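/- arXiv:1703.10953 — 2 statements merged into one kernel-verified Lean document; each statement's English description precedes it below -/
import Mathlib

section
/- Fix ε > 0. Then as N → ∞, the number of ordered pairs (a, b) of positive integers with 1 < ab ≤ N, a² + b² prime, P(ab) > N^{1/log log N}, and ω(a) > (1 + ε) log log N is o(N); that is, for every δ > 0 this count is at most δ · N for all sufficiently large real N. -/
open Real

/-- The largest prime factor of `n`, with the convention that `P(1) = 1`. -/
def maxPrimeFac (n : ℕ) : ℕ := if n ≤ 1 then 1 else n.primeFactors.sup id

theorem tsum_prime_pow_div_le_exp {g : ℕ → ℝ} (h1 : g 1 = 1) (hnn : ∀ n, 0 ≤ g n) {B : ℝ}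
    {p : ℕ} (hp : p.Prime) (hB : ∀ k : ℕ, g (p ^ k) ≤ B * (k + 1)) :
    Summable (fun k : ℕ => g (p ^ k) / ((p ^ k : ℕ) : ℝ)) ∧
      ∑' k : ℕ, g (p ^ k) / ((p ^ k : ℕ) : ℝ) ≤ exp (g p / p + 8 * B * ((p : ℝ) ^ 2)⁻¹) := by
  have hp2 : (2 : ℝ) ≤ p := by exact_mod_cast hp.two_le
  have hB0 : 0 ≤ B := by
    have := hB 0
    simp only [pow_zero, h1, Nat.cast_zero, zero_add, mul_one] at this
    linarith
  set x : ℝ := (p : ℝ)⁻¹ with hx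
  have hx0 : 0 < x := by positivity
  have hx2 : x ≤ 1 / 2 := by
    rw [hx, inv_le_comm₀ (by positivity) (by norm_num)]
    simpa using hp2
  have hxn : ‖x‖ < 1 := by
    rw [Real.norm_of_nonneg hx0.le]; linarith
  have hgeo : HasSum (fun k : ℕ => B * x ^ 2 * ((k : ℝ) * x ^ k + 3 * x ^ k))
      (B * x ^ 2 * (x / (1 - x) ^ 2 + 3 * (1 - x)⁻¹)) :=
    ((hasSum_coe_mul_geometric_of_norm_lt_one hxn).add
      ((hasSum_geometric_of_norm_lt_one hxn).mul_left 3)).mul_left _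
  have hle : ∀ k : ℕ, g (p ^ (k + 2)) / ((p ^ (k + 2) : ℕ) : ℝ) ≤
      B * x ^ 2 * ((k : ℝ) * x ^ k + 3 * x ^ k) := by
    intro k
    have h := hB (k + 2)
    have e : (((p ^ (k + 2) : ℕ) : ℝ))⁻¹ = x ^ k * x ^ 2 := by
      push_cast; rw [hx, ← pow_add, inv_pow]
    rw [div_eq_mul_inv, e]
    calc g (p ^ (k + 2)) * (x ^ k * x ^ 2) ≤ (B * ((k + 2 : ℕ) + 1)) * (x ^ k * x ^ 2) := by
          gcongr
      _ = _ := by push_cast; ring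
  have hs2 : Summable (fun k : ℕ => g (p ^ (k + 2)) / ((p ^ (k + 2) : ℕ) : ℝ)) :=
    Summable.of_nonneg_of_le (fun k => div_nonneg (hnn _) (by positivity)) hle hgeo.summable
  have hs : Summable (fun k : ℕ => g (p ^ k) / ((p ^ k : ℕ) : ℝ)) :=
    (summable_nat_add_iff 2).1 hs2
  refine ⟨hs, ?_⟩
  rw [← hs.sum_add_tsum_nat_add 2]
  have h3 := hs2.tsum_le_tsum hle hgeo.summable
  rw [hgeo.tsum_eq] at h3
  have h4 : x / (1 - x) ^ 2 + 3 * (1 - x)⁻¹ ≤ 8 := by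
    have h5 : (1 - x)⁻¹ ≤ 2 := by
      rw [inv_le_comm₀ (by linarith) (by norm_num)]; linarith
    have h6 : 0 < (1 - x)⁻¹ := by
      have : 0 < 1 - x := by linarith
      positivity
    have h7 : x / (1 - x) ^ 2 = x * ((1 - x)⁻¹ * (1 - x)⁻¹) := by
      rw [div_eq_mul_inv, ← inv_pow, sq]
    rw [h7]
    nlinarith [mul_le_mul h5 h5 h6.le (by norm_num), mul_pos h6 h6]
  have h8 : B * x ^ 2 * (x / (1 - x) ^ 2 + 3 * (1 - x)⁻¹) ≤ 8 * B * x ^ 2 := by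
    nlinarith [mul_nonneg hB0 (sq_nonneg x)]
  have h9 := add_one_le_exp (g p / p + 8 * B * ((p : ℝ) ^ 2)⁻¹)
  have h10 : ((p : ℝ) ^ 2)⁻¹ = x ^ 2 := by rw [hx, inv_pow]
  rw [h10] at h9 ⊢
  simp only [Finset.sum_range_succ, Finset.sum_range_zero, pow_zero, pow_one, h1, Nat.cast_one,
    div_one, zero_add]
  linarith

/-- A Rankin-type bound: a nonnegative multiplicative function whose values at the prime powers
`p ^ k` are at most `B * (k + 1)` satisfies `∑_{n ≤ M} g n / n ≤ exp (∑_{p ≤ M} g p / p + 8 * B)`. -/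
theorem sum_div_le_exp_sum_primesBelow {g : ℕ → ℝ} (h1 : g 1 = 1)
    (hmul : ∀ {m n : ℕ}, m.Coprime n → g (m * n) = g m * g n) (hnn : ∀ n, 0 ≤ g n) {B : ℝ}
    (hB : ∀ p k : ℕ, p.Prime → g (p ^ k) ≤ B * (k + 1)) (M : ℕ) :
    ∑ n ∈ Finset.Icc 1 M, g n / n ≤ exp (∑ p ∈ (M + 1).primesBelow, g p / p + 8 * B) := by
  have hB0 : 0 ≤ B := by
    have := hB 2 0 Nat.prime_two
    simp only [pow_zero, h1, Nat.cast_zero, zero_add, mul_one] at this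
    linarith
  obtain ⟨hs, hS⟩ := EulerProduct.summable_and_hasSum_smoothNumbers_prod_primesBelow_tsum
    (f := fun n : ℕ => g n / (n : ℝ)) (by simp [h1])
    (fun {m n} hmn => by
      simp only [hmul hmn, Nat.cast_mul]; rw [mul_div_mul_comm])
    (fun {p} hp => (tsum_prime_pow_div_le_exp h1 hnn hp (fun k => hB p k hp)).1.norm) (M + 1)
  have hmem : ∀ n ∈ Finset.Icc 1 M, n ∈ (M + 1).smoothNumbers := by
    intro n hn
    rw [Finset.mem_Icc] at hn
    exact Nat.mem_smoothNumbers_of_lt hn.1 (by omega)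
  calc ∑ n ∈ Finset.Icc 1 M, g n / n
      ≤ ∏ p ∈ (M + 1).primesBelow, ∑' k : ℕ, g (p ^ k) / ((p ^ k : ℕ) : ℝ) := by
        rw [← hS.tsum_eq, ← Finset.sum_subtype_of_mem (fun n : ℕ => g n / (n : ℝ)) hmem]
        exact hS.summable.sum_le_tsum _ (fun i _ => div_nonneg (hnn _) (by positivity))
    _ ≤ ∏ p ∈ (M + 1).primesBelow, exp (g p / p + 8 * B * ((p : ℝ) ^ 2)⁻¹) := by
        refine Finset.prod_le_prod (fun p _ => tsum_nonneg fun k =>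
          div_nonneg (hnn _) (by positivity)) fun p hp => ?_
        have hpp := Nat.prime_of_mem_primesBelow hp
        exact (tsum_prime_pow_div_le_exp h1 hnn hpp (fun k => hB p k hpp)).2
    _ = exp (∑ p ∈ (M + 1).primesBelow, g p / p +
          8 * B * ∑ p ∈ (M + 1).primesBelow, ((p : ℝ) ^ 2)⁻¹) := by
        rw [← exp_sum, Finset.sum_add_distrib, Finset.mul_sum]
    _ ≤ _ := by
        have h2 : ∑ p ∈ (M + 1).primesBelow, ((p : ℝ) ^ 2)⁻¹ ≤ 1 := by
          calc ∑ p ∈ (M + 1).primesBelow, ((p : ℝ) ^ 2)⁻¹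
              ≤ ∑ i ∈ Finset.Ioo 1 (M + 1), ((i : ℝ) ^ 2)⁻¹ := by
                refine Finset.sum_le_sum_of_subset_of_nonneg (fun p hp => ?_)
                  fun _ _ _ => by positivity
                have := (Nat.prime_of_mem_primesBelow hp).one_lt
                exact Finset.mem_Ioo.2 ⟨this, Nat.lt_of_mem_primesBelow hp⟩
            _ ≤ 2 / ((1 : ℕ) + 1) := sum_Ioo_inv_sq_le 1 (M + 1)
            _ = 1 := by norm_num
        have h3 := mul_le_mul_of_nonneg_left h2 (by positivity : 0 ≤ 8 * B)
        exact exp_le_exp.2 (by linarith)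

/-- Lower bound in Mertens' second theorem. -/
theorem log_log_sub_le_sum_inv_primesBelow {M : ℕ} (hM : 1 ≤ M) :
    log (log (M + 1)) - 8 ≤ ∑ p ∈ (M + 1).primesBelow, (1 : ℝ) / p := by
  have h := sum_div_le_exp_sum_primesBelow (g := fun _ => 1) rfl (by simp) (by simp) (B := 1)
    (by intro p k _; simp) M
  have h2 : log (M + 1) ≤ ∑ n ∈ Finset.Icc 1 M, (1 : ℝ) / n := by
    have := log_add_one_le_harmonic M
    rw [harmonic_eq_sum_Icc] at this
    push_cast at this
    simpa using this
  have hpos : 0 < log ((M : ℝ) + 1) := log_pos (by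
    have : (1 : ℝ) ≤ M := by exact_mod_cast hM
    linarith)
  have h3 := log_le_log hpos (h2.trans h)
  rw [log_exp] at h3
  linarith

theorem χ₄_natCast_real_eq (n : ℕ) :
    ((ZMod.χ₄ n : ℤ) : ℝ) = if n % 2 = 0 then 0 else if n % 4 = 1 then 1 else -1 := by
  rw [ZMod.χ₄_nat_eq_if_mod_four]
  split_ifs <;> simp

theorem two_thirds_le_sum_χ₄_div {K : ℕ} (hK : 1 ≤ K) :
    2 / 3 ≤ ∑ d ∈ Finset.Ioc 0 K, ((ZMod.χ₄ d : ℤ) : ℝ) / d := by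
  have e1 : ∀ j : ℕ, ((ZMod.χ₄ (4 * j + 5 : ℕ) : ℤ) : ℝ) = 1 := fun j => by
    rw [χ₄_natCast_real_eq, if_neg (by omega), if_pos (by omega)]
  have e2 : ∀ j : ℕ, ((ZMod.χ₄ (4 * j + 6 : ℕ) : ℤ) : ℝ) = 0 := fun j => by
    rw [χ₄_natCast_real_eq, if_pos (by omega)]
  have e3 : ∀ j : ℕ, ((ZMod.χ₄ (4 * j + 7 : ℕ) : ℤ) : ℝ) = -1 := fun j => by
    rw [χ₄_natCast_real_eq, if_neg (by omega), if_neg (by omega)]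
  have e4 : ∀ j : ℕ, ((ZMod.χ₄ (4 * j + 8 : ℕ) : ℤ) : ℝ) = 0 := fun j => by
    rw [χ₄_natCast_real_eq, if_pos (by omega)]
  have hle : ∀ j : ℕ, (1 : ℝ) / ((4 * j + 7 : ℕ) : ℝ) ≤ 1 / ((4 * j + 5 : ℕ) : ℝ) := fun j => by
    apply one_div_le_one_div_of_le <;> push_cast <;> linarith [Nat.cast_nonneg (α := ℝ) j]
  have key : ∀ j : ℕ, 2 / 3 ≤ ∑ d ∈ Finset.range (4 * j + 5), ((ZMod.χ₄ d : ℤ) : ℝ) / d := by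
    intro j
    induction j with
    | zero =>
      simp only [Finset.sum_range_succ, Finset.sum_range_zero, χ₄_natCast_real_eq]
      norm_num
    | succ j ih =>
      rw [show 4 * (j + 1) + 5 = 4 * j + 8 + 1 by ring, Finset.sum_range_succ,
        Finset.sum_range_succ _ (4 * j + 7), Finset.sum_range_succ _ (4 * j + 6),
        Finset.sum_range_succ _ (4 * j + 5), e1, e2, e3, e4, neg_div, zero_div, zero_div]
      linarith [hle j]
  have hr : ∑ d ∈ Finset.Ioc 0 K, ((ZMod.χ₄ d : ℤ) : ℝ) / d =
      ∑ d ∈ Finset.range (K + 1), ((ZMod.χ₄ d : ℤ) : ℝ) / d := by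
    rw [Finset.range_eq_Ico, Finset.sum_eq_sum_Ico_succ_bot (by omega)]
    simp only [Nat.cast_zero, div_zero, zero_add]
    rfl
  rw [hr]
  by_cases h4 : K < 4
  · interval_cases K <;>
    · simp only [Finset.sum_range_succ, Finset.sum_range_zero, χ₄_natCast_real_eq]
      norm_num
  · obtain ⟨j, i, hi, rfl⟩ : ∃ j i : ℕ, i < 4 ∧ K = 4 * j + 4 + i :=
      ⟨K / 4 - 1, K % 4, by omega, by omega⟩
    have h := key j
    have hpos : (0 : ℝ) ≤ 1 / ((4 * j + 5 : ℕ) : ℝ) := by positivity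
    interval_cases i
    · exact h
    · rw [Finset.sum_range_succ, e1]; exact h.trans (by linarith)
    · rw [Finset.sum_range_succ _ (4 * j + 6), e2, Finset.sum_range_succ, e1, zero_div]
      exact h.trans (by linarith)
    · rw [Finset.sum_range_succ _ (4 * j + 7), e3, Finset.sum_range_succ _ (4 * j + 6), e2,
        Finset.sum_range_succ, e1, neg_div, zero_div]
      exact h.trans (by linarith [hle j])

/-- A quarter of the number of representations of `n` as a sum of two squares. -/
noncomputable def sumDivisorsχ₄ (n : ℕ) : ℝ := ∑ d ∈ n.divisors, ((ZMod.χ₄ d : ℤ) : ℝ)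

theorem sumDivisorsχ₄_mul {m n : ℕ} (h : m.Coprime n) :
    sumDivisorsχ₄ (m * n) = sumDivisorsχ₄ m * sumDivisorsχ₄ n := by
  obtain ⟨f, hf⟩ : ∃ f : ArithmeticFunction ℝ, ∀ d : ℕ, f d = ((ZMod.χ₄ d : ℤ) : ℝ) :=
    ⟨⟨fun d => ((ZMod.χ₄ d : ℤ) : ℝ), by simp⟩, fun _ => rfl⟩
  have hmul : f.IsMultiplicative :=
    ⟨by simp [hf], fun {a b} _ => by simp only [hf, Nat.cast_mul, map_mul, Int.cast_mul]⟩
  have e : ∀ k, sumDivisorsχ₄ k = ((ArithmeticFunction.zeta : ArithmeticFunction ℝ) * f) k :=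
    fun k => by
      rw [ArithmeticFunction.coe_zeta_mul_apply]
      exact Finset.sum_congr rfl fun d _ => (hf d).symm
  rw [e, e, e]
  exact (ArithmeticFunction.isMultiplicative_zeta.natCast.mul hmul).2 h

theorem sumDivisorsχ₄_prime_pow {p : ℕ} (hp : p.Prime) (k : ℕ) :
    sumDivisorsχ₄ (p ^ k) = ∑ i ∈ Finset.range (k + 1), ((ZMod.χ₄ p : ℤ) : ℝ) ^ i := by
  rw [sumDivisorsχ₄, Nat.sum_divisors_prime_pow hp]
  simp only [Nat.cast_pow, map_pow, Int.cast_pow]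

theorem sumDivisorsχ₄_prime_pow_nonneg {p : ℕ} (hp : p.Prime) (k : ℕ) :
    0 ≤ sumDivisorsχ₄ (p ^ k) := by
  rw [sumDivisorsχ₄_prime_pow hp, χ₄_natCast_real_eq]
  split_ifs
  · exact Finset.sum_nonneg fun i _ => by positivity
  · exact Finset.sum_nonneg fun i _ => by positivity
  · rw [neg_one_geom_sum]; split_ifs <;> norm_num

theorem sumDivisorsχ₄_nonneg (n : ℕ) : 0 ≤ sumDivisorsχ₄ n := by
  induction n using Nat.recOnPosPrimePosCoprime with
  | prime_pow p k hp _ => exact sumDivisorsχ₄_prime_pow_nonneg hp k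
  | zero => simp [sumDivisorsχ₄]
  | one => simp [sumDivisorsχ₄]
  | coprime a b _ _ hab ha hb => rw [sumDivisorsχ₄_mul hab]; exact mul_nonneg ha hb

theorem sumDivisorsχ₄_prime {p : ℕ} (hp : p.Prime) :
    sumDivisorsχ₄ p = 1 + ((ZMod.χ₄ p : ℤ) : ℝ) := by
  have := sumDivisorsχ₄_prime_pow hp 1
  simpa [Finset.sum_range_succ] using this

theorem sumDivisorsχ₄_prime_pow_le {p : ℕ} (hp : p.Prime) (k : ℕ) :
    sumDivisorsχ₄ (p ^ k) ≤ 1 * ((k : ℝ) + 1) := by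
  rw [sumDivisorsχ₄_prime_pow hp]
  calc ∑ i ∈ Finset.range (k + 1), ((ZMod.χ₄ p : ℤ) : ℝ) ^ i
      ≤ ∑ i ∈ Finset.range (k + 1), (1 : ℝ) := by
        refine Finset.sum_le_sum fun i _ => (le_abs_self _).trans ?_
        rw [abs_pow]
        refine pow_le_one₀ (abs_nonneg _) ?_
        rw [χ₄_natCast_real_eq]
        split_ifs <;> norm_num
    _ = _ := by simp

theorem log_le_sum_sumDivisorsχ₄_div (M : ℕ) :
    2 / 3 * log (M + 1) ≤ ∑ n ∈ Finset.Icc 1 M, sumDivisorsχ₄ n / n := by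
  set u : ArithmeticFunction ℝ := ⟨fun n => (n : ℝ)⁻¹, by simp⟩ with hu
  set v : ArithmeticFunction ℝ := ⟨fun n => ((ZMod.χ₄ n : ℤ) : ℝ) / n, by simp⟩ with hv
  have huv : ∀ n : ℕ, sumDivisorsχ₄ n / n = (u * v) n := by
    intro n
    rw [ArithmeticFunction.mul_apply, sumDivisorsχ₄, Finset.sum_div,
      ← Nat.sum_divisorsAntidiagonal' (fun _ d => ((ZMod.χ₄ d : ℤ) : ℝ) / n)]
    refine Finset.sum_congr rfl fun x hx => ?_
    have := (Nat.mem_divisorsAntidiagonal.1 hx).1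
    rw [← this]
    simp only [hu, hv, ArithmeticFunction.coe_mk, Nat.cast_mul, div_eq_mul_inv, mul_inv]
    ring
  have hI : Finset.Icc 1 M = Finset.Ioc 0 M := rfl
  rw [Finset.sum_congr rfl fun n _ => huv n, hI, ArithmeticFunction.sum_Ioc_mul_eq_sum_sum]
  have h2 : log (M + 1) ≤ ∑ n ∈ Finset.Ioc 0 M, (n : ℝ)⁻¹ := by
    have := log_add_one_le_harmonic M
    rw [harmonic_eq_sum_Icc] at this
    push_cast at this
    exact this
  calc 2 / 3 * log (M + 1) ≤ 2 / 3 * ∑ n ∈ Finset.Ioc 0 M, (n : ℝ)⁻¹ := by linarith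
    _ = ∑ n ∈ Finset.Ioc 0 M, (n : ℝ)⁻¹ * (2 / 3) := by rw [mul_comm, Finset.sum_mul]
    _ ≤ _ := by
      refine Finset.sum_le_sum fun n hn => ?_
      rw [Finset.mem_Ioc] at hn
      exact mul_le_mul_of_nonneg_left
        (two_thirds_le_sum_χ₄_div (Nat.div_pos hn.2 hn.1)) (by positivity)

/-- The sum over primes of the local densities of `n * (n ^ 2 + 1)`, up to the factor at `2`. -/
theorem two_mul_log_log_sub_le_sum_primesBelow {M : ℕ} (hM : 1 ≤ M) :
    2 * log (log (M + 1)) - 17 ≤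
      ∑ p ∈ (M + 1).primesBelow, (2 + ((ZMod.χ₄ p : ℤ) : ℝ)) / p := by
  have h := sum_div_le_exp_sum_primesBelow (g := sumDivisorsχ₄) (by simp [sumDivisorsχ₄])
    sumDivisorsχ₄_mul sumDivisorsχ₄_nonneg (fun p k hp => sumDivisorsχ₄_prime_pow_le hp k) M
  have hpos : 0 < log ((M : ℝ) + 1) := log_pos (by
    have : (1 : ℝ) ≤ M := by exact_mod_cast hM
    linarith)
  have h3 := log_le_log (by positivity) ((log_le_sum_sumDivisorsχ₄_div M).trans h)
  rw [log_exp, log_mul (by norm_num) hpos.ne'] at h3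
  have h4 : -1 ≤ log (2 / 3 : ℝ) := by
    rw [le_log_iff_exp_le (by norm_num)]
    have := exp_one_gt_d9
    rw [exp_neg, inv_le_comm₀ (exp_pos _) (by norm_num)]
    linarith
  have h5 := log_log_sub_le_sum_inv_primesBelow hM
  have h6 : ∑ p ∈ (M + 1).primesBelow, (2 + ((ZMod.χ₄ p : ℤ) : ℝ)) / p =
      ∑ p ∈ (M + 1).primesBelow, (1 : ℝ) / p +
        ∑ p ∈ (M + 1).primesBelow, sumDivisorsχ₄ p / p := by
    rw [← Finset.sum_add_distrib]
    refine Finset.sum_congr rfl fun p hp => ?_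
    rw [sumDivisorsχ₄_prime (Nat.prime_of_mem_primesBelow hp)]
    ring
  rw [h6]
  linarith

theorem sum_pow_card_primeFactors_div_le {t : ℝ} (ht : 1 ≤ t) (M : ℕ) :
    ∑ n ∈ Finset.Icc 1 M, t ^ n.primeFactors.card / (n : ℝ) ≤
      exp (t * ∑ p ∈ (M + 1).primesBelow, (1 : ℝ) / p + 8 * t) := by
  have h := sum_div_le_exp_sum_primesBelow (g := fun n => t ^ n.primeFactors.card) (by simp)
    (fun {m n} hmn => by
      simp only [hmn.primeFactors_mul, Finset.card_union_of_disjoint hmn.disjoint_primeFactors,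
        pow_add])
    (fun n => by positivity) (B := t)
    (by
      intro p k hp
      rcases Nat.eq_zero_or_pos k with rfl | hk
      · simpa using ht
      · simp only [Nat.primeFactors_prime_pow hk.ne' hp, Finset.card_singleton, pow_one]
        nlinarith [Nat.cast_nonneg (α := ℝ) k]) M
  have e : ∑ p ∈ (M + 1).primesBelow, t ^ p.primeFactors.card / (p : ℝ) =
      t * ∑ p ∈ (M + 1).primesBelow, (1 : ℝ) / p := by
    rw [Finset.mul_sum]
    refine Finset.sum_congr rfl fun p hp => ?_
    rw [(Nat.prime_of_mem_primesBelow hp).primeFactors]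
    simp [div_eq_mul_inv]
  rwa [e] at h

theorem sum_primesBelow_rpow_neg_le {s : ℝ} (hs : 1 < s) (n : ℕ) :
    ∑ p ∈ n.primesBelow, (p : ℝ) ^ (-s) ≤ log (∑' m : ℕ, 1 / (m : ℝ) ^ s) := by
  obtain ⟨f, hf⟩ : ∃ f : ℕ →* ℝ, ∀ m : ℕ, f m = (m : ℝ) ^ (-s) :=
    ⟨{ toFun := fun m => (m : ℝ) ^ (-s)
       map_one' := by simp
       map_mul' := fun a b => by
        push_cast
        exact mul_rpow (Nat.cast_nonneg a) (Nat.cast_nonneg b) }, fun _ => rfl⟩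
  have hf1 : ∀ m : ℕ, f m = 1 / (m : ℝ) ^ s := fun m => by
    rw [hf, rpow_neg (Nat.cast_nonneg m), one_div]
  have hlt : ∀ {p : ℕ}, p.Prime → ‖f p‖ < 1 := fun {p} hp => by
    rw [hf, norm_of_nonneg (by positivity)]
    exact rpow_lt_one_of_one_lt_of_neg (by exact_mod_cast hp.one_lt) (by linarith)
  obtain ⟨-, hS⟩ := EulerProduct.summable_and_hasSum_smoothNumbers_prod_primesBelow_geometric hlt n
  have hsum : Summable (fun m : ℕ => 1 / (m : ℝ) ^ s) := summable_one_div_nat_rpow.2 hs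
  have hsum' : Summable f := by
    have : (f : ℕ → ℝ) = fun m : ℕ => 1 / (m : ℝ) ^ s := funext hf1
    rw [this]; exact hsum
  have hprod : ∏ p ∈ n.primesBelow, (1 - f p)⁻¹ ≤ ∑' m : ℕ, 1 / (m : ℝ) ^ s := by
    rw [← hS.tsum_eq, ← tsum_congr hf1]
    exact hsum'.tsum_subtype_le f _ (fun m => by rw [hf]; positivity)
  have hexp : exp (∑ p ∈ n.primesBelow, (p : ℝ) ^ (-s)) ≤ ∏ p ∈ n.primesBelow, (1 - f p)⁻¹ := by
    rw [exp_sum]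
    refine Finset.prod_le_prod (fun _ _ => (exp_pos _).le) fun p hp => ?_
    have h1 := hlt (Nat.prime_of_mem_primesBelow hp)
    have h2 := (le_abs_self _).trans_lt h1
    rw [← hf, le_inv_comm₀ (exp_pos _) (by linarith), ← exp_neg]
    exact one_sub_le_exp_neg _
  rw [le_log_iff_exp_le]
  · exact hexp.trans hprod
  · exact (exp_pos _).trans_le (hexp.trans hprod)

open Filter Topology in
/-- A weak form of the upper bound in Mertens' second theorem. -/
theorem eventually_sum_inv_primesBelow_le {η : ℝ} (hη : 0 < η) :
    ∀ᶠ x : ℝ in atTop,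
      ∑ p ∈ (⌊x⌋₊ + 1).primesBelow, (1 : ℝ) / p ≤ (1 + η) * log (log x) := by
  set κ : ℝ := min η 1 / 4 with hκ
  have hκ0 : 0 < κ := by positivity
  have hκ1 : κ ≤ 1 / 4 := by rw [hκ]; linarith [min_le_right η 1]
  have hκη : 4 * κ ≤ η := by rw [hκ]; linarith [min_le_left η 1]
  have hlog := tendsto_log_atTop
  have hs : Tendsto (fun x : ℝ => 1 + (log x) ^ (-(1 + κ))) atTop (𝓝[>] 1) := by
    refine tendsto_nhdsWithin_iff.2 ⟨?_, ?_⟩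
    · have := ((tendsto_rpow_neg_atTop (by linarith : 0 < 1 + κ)).comp hlog).const_add 1
      simpa using this
    · filter_upwards [hlog.eventually_gt_atTop 0] with x hx
      exact lt_add_of_pos_right _ (rpow_pos_of_pos hx _)
  have h1 : ∀ᶠ x : ℝ in atTop, (log x) ^ (-(1 + κ)) *
      ∑' m : ℕ, 1 / (m : ℝ) ^ (1 + (log x) ^ (-(1 + κ))) < 2 := by
    have := (tendsto_sub_mul_tsum_nat_rpow.comp hs).eventually_lt_const (by norm_num : (1 : ℝ) < 2)
    filter_upwards [this] with x hx
    simpa using hx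
  have h2 : ∀ᶠ x : ℝ in atTop, exp ((log x) ^ (-κ)) < 1 + κ := by
    have := (continuous_exp.tendsto 0).comp ((tendsto_rpow_neg_atTop hκ0).comp hlog)
    exact this.eventually_lt_const (by rw [exp_zero]; linarith)
  have h3 : ∀ᶠ x : ℝ in atTop, 4 / κ ≤ log (log x) :=
    (hlog.comp hlog).eventually_ge_atTop _
  filter_upwards [h1, h2, h3, hlog.eventually_gt_atTop 0, eventually_gt_atTop 1]
    with x h1 h2 h3 hl hx
  set e : ℝ := (log x) ^ (-(1 + κ)) with he
  have he0 : 0 < e := rpow_pos_of_pos hl _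
  have hE := sum_primesBelow_rpow_neg_le (by linarith : 1 < 1 + e) (⌊x⌋₊ + 1)
  have hE0 : (0 : ℝ) < ∑' m : ℕ, 1 / (m : ℝ) ^ (1 + e) := by
    refine (summable_one_div_nat_rpow.2 (by linarith)).tsum_pos (fun m => by positivity) 1 ?_
    simp
  have hL : log (∑' m : ℕ, 1 / (m : ℝ) ^ (1 + e)) ≤ log 2 + (1 + κ) * log (log x) := by
    have h4 : ∑' m : ℕ, 1 / (m : ℝ) ^ (1 + e) ≤ 2 * (log x) ^ (1 + κ) := by
      have h5 : e * (log x) ^ (1 + κ) = 1 := by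
        rw [he, ← rpow_add hl]; simp
      have h6 := mul_le_mul_of_nonneg_right h1.le (rpow_nonneg hl.le (1 + κ))
      calc _ = (e * (log x) ^ (1 + κ)) * ∑' m : ℕ, 1 / (m : ℝ) ^ (1 + e) := by rw [h5, one_mul]
        _ ≤ _ := by linarith
    have h7 := log_le_log hE0 h4
    rwa [log_mul (by norm_num) (rpow_pos_of_pos hl _).ne', log_rpow hl] at h7
  have hterm : ∑ p ∈ (⌊x⌋₊ + 1).primesBelow, (1 : ℝ) / p ≤
      (1 + κ) * ∑ p ∈ (⌊x⌋₊ + 1).primesBelow, (p : ℝ) ^ (-(1 + e)) := by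
    rw [Finset.mul_sum]
    refine Finset.sum_le_sum fun p hp => ?_
    have hpp := (Nat.prime_of_mem_primesBelow hp).pos
    have hp0 : (0 : ℝ) < p := by exact_mod_cast hpp
    have hpx : (p : ℝ) ≤ x :=
      (Nat.le_floor_iff (by linarith)).1 (Nat.lt_succ_iff.1 (Nat.lt_of_mem_primesBelow hp))
    have h8 : (1 : ℝ) / p = (p : ℝ) ^ e * (p : ℝ) ^ (-(1 + e)) := by
      rw [← rpow_add hp0, show e + -(1 + e) = -1 by ring, rpow_neg_one, one_div]
    rw [h8]
    refine mul_le_mul_of_nonneg_right ?_ (by positivity)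
    refine le_trans ?_ h2.le
    rw [rpow_def_of_pos hp0, exp_le_exp]
    calc log p * e ≤ log x * e := by
          gcongr
      _ = (log x) ^ (-κ) := by
          rw [he]
          nth_rewrite 1 [← rpow_one (log x)]
          rw [← rpow_add hl]
          congr 1; ring
  have h9 : (1 + κ) * ∑ p ∈ (⌊x⌋₊ + 1).primesBelow, (p : ℝ) ^ (-(1 + e)) ≤
      (1 + κ) * (log 2 + (1 + κ) * log (log x)) :=
    mul_le_mul_of_nonneg_left (hE.trans hL) (by linarith)
  refine (hterm.trans h9).trans ?_
  have h10 : 4 ≤ κ * log (log x) := by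
    rwa [div_le_iff₀' hκ0] at h3
  have h11 : log 2 ≤ 1 := by linarith [log_two_lt_d9]
  have h12 : 0 < log (log x) := by
    by_contra h
    nlinarith
  nlinarith [mul_le_mul_of_nonneg_right hκη h12.le,
    mul_nonneg (by linarith : (0 : ℝ) ≤ 1 / 4 - κ) (mul_nonneg hκ0.le h12.le)]

theorem abs_card_filter_modEq_sub_le {Q : ℕ} (hQ : 0 < Q) (a X : ℕ) :
    |(((Finset.range X).filter fun n => n ≡ a [MOD Q]).card : ℝ) - X / Q| ≤ 1 := by
  rw [← Nat.count_eq_card_filter_range, Nat.count_modEq_card _ hQ]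
  have hQ' : (0 : ℝ) < Q := by exact_mod_cast hQ
  have h1 : (X : ℝ) / Q = (X / Q : ℕ) + ((X % Q : ℕ) : ℝ) / Q := by
    have : (X : ℝ) = Q * (X / Q : ℕ) + (X % Q : ℕ) := by exact_mod_cast (Nat.div_add_mod X Q).symm
    rw [this]
    field_simp
  have h2 : ((X % Q : ℕ) : ℝ) / Q < 1 := by
    rw [div_lt_one hQ']; exact_mod_cast Nat.mod_lt X hQ
  have h3 : (0 : ℝ) ≤ ((X % Q : ℕ) : ℝ) / Q := by positivity
  rw [h1, abs_le]
  split_ifs <;> push_cast <;> constructor <;> linarith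

/-- Counting the `n < X` in a residue class modulo `Q` which fall into prescribed sets of residue
classes modulo the primes in `D`. -/
theorem abs_card_filter_residues_sub_le {D : Finset ℕ} {Ω : ℕ → Finset ℕ} (X : ℕ)
    (hD : ∀ q ∈ D, q.Prime) (hΩ : ∀ q ∈ D, Ω q ⊆ Finset.range q) {Q : ℕ} (hQ : 0 < Q) (a : ℕ)
    (hQD : ∀ q ∈ D, Q.Coprime q) :
    |(((Finset.range X).filter fun n => n ≡ a [MOD Q] ∧ ∀ q ∈ D, n % q ∈ Ω q).card : ℝ) -
      X / Q * ∏ q ∈ D, ((Ω q).card : ℝ) / q| ≤ ∏ q ∈ D, ((Ω q).card : ℝ) := by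
  induction D using Finset.induction_on generalizing Q a with
  | empty => simpa using abs_card_filter_modEq_sub_le hQ a X
  | insert p D hp ih =>
    have hpp := hD p (Finset.mem_insert_self _ _)
    have hcop := hQD p (Finset.mem_insert_self _ _)
    have hsplit : ((Finset.range X).filter fun n => n ≡ a [MOD Q] ∧
        ∀ q ∈ insert p D, n % q ∈ Ω q) = (Ω p).biUnion fun b => (Finset.range X).filter fun n =>
          n ≡ (Nat.chineseRemainder hcop a b : ℕ) [MOD Q * p] ∧ ∀ q ∈ D, n % q ∈ Ω q := by
      ext n
      simp only [Finset.mem_filter, Finset.mem_biUnion, Finset.forall_mem_insert]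
      constructor
      · rintro ⟨hn, ha, hb, hD'⟩
        exact ⟨n % p, hb, hn, Nat.chineseRemainder_modEq_unique hcop ha (Nat.mod_modEq n p).symm, hD'⟩
      · rintro ⟨b, hb, hn, hc, hD'⟩
        have h1 := (hc.of_mul_right p).trans (Nat.chineseRemainder hcop a b).2.1
        have h2 := (hc.of_mul_left Q).trans (Nat.chineseRemainder hcop a b).2.2
        refine ⟨hn, h1, ?_, hD'⟩
        have hb' := Finset.mem_range.1 (hΩ p (Finset.mem_insert_self _ _) hb)
        have h3 : n % p = b := by
          have : n % p = b % p := h2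
          rwa [Nat.mod_eq_of_lt hb'] at this
        rwa [h3]
    have hdisj : ∀ b ∈ Ω p, ∀ b' ∈ Ω p, b ≠ b' → Disjoint
        ((Finset.range X).filter fun n =>
          n ≡ (Nat.chineseRemainder hcop a b : ℕ) [MOD Q * p] ∧ ∀ q ∈ D, n % q ∈ Ω q)
        ((Finset.range X).filter fun n =>
          n ≡ (Nat.chineseRemainder hcop a b' : ℕ) [MOD Q * p] ∧ ∀ q ∈ D, n % q ∈ Ω q) := by
      intro b hb b' hb' hne
      rw [Finset.disjoint_left]
      intro n hn hn'
      have h2 := ((Finset.mem_filter.1 hn).2.1.of_mul_left Q).trans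
        (Nat.chineseRemainder hcop a b).2.2
      have h2' := ((Finset.mem_filter.1 hn').2.1.of_mul_left Q).trans
        (Nat.chineseRemainder hcop a b').2.2
      have hlt := Finset.mem_range.1 (hΩ p (Finset.mem_insert_self _ _) hb)
      have hlt' := Finset.mem_range.1 (hΩ p (Finset.mem_insert_self _ _) hb')
      exact hne ((h2.symm.trans h2').eq_of_lt_of_lt hlt hlt')
    rw [hsplit, Finset.card_biUnion hdisj, Finset.prod_insert hp, Finset.prod_insert hp]
    have hQp : 0 < Q * p := Nat.mul_pos hQ hpp.pos
    have hstep := fun b : ℕ => ih (fun q hq => hD q (Finset.mem_insert_of_mem hq))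
      (fun q hq => hΩ q (Finset.mem_insert_of_mem hq)) hQp (Nat.chineseRemainder hcop a b : ℕ)
      (fun q hq => (hQD q (Finset.mem_insert_of_mem hq)).mul_left
        ((Nat.coprime_primes hpp (hD q (Finset.mem_insert_of_mem hq))).2
          (fun h => hp (h ▸ hq))))
    have e : (X : ℝ) / Q * (((Ω p).card : ℝ) / p * ∏ q ∈ D, ((Ω q).card : ℝ) / q) =
        ∑ b ∈ Ω p, (X : ℝ) / ((Q * p : ℕ) : ℝ) * ∏ q ∈ D, ((Ω q).card : ℝ) / q := by
      rw [Finset.sum_const, nsmul_eq_mul]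
      push_cast
      rw [← div_div]
      ring
    rw [e]
    push_cast
    rw [← Finset.sum_sub_distrib]
    refine (Finset.abs_sum_le_sum_abs _ _).trans ?_
    calc _ ≤ ∑ b ∈ Ω p, ∏ q ∈ D, ((Ω q).card : ℝ) := Finset.sum_le_sum fun b _ => by
            have := hstep b
            push_cast at this
            exact this
      _ = _ := by rw [Finset.sum_const, nsmul_eq_mul]

/-- One half of the Bonferroni inequalities. -/
theorem ite_eq_empty_le_sum_powerset {α : Type*} (T : Finset α) (r : ℕ) [Decidable (T = ∅)] :
    (if T = ∅ then (1 : ℝ) else 0) ≤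
      ∑ D ∈ T.powerset, if D.card ≤ 2 * r then (-1 : ℝ) ^ D.card else 0 := by
  rw [Finset.sum_powerset_apply_card (fun j => if j ≤ 2 * r then (-1 : ℝ) ^ j else 0)]
  rcases Nat.eq_zero_or_pos T.card with h0 | hpos
  · rw [Finset.card_eq_zero] at h0
    simp [h0]
  · have hne : T ≠ ∅ := fun h => by simp [h] at hpos
    rw [if_neg hne]
    obtain ⟨t, ht⟩ : ∃ t, T.card = t + 1 := ⟨T.card - 1, by omega⟩
    rw [ht]
    have h1 : ∑ m ∈ Finset.range (t + 1 + 1), (t + 1).choose m •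
        (if m ≤ 2 * r then (-1 : ℝ) ^ m else 0) =
        ∑ m ∈ Finset.range (2 * r + 1), (-1 : ℝ) ^ m * (t + 1).choose m := by
      have h2 : ∀ m : ℕ, (t + 1).choose m • (if m ≤ 2 * r then (-1 : ℝ) ^ m else 0) =
          if m ∈ Finset.range (2 * r + 1) then (-1 : ℝ) ^ m * (t + 1).choose m else 0 := by
        intro m
        simp only [Finset.mem_range, Nat.lt_succ_iff, nsmul_eq_mul]
        split_ifs <;> ring
      have h3 : ∀ m : ℕ, (if m ∈ Finset.range (2 * r + 1) then
          (-1 : ℝ) ^ m * (t + 1).choose m else 0) ≠ 0 → m ∈ Finset.range (t + 1 + 1) := by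
        intro m hm
        by_contra hcon
        rw [Finset.mem_range, not_lt] at hcon
        rw [Nat.choose_eq_zero_of_lt (by omega)] at hm
        simp at hm
      rw [Finset.sum_congr rfl fun m _ => h2 m, ← Finset.sum_filter]
      refine Finset.sum_subset_zero_on_sdiff (fun m hm => (Finset.mem_filter.1 hm).2) ?_
        fun _ _ => rfl
      intro m hm
      rw [Finset.mem_sdiff, Finset.mem_filter] at hm
      by_contra hne
      exact hm.2 ⟨h3 m (by rw [if_pos hm.1]; exact hne), hm.1⟩
    rw [h1]
    have h4 := Int.alternating_sum_range_choose_eq_choose (n := t) (m := 2 * r)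
    have h5 : ∑ m ∈ Finset.range (2 * r + 1), (-1 : ℝ) ^ m * (t + 1).choose m =
        ((-1) ^ (2 * r) * (t.choose (2 * r) : ℝ)) := by exact_mod_cast congrArg (Int.cast (R := ℝ)) h4
    rw [h5, pow_mul]
    simp

theorem sum_powerset_neg_one_pow_mul_prod {α : Type*} (s : Finset α) (g : α → ℝ) :
    ∑ D ∈ s.powerset, (-1 : ℝ) ^ D.card * ∏ q ∈ D, g q = ∏ q ∈ s, (1 - g q) := by
  classical
  simp only [sub_eq_add_neg]
  rw [Finset.prod_one_add]
  refine Finset.sum_congr rfl fun D _ => ?_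
  rw [← Finset.prod_const, ← Finset.prod_mul_distrib]
  exact Finset.prod_congr rfl fun q _ => by ring

theorem prod_one_add_le_exp_sum {α : Type*} (s : Finset α) {g : α → ℝ} (hg : ∀ q ∈ s, 0 ≤ g q) :
    ∏ q ∈ s, (1 + g q) ≤ exp (∑ q ∈ s, g q) := by
  rw [exp_sum]
  refine Finset.prod_le_prod (fun q hq => by have := hg q hq; linarith) fun q _ => ?_
  rw [add_comm]
  exact add_one_le_exp _

theorem sum_powerset_ite_lt_card_prod_le {α : Type*} (s : Finset α) {g : α → ℝ}
    (hg : ∀ q ∈ s, 0 ≤ g q) (k : ℕ) :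
    ∑ D ∈ s.powerset, (if D.card ≤ k then 0 else ∏ q ∈ D, g q) ≤
      exp (3 * ∑ q ∈ s, g q - k) := by
  classical
  have hE : exp 1 ≤ 3 := by have := exp_one_lt_d9; linarith
  calc _ ≤ ∑ D ∈ s.powerset, exp (-k) * ∏ q ∈ D, exp 1 * g q := by
        refine Finset.sum_le_sum fun D hD => ?_
        have h0 : ∀ q ∈ D, 0 ≤ g q := fun q hq => hg q (Finset.mem_powerset.1 hD hq)
        have hp : 0 ≤ ∏ q ∈ D, g q := Finset.prod_nonneg h0
        rw [Finset.prod_mul_distrib, Finset.prod_const, ← exp_nat_mul, mul_one, ← mul_assoc,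
          ← exp_add]
        split_ifs with h
        · positivity
        · have h1 : (1 : ℝ) ≤ exp (-k + D.card) := by
            apply one_le_exp
            have : (k : ℝ) < D.card := by exact_mod_cast not_le.1 h
            linarith
          nlinarith
    _ = exp (-k) * ∏ q ∈ s, (1 + exp 1 * g q) := by
        rw [← Finset.mul_sum, Finset.prod_one_add]
    _ ≤ exp (-k) * exp (∑ q ∈ s, exp 1 * g q) := by
        gcongr
        exact prod_one_add_le_exp_sum s fun q hq => mul_nonneg (exp_pos _).le (hg q hq)
    _ ≤ _ := by
        rw [← exp_add, ← Finset.mul_sum]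
        apply exp_le_exp.2
        have := Finset.sum_nonneg hg
        nlinarith

theorem sum_powerset_ite_card_le_prod_le {α : Type*} (s : Finset α) {g : α → ℝ} {W B : ℝ}
    (hW : 1 ≤ W) (hs : (s.card : ℝ) ≤ W) (hB : 0 ≤ B) (hg : ∀ q ∈ s, 0 ≤ g q)
    (hgB : ∀ q ∈ s, g q ≤ B) (k : ℕ) :
    ∑ D ∈ s.powerset, (if D.card ≤ k then ∏ q ∈ D, g q else 0) ≤ exp B * W ^ k := by
  classical
  have hW0 : 0 < W := by linarith
  calc _ ≤ ∑ D ∈ s.powerset, W ^ k * ∏ q ∈ D, g q / W := by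
        refine Finset.sum_le_sum fun D hD => ?_
        have h0 : ∀ q ∈ D, 0 ≤ g q := fun q hq => hg q (Finset.mem_powerset.1 hD hq)
        have hp : 0 ≤ ∏ q ∈ D, g q := Finset.prod_nonneg h0
        rw [Finset.prod_div_distrib, Finset.prod_const]
        split_ifs with h
        · rw [mul_div_assoc', le_div_iff₀ (by positivity), mul_comm]
          gcongr
        · positivity
    _ = W ^ k * ∏ q ∈ s, (1 + g q / W) := by
        rw [← Finset.mul_sum, Finset.prod_one_add]
    _ ≤ W ^ k * exp (∑ q ∈ s, g q / W) := by
        gcongr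
        exact prod_one_add_le_exp_sum s fun q hq => div_nonneg (hg q hq) hW0.le
    _ ≤ W ^ k * exp B := by
        gcongr
        calc ∑ q ∈ s, g q / W ≤ ∑ q ∈ s, B / W := by
              gcongr with q hq; exact hgB q hq
          _ = s.card * (B / W) := by rw [Finset.sum_const, nsmul_eq_mul]
          _ ≤ W * (B / W) := by gcongr
          _ = B := by field_simp
    _ = _ := mul_comm _ _

/-- Brun's pure sieve. -/
theorem card_filter_forall_notMem_le {s : Finset ℕ} {Ω : ℕ → Finset ℕ} (X r : ℕ) {W B : ℝ}
    (hs : ∀ q ∈ s, q.Prime) (hΩ : ∀ q ∈ s, Ω q ⊆ Finset.range q) (hW : 1 ≤ W)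
    (hsW : (s.card : ℝ) ≤ W) (hB : 0 ≤ B) (hΩB : ∀ q ∈ s, ((Ω q).card : ℝ) ≤ B) :
    (((Finset.range X).filter fun n => ∀ q ∈ s, n % q ∉ Ω q).card : ℝ) ≤
      X * (exp (-∑ q ∈ s, ((Ω q).card : ℝ) / q) +
        exp (3 * ∑ q ∈ s, ((Ω q).card : ℝ) / q - (2 * r : ℕ))) + exp B * W ^ (2 * r) := by
  classical
  set g : ℕ → ℝ := fun q => ((Ω q).card : ℝ) / q with hg
  have hg0 : ∀ q ∈ s, 0 ≤ g q := fun q _ => by simp only [hg]; positivity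
  have hg1 : ∀ q ∈ s, g q ≤ 1 := fun q hq => by
    simp only [hg]
    have hq0 := (hs q hq).pos
    rw [div_le_one (by exact_mod_cast hq0)]
    have := Finset.card_le_card (hΩ q hq)
    rw [Finset.card_range] at this
    exact_mod_cast this
  let A : Finset ℕ → ℝ := fun D =>
    (((Finset.range X).filter fun n => ∀ q ∈ D, n % q ∈ Ω q).card : ℝ)
  have hA : ∀ D ∈ s.powerset, |A D - X * ∏ q ∈ D, g q| ≤ ∏ q ∈ D, ((Ω q).card : ℝ) := by
    intro D hD
    rw [Finset.mem_powerset] at hD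
    have := abs_card_filter_residues_sub_le X (fun q hq => hs q (hD hq))
      (fun q hq => hΩ q (hD hq)) Nat.one_pos 0 (fun q _ => Nat.coprime_one_left q)
    simpa [Nat.modEq_one, A, hg] using this
  have h1 : (((Finset.range X).filter fun n => ∀ q ∈ s, n % q ∉ Ω q).card : ℝ) ≤
      ∑ D ∈ s.powerset, if D.card ≤ 2 * r then (-1 : ℝ) ^ D.card * A D else 0 := by
    calc _ = ∑ n ∈ Finset.range X, if (s.filter fun q => n % q ∈ Ω q) = ∅ then (1 : ℝ) else 0 := by
          rw [Finset.card_filter]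
          push_cast
          refine Finset.sum_congr rfl fun n _ => ?_
          simp only [Finset.filter_eq_empty_iff]
      _ ≤ ∑ n ∈ Finset.range X, ∑ D ∈ (s.filter fun q => n % q ∈ Ω q).powerset,
            if D.card ≤ 2 * r then (-1 : ℝ) ^ D.card else 0 :=
          Finset.sum_le_sum fun n _ => ite_eq_empty_le_sum_powerset _ r
      _ = ∑ n ∈ Finset.range X, ∑ D ∈ s.powerset, if ∀ q ∈ D, n % q ∈ Ω q then
            (if D.card ≤ 2 * r then (-1 : ℝ) ^ D.card else 0) else 0 := by
          refine Finset.sum_congr rfl fun n _ => ?_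
          conv_rhs => rw [← Finset.sum_filter]
          refine Finset.sum_congr ?_ fun _ _ => rfl
          ext D
          simp only [Finset.mem_powerset, Finset.mem_filter, Finset.subset_iff]
          exact ⟨fun h => ⟨fun q hq => (h hq).1, fun q hq => (h hq).2⟩,
            fun h q hq => ⟨h.1 hq, h.2 q hq⟩⟩
      _ = _ := by
          rw [Finset.sum_comm]
          refine Finset.sum_congr rfl fun D _ => ?_
          rw [← Finset.sum_filter, Finset.sum_const, nsmul_eq_mul]
          split_ifs
          · exact mul_comm _ _
          · simp
  have h2 : ∀ D ∈ s.powerset, (if D.card ≤ 2 * r then (-1 : ℝ) ^ D.card * A D else 0) ≤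
      X * ((-1 : ℝ) ^ D.card * ∏ q ∈ D, g q) + X * (if D.card ≤ 2 * r then 0 else ∏ q ∈ D, g q) +
        if D.card ≤ 2 * r then ∏ q ∈ D, ((Ω q).card : ℝ) else 0 := by
    intro D hD
    have h0 : 0 ≤ ∏ q ∈ D, g q := Finset.prod_nonneg fun q hq => hg0 q (Finset.mem_powerset.1 hD hq)
    have hX : (0 : ℝ) ≤ X := Nat.cast_nonneg X
    have hh := abs_le.1 (hA D hD)
    rcases neg_one_pow_eq_or ℝ D.card with h | h <;> rw [h] <;> split_ifs
    · linarith
    · nlinarith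
    · linarith
    · linarith
  refine (h1.trans (Finset.sum_le_sum h2)).trans ?_
  rw [Finset.sum_add_distrib, Finset.sum_add_distrib, ← Finset.mul_sum, ← Finset.mul_sum,
    sum_powerset_neg_one_pow_mul_prod, ← mul_add]
  have h3 : ∏ q ∈ s, (1 - g q) ≤ exp (-∑ q ∈ s, g q) := by
    rw [← Finset.sum_neg_distrib, exp_sum]
    refine Finset.prod_le_prod (fun q hq => by have := hg1 q hq; linarith) fun q _ => ?_
    have := add_one_le_exp (-g q)
    linarith
  gcongr
  · exact sum_powerset_ite_lt_card_prod_le s hg0 _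
  · exact sum_powerset_ite_card_le_prod_le s hW hsW hB (fun q _ => Nat.cast_nonneg _) hΩB _

/-- For an odd prime `q ∤ c d`, the residues `m` with `q ∣ m (m² c² + d²)`. -/
theorem exists_residues_dvd {q c d : ℕ} (hq : q.Prime) (hq2 : q ≠ 2) (hqc : ¬ q ∣ c)
    (hqd : ¬ q ∣ d) :
    ∃ Ω ⊆ Finset.range q, (Ω.card : ℝ) = 2 + ((ZMod.χ₄ q : ℤ) : ℝ) ∧
      ∀ m ∈ Ω, q ∣ m * (m ^ 2 * c ^ 2 + d ^ 2) := by
  have := Fact.mk hq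
  have hodd : q % 2 = 1 := by
    rcases hq.eq_two_or_odd with h | h
    · exact absurd h hq2
    · exact h
  rw [χ₄_natCast_real_eq, if_neg (by omega)]
  by_cases h4 : q % 4 = 1
  · rw [if_pos h4]
    obtain ⟨i, hi⟩ := ZMod.exists_sq_eq_neg_one_iff.2 (show q % 4 ≠ 3 by omega)
    have hc : (c : ZMod q) ≠ 0 := by rwa [Ne, ZMod.natCast_eq_zero_iff]
    have hd : (d : ZMod q) ≠ 0 := by rwa [Ne, ZMod.natCast_eq_zero_iff]
    have hi0 : i ≠ 0 := by
      rintro rfl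
      simp at hi
    have h2 : (2 : ZMod q) ≠ 0 := by
      have : ((2 : ℕ) : ZMod q) ≠ 0 := by
        rw [Ne, ZMod.natCast_eq_zero_iff]
        intro h
        exact hq2 ((Nat.prime_dvd_prime_iff_eq hq Nat.prime_two).1 h)
      exact_mod_cast this
    set u : ZMod q := i * d / c with hu
    have hu0 : u ≠ 0 := div_ne_zero (mul_ne_zero hi0 hd) hc
    have hun : u ≠ -u := by
      intro h
      have : 2 * u = 0 := by linear_combination h
      exact (mul_ne_zero h2 hu0) this
    have huc : u ^ 2 * c ^ 2 + d ^ 2 = 0 := by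
      rw [hu]
      field_simp
      linear_combination (-(d : ZMod q) ^ 2) * hi
    refine ⟨({0, u, -u} : Finset (ZMod q)).image ZMod.val, ?_, ?_, ?_⟩
    · intro m hm
      obtain ⟨v, -, rfl⟩ := Finset.mem_image.1 hm
      exact Finset.mem_range.2 (ZMod.val_lt v)
    · rw [Finset.card_image_of_injective _ (ZMod.val_injective q), Finset.card_eq_three.2
        ⟨0, u, -u, hu0.symm, (neg_ne_zero.2 hu0).symm, hun, rfl⟩]
      norm_num
    · intro m hm
      obtain ⟨v, hv, rfl⟩ := Finset.mem_image.1 hm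
      rw [← ZMod.natCast_eq_zero_iff]
      push_cast
      rw [ZMod.natCast_zmod_val]
      simp only [Finset.mem_insert, Finset.mem_singleton] at hv
      rcases hv with rfl | rfl | rfl
      · simp
      · rw [huc, mul_zero]
      · rw [neg_sq, huc, mul_zero]
  · rw [if_neg h4]
    refine ⟨{0}, ?_, ?_, ?_⟩
    · simpa using hq.pos
    · norm_num
    · simp

theorem two_pow_card_primeFactors_le {n : ℕ} (hn : n ≠ 0) : 2 ^ n.primeFactors.card ≤ n :=
  calc 2 ^ n.primeFactors.card ≤ ∏ p ∈ n.primeFactors, p :=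
        Finset.pow_card_le_prod _ _ _ fun _ hp => (Nat.prime_of_mem_primeFactors hp).two_le
    _ ≤ n := Nat.le_of_dvd (Nat.pos_of_ne_zero hn) (Nat.prod_primeFactors_dvd n)

theorem tendsto_log_log_atTop : Filter.Tendsto (fun N : ℝ => log (log N)) .atTop .atTop :=
  tendsto_log_atTop.comp tendsto_log_atTop

theorem eventually_mul_log_add_le {η : ℝ} (hη : 0 < η) (a b : ℝ) :
    ∀ᶠ L : ℝ in .atTop, a * log L + b ≤ η * L := by
  have h1 : (fun L : ℝ => a * log L) =o[.atTop] (fun L : ℝ => L) :=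
    isLittleO_log_id_atTop.const_mul_left a
  filter_upwards [h1.bound (half_pos hη), Filter.eventually_ge_atTop (b / (η / 2)),
    Filter.eventually_ge_atTop 0] with L h2 h3 h4
  rw [norm_eq_abs, norm_eq_abs, abs_of_nonneg h4] at h2
  rw [div_le_iff₀ (by positivity)] at h3
  have := le_abs_self (a * log L)
  linarith

theorem eventually_sum_inv_primeFactors_le {η : ℝ} (hη : 0 < η) :
    ∀ᶠ N : ℝ in .atTop, ∀ n : ℕ, n ≠ 0 → (n : ℝ) ≤ N →
      ∑ q ∈ n.primeFactors, (1 : ℝ) / q ≤ η * log (log N) := by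
  filter_upwards [tendsto_log_atTop.eventually (eventually_sum_inv_primesBelow_le one_pos),
    tendsto_log_log_atTop.eventually (eventually_mul_log_add_le hη 2 2),
    tendsto_log_atTop.eventually_ge_atTop 1] with N h1 h2 h3 n hn hnN
  have hlog : 0 < log N := by linarith
  rw [← Finset.sum_filter_add_sum_filter_not n.primeFactors (fun q : ℕ => (q : ℝ) ≤ log N)]
  have h4 : ∑ q ∈ n.primeFactors with ((q : ℕ) : ℝ) ≤ log N, (1 : ℝ) / q ≤
      ∑ q ∈ (⌊log N⌋₊ + 1).primesBelow, (1 : ℝ) / q := by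
    refine Finset.sum_le_sum_of_subset_of_nonneg ?_ fun q _ _ => by positivity
    intro q hq
    rw [Finset.mem_filter] at hq
    rw [Nat.mem_primesBelow]
    exact ⟨Nat.lt_succ_of_le (Nat.le_floor hq.2), Nat.prime_of_mem_primeFactors hq.1⟩
  have h5 : ∑ q ∈ n.primeFactors with ¬ ((q : ℕ) : ℝ) ≤ log N, (1 : ℝ) / q ≤ 2 := by
    have hω : (n.primeFactors.card : ℝ) * log 2 ≤ log N := by
      rw [← log_pow]
      apply log_le_log (by positivity)
      refine le_trans ?_ hnN
      exact_mod_cast two_pow_card_primeFactors_le hn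
    calc _ ≤ ∑ q ∈ n.primeFactors with ¬ ((q : ℕ) : ℝ) ≤ log N, 1 / log N := by
          refine Finset.sum_le_sum fun q hq => ?_
          exact one_div_le_one_div_of_le hlog (not_le.1 (Finset.mem_filter.1 hq).2).le
      _ ≤ n.primeFactors.card * (1 / log N) := by
          rw [Finset.sum_const, nsmul_eq_mul]
          gcongr
          exact Finset.filter_subset _ _
      _ ≤ 2 := by
          have := log_two_gt_d9
          rw [mul_one_div, div_le_iff₀ hlog]
          have : (0 : ℝ) ≤ n.primeFactors.card := Nat.cast_nonneg _
          nlinarith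
  linarith

theorem neg_one_le_χ₄_natCast (n : ℕ) : -1 ≤ ((ZMod.χ₄ n : ℤ) : ℝ) := by
  rw [χ₄_natCast_real_eq]
  split_ifs <;> norm_num

theorem χ₄_natCast_le_one (n : ℕ) : ((ZMod.χ₄ n : ℤ) : ℝ) ≤ 1 := by
  rw [χ₄_natCast_real_eq]
  split_ifs <;> norm_num

theorem two_mul_log_log_sub_le_sum_primesBelow_filter {c d Z : ℕ} (hc : c ≠ 0) (hd : d ≠ 0)
    (hZ : 1 ≤ Z) :
    2 * log (log (Z + 1)) - 18 - 3 * ∑ q ∈ (c * d).primeFactors, (1 : ℝ) / q ≤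
      ∑ q ∈ (Z + 1).primesBelow with q ≠ 2 ∧ ¬ q ∣ c ∧ ¬ q ∣ d,
        (2 + ((ZMod.χ₄ q : ℤ) : ℝ)) / q := by
  have hnn : ∀ q : ℕ, 0 ≤ (2 + ((ZMod.χ₄ q : ℤ) : ℝ)) / q := fun q => by
    have := neg_one_le_χ₄_natCast q
    exact div_nonneg (by linarith) (Nat.cast_nonneg q)
  have h1 := two_mul_log_log_sub_le_sum_primesBelow hZ
  rw [← Finset.sum_filter_add_sum_filter_not (Z + 1).primesBelow
    (fun q => q ≠ 2 ∧ ¬ q ∣ c ∧ ¬ q ∣ d)] at h1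
  have h3 : ∑ q ∈ (Z + 1).primesBelow with ¬ (q ≠ 2 ∧ ¬ q ∣ c ∧ ¬ q ∣ d),
      (2 + ((ZMod.χ₄ q : ℤ) : ℝ)) / q ≤
      ∑ q ∈ insert 2 (c * d).primeFactors, (2 + ((ZMod.χ₄ q : ℤ) : ℝ)) / q := by
    refine Finset.sum_le_sum_of_subset_of_nonneg ?_ fun q _ _ => hnn q
    intro q hq
    rw [Finset.mem_filter, Nat.mem_primesBelow] at hq
    rw [Finset.mem_insert, Nat.mem_primeFactors]
    by_cases h : q = 2
    · exact Or.inl h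
    · refine Or.inr ⟨hq.1.2, ?_, mul_ne_zero hc hd⟩
      rw [hq.1.2.dvd_mul]
      tauto
  have h4 : ∑ q ∈ insert 2 (c * d).primeFactors, (2 + ((ZMod.χ₄ q : ℤ) : ℝ)) / q ≤
      1 + 3 * ∑ q ∈ (c * d).primeFactors, (1 : ℝ) / q := by
    have h6 : ∑ q ∈ insert 2 (c * d).primeFactors, (2 + ((ZMod.χ₄ q : ℤ) : ℝ)) / q ≤
        (2 + ((ZMod.χ₄ (2 : ℕ) : ℤ) : ℝ)) / (2 : ℕ) +
          ∑ q ∈ (c * d).primeFactors, (2 + ((ZMod.χ₄ q : ℤ) : ℝ)) / q := by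
      by_cases h : 2 ∈ (c * d).primeFactors
      · rw [Finset.insert_eq_of_mem h]
        linarith [hnn 2]
      · rw [Finset.sum_insert h]
    have h7 : (2 + ((ZMod.χ₄ (2 : ℕ) : ℤ) : ℝ)) / (2 : ℕ) = 1 := by
      rw [χ₄_natCast_real_eq]
      norm_num
    refine h6.trans ?_
    rw [h7, Finset.mul_sum]
    gcongr with q hq
    rw [mul_one_div]
    gcongr
    linarith [χ₄_natCast_le_one q]
  linarith

theorem card_primes_filter_le {c d : ℕ} (hc : c ≠ 0) (hd : d ≠ 0) {Z : ℕ} (hZ : 1 ≤ Z) (X r : ℕ) :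
    (((Finset.range X).filter fun n => n.Prime ∧ Z < n ∧ (n ^ 2 * c ^ 2 + d ^ 2).Prime).card : ℝ) ≤
      X * (exp (-(2 * log (log (Z + 1)) - 18 - 3 * ∑ q ∈ (c * d).primeFactors, (1 : ℝ) / q)) +
        exp (9 * ∑ q ∈ (Z + 1).primesBelow, (1 : ℝ) / q - (2 * r : ℕ))) +
        exp 3 * Z ^ (2 * r) := by
  set s := (Z + 1).primesBelow.filter fun q => q ≠ 2 ∧ ¬ q ∣ c ∧ ¬ q ∣ d with hsdef
  have hs : ∀ q ∈ s, q.Prime ∧ q ≤ Z ∧ q ≠ 2 ∧ ¬ q ∣ c ∧ ¬ q ∣ d := by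
    intro q hq
    rw [hsdef, Finset.mem_filter, Nat.mem_primesBelow] at hq
    exact ⟨hq.1.2, Nat.lt_succ_iff.1 hq.1.1, hq.2⟩
  have hex : ∀ q, ∃ Ω : Finset ℕ, q ∈ s → Ω ⊆ Finset.range q ∧
      (Ω.card : ℝ) = 2 + ((ZMod.χ₄ q : ℤ) : ℝ) ∧ ∀ m ∈ Ω, q ∣ m * (m ^ 2 * c ^ 2 + d ^ 2) := by
    intro q
    by_cases hq : q ∈ s
    · obtain ⟨h1, -, h3, h4, h5⟩ := hs q hq
      obtain ⟨Ω, h⟩ := exists_residues_dvd h1 h3 h4 h5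
      exact ⟨Ω, fun _ => h⟩
    · exact ⟨∅, fun h => absurd h hq⟩
  choose Ω hΩ using hex
  have hcard : (s.card : ℝ) ≤ Z := by
    have : s ⊆ Finset.Icc 1 Z := fun q hq =>
      Finset.mem_Icc.2 ⟨(hs q hq).1.one_lt.le, (hs q hq).2.1⟩
    have := Finset.card_le_card this
    rw [Nat.card_Icc, Nat.add_sub_cancel] at this
    exact_mod_cast this
  have hΩ3 : ∀ q ∈ s, ((Ω q).card : ℝ) ≤ 3 := by
    intro q hq
    rw [(hΩ q hq).2.1]
    linarith [χ₄_natCast_le_one q]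
  have hsieve := card_filter_forall_notMem_le X r (fun q hq => (hs q hq).1)
    (fun q hq => (hΩ q hq).1) (show (1 : ℝ) ≤ Z by exact_mod_cast hZ) hcard (by norm_num) hΩ3
  have hsub : ((Finset.range X).filter fun n =>
      n.Prime ∧ Z < n ∧ (n ^ 2 * c ^ 2 + d ^ 2).Prime) ⊆
      (Finset.range X).filter fun n => ∀ q ∈ s, n % q ∉ Ω q := by
    intro n hn
    rw [Finset.mem_filter] at hn ⊢
    obtain ⟨hX, hnp, hZn, hprime⟩ := hn
    refine ⟨hX, fun q hq hmem => ?_⟩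
    obtain ⟨hqp, hqZ, -, -, -⟩ := hs q hq
    have h1 := (hΩ q hq).2.2 _ hmem
    have h2 : q ∣ n * (n ^ 2 * c ^ 2 + d ^ 2) := by
      have hmod : n % q ≡ n [MOD q] := Nat.mod_modEq n q
      exact ((hmod.mul (((hmod.pow 2).mul_right _).add_right _)).dvd_iff dvd_rfl).1 h1
    rcases hqp.dvd_mul.1 h2 with h | h
    · have := (Nat.prime_dvd_prime_iff_eq hqp hnp).1 h
      omega
    · have := (Nat.prime_dvd_prime_iff_eq hqp hprime).1 h
      have h3 : n ≤ n ^ 2 * c ^ 2 := by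
        have : 0 < n := hnp.pos
        have : 0 < c ^ 2 := by positivity
        nlinarith
      omega
  have hlow : 2 * log (log (Z + 1)) - 18 - 3 * ∑ q ∈ (c * d).primeFactors, (1 : ℝ) / q ≤
      ∑ q ∈ s, ((Ω q).card : ℝ) / q := by
    refine (two_mul_log_log_sub_le_sum_primesBelow_filter hc hd hZ).trans_eq ?_
    exact Finset.sum_congr rfl fun q hq => by rw [(hΩ q hq).2.1]
  have hup : ∑ q ∈ s, ((Ω q).card : ℝ) / q ≤ 3 * ∑ q ∈ (Z + 1).primesBelow, (1 : ℝ) / q := by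
    rw [Finset.mul_sum]
    calc _ ≤ ∑ q ∈ s, 3 * ((1 : ℝ) / q) := by
          refine Finset.sum_le_sum fun q hq => ?_
          rw [mul_one_div]
          gcongr
          exact hΩ3 q hq
      _ ≤ _ := Finset.sum_le_sum_of_subset_of_nonneg (Finset.filter_subset _ _)
          fun q _ _ => by positivity
  refine le_trans (Nat.cast_le.2 (Finset.card_le_card hsub)) (hsieve.trans ?_)
  have h1 := exp_le_exp.2 (neg_le_neg hlow)
  have h2 : exp (3 * ∑ q ∈ s, ((Ω q).card : ℝ) / q - (2 * r : ℕ)) ≤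
      exp (9 * ∑ q ∈ (Z + 1).primesBelow, (1 : ℝ) / q - (2 * r : ℕ)) :=
    exp_le_exp.2 (by linarith)
  exact add_le_add_left (mul_le_mul_of_nonneg_left (add_le_add h1 h2) (Nat.cast_nonneg X)) _

theorem eventually_exp_three_mul_pow_le :
    ∀ᶠ L : ℝ in .atTop, exp 3 * exp (exp L / L ^ 3) ^ (2 * ⌈10 * L⌉₊) ≤
      exp (exp L / L) * exp (-(2 * L)) := by
  filter_upwards [(tendsto_exp_div_pow_atTop 2).eventually_ge_atTop 110,
    Filter.eventually_ge_atTop 22] with L h1 h2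
  have hL : 0 < L := by linarith
  rw [← exp_nat_mul, ← exp_add, ← exp_add]
  apply exp_le_exp.2
  have hr : ((2 * ⌈10 * L⌉₊ : ℕ) : ℝ) ≤ 21 * L := by
    have := Nat.ceil_lt_add_one (show 0 ≤ 10 * L by positivity)
    push_cast
    linarith
  have h3 : ((2 * ⌈10 * L⌉₊ : ℕ) : ℝ) * (exp L / L ^ 3) ≤ 21 * L * (exp L / L ^ 3) := by gcongr
  have h4 : 21 * L * (exp L / L ^ 3) = 21 * (exp L / L ^ 2) := by field_simp
  have h5 : exp L / L = L * (exp L / L ^ 2) := by field_simp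
  rw [h4] at h3
  rw [h5]
  nlinarith

theorem eventually_card_primes_filter_le {η : ℝ} (hη : 0 < η) :
    ∀ᶠ L : ℝ in .atTop, ∀ c d : ℕ, c ≠ 0 → d ≠ 0 →
      3 * ∑ q ∈ (c * d).primeFactors, (1 : ℝ) / q ≤ η / 2 * L → ∀ x : ℝ, exp (exp L / L) < x →
      (((Finset.range (⌊x⌋₊ + 1)).filter fun n : ℕ =>
        n.Prime ∧ exp (exp L / L) < n ∧ (n ^ 2 * c ^ 2 + d ^ 2).Prime).card : ℝ) ≤
        x * exp (-((2 - η) * L)) := by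
  have hz : Filter.Tendsto (fun L : ℝ => exp (exp L / L ^ 3)) .atTop .atTop :=
    tendsto_exp_atTop.comp (tendsto_exp_div_pow_atTop 3)
  filter_upwards [hz.eventually (eventually_sum_inv_primesBelow_le one_pos),
    eventually_exp_three_mul_pow_le, eventually_mul_log_add_le (half_pos hη) 6 20,
    Filter.eventually_ge_atTop 1] with L hsum hpow hlog hL c d hc hd hcd x hx
  set z := exp (exp L / L ^ 3) with hzdef
  have hL0 : 0 < L := by linarith
  have hlogL : 0 ≤ log L := log_nonneg hL
  have hz1 : 1 ≤ z := one_le_exp (by positivity)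
  have hzx : z ≤ exp (exp L / L) := by
    apply exp_le_exp.2
    gcongr
    nlinarith [sq_nonneg L, sq_nonneg (L - 1)]
  have hZ : 1 ≤ ⌊z⌋₊ := Nat.one_le_floor_iff z |>.2 hz1
  have hx1 : 1 ≤ x := by linarith
  have hllz : log (log z) = L - 3 * log L := by
    rw [hzdef, log_exp, log_div (exp_pos L).ne' (by positivity), log_exp, log_pow]
    norm_num
  have hlow : L - 3 * log L ≤ log (log (⌊z⌋₊ + 1)) := by
    rw [← hllz]
    have h1 : 0 < log z := by rw [hzdef, log_exp]; positivity
    exact log_le_log h1 (log_le_log (by linarith) (Nat.lt_floor_add_one z).le)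
  have hr : 20 * L ≤ ((2 * ⌈10 * L⌉₊ : ℕ) : ℝ) := by
    have := Nat.le_ceil (10 * L)
    push_cast
    linarith
  have hsub : ((Finset.range (⌊x⌋₊ + 1)).filter fun n : ℕ =>
      n.Prime ∧ exp (exp L / L) < n ∧ (n ^ 2 * c ^ 2 + d ^ 2).Prime) ⊆
      (Finset.range (⌊x⌋₊ + 1)).filter fun n =>
        n.Prime ∧ ⌊z⌋₊ < n ∧ (n ^ 2 * c ^ 2 + d ^ 2).Prime := by
    refine Finset.monotone_filter_right _ fun n _ h => ⟨h.1, ?_, h.2.2⟩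
    exact (Nat.floor_lt (by linarith)).2 (hzx.trans_lt h.2.1)
  have hmain := card_primes_filter_le hc hd hZ (⌊x⌋₊ + 1) ⌈10 * L⌉₊
  set E := exp (-(2 * L - η / 2 * L - 6 * log L - 18)) with hE
  have h1 : exp (-(2 * log (log (⌊z⌋₊ + 1)) - 18 -
      3 * ∑ q ∈ (c * d).primeFactors, (1 : ℝ) / q)) ≤ E := exp_le_exp.2 (by linarith)
  have h2 : exp (9 * ∑ q ∈ (⌊z⌋₊ + 1).primesBelow, (1 : ℝ) / q - (2 * ⌈10 * L⌉₊ : ℕ)) ≤ E :=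
    exp_le_exp.2 (by rw [hllz] at hsum; nlinarith)
  have h3 : exp 3 * (⌊z⌋₊ : ℝ) ^ (2 * ⌈10 * L⌉₊) ≤ x * E := by
    calc _ ≤ exp 3 * z ^ (2 * ⌈10 * L⌉₊) := by
          gcongr
          exact Nat.floor_le (by linarith)
      _ ≤ _ := hpow
      _ ≤ _ := by
          have := mul_pos hη hL0
          exact mul_le_mul hx.le (exp_le_exp.2 (by linarith)) (exp_pos _).le (by linarith)
  have hX : ((⌊x⌋₊ + 1 : ℕ) : ℝ) ≤ 2 * x := by
    have := Nat.floor_le (show 0 ≤ x by linarith)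
    push_cast
    linarith
  have hE5 : 5 * E ≤ exp (-((2 - η) * L)) := by
    have h5 : (5 : ℝ) ≤ exp 2 := by
      have h := exp_one_gt_d9
      have : exp 2 = exp 1 * exp 1 := by rw [← exp_add]; norm_num
      nlinarith
    calc 5 * E ≤ exp 2 * E := by gcongr
      _ = exp (2 + -(2 * L - η / 2 * L - 6 * log L - 18)) := by rw [hE, ← exp_add]
      _ ≤ _ := exp_le_exp.2 (by linarith)
  calc _ ≤ _ := Nat.cast_le.2 (Finset.card_le_card hsub)
    _ ≤ _ := hmain
    _ ≤ 2 * x * (E + E) + x * E := by gcongr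
    _ = x * (5 * E) := by ring
    _ ≤ _ := by gcongr

theorem eventually_card_primes_mul_le {η : ℝ} (hη : 0 < η) :
    ∀ᶠ N : ℝ in .atTop, ∀ c d : ℕ, c ≠ 0 → d ≠ 0 →
      (((Finset.range (⌊N⌋₊ + 1)).filter fun n : ℕ => n.Prime ∧ N ^ (1 / log (log N)) < n ∧
        (n * (c * d) : ℝ) ≤ N ∧ (n ^ 2 * c ^ 2 + d ^ 2).Prime).card : ℝ) ≤
        N / (c * d) * exp (-((2 - η) * log (log N))) := by
  filter_upwards [tendsto_log_log_atTop.eventually (eventually_card_primes_filter_le hη),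
    eventually_sum_inv_primeFactors_le (show 0 < η / 6 by positivity),
    tendsto_log_log_atTop.eventually_ge_atTop 1, tendsto_log_atTop.eventually_ge_atTop 1,
    Filter.eventually_ge_atTop 1] with N h1 h2 hL hlog hN c d hc hd
  have hcd : (0 : ℝ) < c * d := by positivity
  have hy : N ^ (1 / log (log N)) = exp (exp (log (log N)) / log (log N)) := by
    rw [exp_log (by linarith), rpow_def_of_pos (by linarith), mul_one_div]
  rw [hy]
  set S := (Finset.range (⌊N⌋₊ + 1)).filter fun n : ℕ => n.Prime ∧
    exp (exp (log (log N)) / log (log N)) < n ∧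
      (n * (c * d) : ℝ) ≤ N ∧ (n ^ 2 * c ^ 2 + d ^ 2).Prime with hS
  rcases S.eq_empty_or_nonempty with he | ⟨p, hp⟩
  · rw [he, Finset.card_empty, Nat.cast_zero]
    positivity
  · rw [hS, Finset.mem_filter] at hp
    obtain ⟨-, hpp, hyp, hpN, -⟩ := hp
    have hp1 : (1 : ℝ) ≤ p := by exact_mod_cast hpp.one_lt.le
    have hω := h2 (c * d) (mul_ne_zero hc hd) (by push_cast; nlinarith)
    refine le_trans (Nat.cast_le.2 (Finset.card_le_card ?_))
      (h1 c d hc hd (by linarith) (N / (c * d)) (hyp.trans_le ((le_div_iff₀ hcd).2 hpN)))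
    intro n hn
    rw [hS, Finset.mem_filter] at hn
    rw [Finset.mem_filter, Finset.mem_range, Nat.lt_succ_iff]
    exact ⟨Nat.le_floor ((le_div_iff₀ hcd).2 hn.2.2.2.1), hn.2.1, hn.2.2.1, hn.2.2.2.2⟩

theorem maxPrimeFac_mem_primeFactors {n : ℕ} (hn : 1 < n) : maxPrimeFac n ∈ n.primeFactors := by
  rw [maxPrimeFac, if_neg (by omega)]
  obtain ⟨p, hp, h⟩ := Finset.exists_mem_eq_sup n.primeFactors (Nat.nonempty_primeFactors.2 hn) id
  rwa [h]

theorem card_primeFactors_prime_mul_le {p c : ℕ} (hp : p.Prime) (hc : c ≠ 0) :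
    (p * c).primeFactors.card ≤ c.primeFactors.card + 1 := by
  rw [Nat.primeFactors_mul hp.ne_zero hc, hp.primeFactors]
  have := Finset.card_union_le {p} c.primeFactors
  rw [Finset.card_singleton] at this
  omega

theorem card_biUnion_product_image_le {S : ℕ → ℕ → Finset ℕ} (A B : Finset ℕ)
    (f : ℕ → ℕ → ℕ → ℕ × ℕ) {u : ℝ} (hS : ∀ c ∈ A, ∀ d ∈ B, ((S c d).card : ℝ) ≤ u / (c * d)) :
    (((A ×ˢ B).biUnion fun x => (S x.1 x.2).image (f x.1 x.2)).card : ℝ) ≤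
      u * ((∑ c ∈ A, (1 : ℝ) / c) * ∑ d ∈ B, (1 : ℝ) / d) := by
  calc _ ≤ ((∑ x ∈ A ×ˢ B, (S x.1 x.2).card : ℕ) : ℝ) := by
        apply Nat.cast_le.2
        refine Finset.card_biUnion_le.trans (Finset.sum_le_sum fun x _ => Finset.card_image_le)
    _ ≤ ∑ x ∈ A ×ˢ B, u / (x.1 * x.2) := by
        push_cast
        refine Finset.sum_le_sum fun x hx => ?_
        rw [Finset.mem_product] at hx
        exact hS _ hx.1 _ hx.2
    _ = _ := by
        rw [Finset.sum_product, Finset.sum_mul_sum, Finset.mul_sum]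
        refine Finset.sum_congr rfl fun c _ => ?_
        rw [Finset.mul_sum]
        refine Finset.sum_congr rfl fun d _ => ?_
        rw [div_mul_div_comm, one_mul, mul_one_div]

theorem ncard_pairs_le {N y K u : ℝ}
    (hu : ∀ c d : ℕ, c ≠ 0 → d ≠ 0 →
      (((Finset.range (⌊N⌋₊ + 1)).filter fun n : ℕ => n.Prime ∧ y < n ∧
        (n * (c * d) : ℝ) ≤ N ∧ (n ^ 2 * c ^ 2 + d ^ 2).Prime).card : ℝ) ≤ u / (c * d)) :
    ({p : ℕ × ℕ | 0 < p.1 ∧ 0 < p.2 ∧ 1 < p.1 * p.2 ∧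
          ((p.1 * p.2 : ℕ) : ℝ) ≤ N ∧ Nat.Prime (p.1 ^ 2 + p.2 ^ 2) ∧
          y < (maxPrimeFac (p.1 * p.2) : ℝ) ∧
          K < (p.1.primeFactors.card : ℝ)}.ncard : ℝ) ≤
      2 * u * ((∑ c ∈ Finset.Icc 1 ⌊N⌋₊ with K - 1 < (((c : ℕ).primeFactors.card : ℕ) : ℝ),
          (1 : ℝ) / c) *
        ∑ d ∈ Finset.Icc 1 ⌊N⌋₊, (1 : ℝ) / d) := by
  set I := Finset.Icc 1 ⌊N⌋₊ with hI
  set J := I.filter fun c : ℕ => K - 1 < (c.primeFactors.card : ℝ) with hJ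
  let S : ℕ → ℕ → Finset ℕ := fun c d => (Finset.range (⌊N⌋₊ + 1)).filter fun n : ℕ =>
    n.Prime ∧ y < n ∧ (n * (c * d) : ℝ) ≤ N ∧ (n ^ 2 * c ^ 2 + d ^ 2).Prime
  have hI0 : ∀ c ∈ I, c ≠ 0 := fun c hc => by
    rw [hI, Finset.mem_Icc] at hc
    omega
  have hJ0 : ∀ c ∈ J, c ≠ 0 := fun c hc => hI0 c (Finset.mem_filter.1 hc).1
  have hmemI : ∀ c m : ℕ, c ≠ 0 → m ≠ 0 → ((m * c : ℕ) : ℝ) ≤ N → c ∈ I := by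
    intro c m hc hm h
    rw [hI, Finset.mem_Icc]
    refine ⟨Nat.one_le_iff_ne_zero.2 hc, ?_⟩
    exact (Nat.le_mul_of_pos_left c (Nat.pos_of_ne_zero hm)).trans (Nat.le_floor h)
  let U₁ := (J ×ˢ I).biUnion fun x => (S x.1 x.2).image (fun n => (n * x.1, x.2))
  let U₂ := (I ×ˢ J).biUnion fun x => (S x.1 x.2).image (fun n => (x.2, n * x.1))
  have hsub : {p : ℕ × ℕ | 0 < p.1 ∧ 0 < p.2 ∧ 1 < p.1 * p.2 ∧
      ((p.1 * p.2 : ℕ) : ℝ) ≤ N ∧ Nat.Prime (p.1 ^ 2 + p.2 ^ 2) ∧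
      y < (maxPrimeFac (p.1 * p.2) : ℝ) ∧ K < (p.1.primeFactors.card : ℝ)} ⊆
      ((U₁ ∪ U₂ : Finset (ℕ × ℕ)) : Set (ℕ × ℕ)) := by
    rintro ⟨a, b⟩ ⟨ha, hb, hab, hN, hprime, hy, hK⟩
    dsimp only at ha hb hab hN hprime hy hK
    obtain ⟨hp, hdvd, -⟩ := Nat.mem_primeFactors.1 (maxPrimeFac_mem_primeFactors hab)
    generalize maxPrimeFac (a * b) = p at hp hdvd hy
    rw [Finset.mem_coe, Finset.mem_union]
    have hpM : p ∈ Finset.range (⌊N⌋₊ + 1) := by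
      rw [Finset.mem_range, Nat.lt_succ_iff]
      exact (Nat.le_of_dvd (by omega) hdvd).trans (Nat.le_floor hN)
    rcases hp.dvd_mul.1 hdvd with ⟨c, rfl⟩ | ⟨c, rfl⟩
    · have hc : c ≠ 0 := (Nat.pos_of_mul_pos_left ha).ne'
      refine Or.inl (Finset.mem_biUnion.2 ⟨(c, b), ?_, Finset.mem_image.2 ⟨p, ?_, rfl⟩⟩)
      · rw [Finset.mem_product, hJ, Finset.mem_filter]
        refine ⟨⟨hmemI c (p * b) hc (mul_ne_zero hp.ne_zero hb.ne') ?_, ?_⟩,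
          hmemI b (p * c) hb.ne' ha.ne' hN⟩
        · rwa [mul_right_comm]
        · have := card_primeFactors_prime_mul_le hp hc
          have : ((p * c).primeFactors.card : ℝ) ≤ c.primeFactors.card + 1 := by exact_mod_cast this
          dsimp only
          linarith
      · refine Finset.mem_filter.2 ⟨hpM, hp, hy, ?_, ?_⟩
        · push_cast at hN ⊢
          rwa [← mul_assoc]
        · rwa [mul_pow] at hprime
    · have hc : c ≠ 0 := (Nat.pos_of_mul_pos_left hb).ne'
      refine Or.inr (Finset.mem_biUnion.2 ⟨(c, a), ?_, Finset.mem_image.2 ⟨p, ?_, rfl⟩⟩)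
      · rw [Finset.mem_product, hJ, Finset.mem_filter]
        refine ⟨hmemI c (a * p) hc (mul_ne_zero ha.ne' hp.ne_zero) ?_,
          hmemI a (p * c) ha.ne' hb.ne' ?_, ?_⟩
        · rwa [mul_assoc]
        · rwa [mul_comm]
        · dsimp only
          linarith
      · refine Finset.mem_filter.2 ⟨hpM, hp, hy, ?_, ?_⟩
        · push_cast at hN ⊢
          calc (p : ℝ) * (c * a) = a * (p * c) := by ring
            _ ≤ N := hN
        · rwa [mul_pow, add_comm] at hprime
  have h1 := card_biUnion_product_image_le J I (fun c d n => (n * c, d))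
    fun c hc d hd => hu c d (hJ0 c hc) (hI0 d hd)
  have h2 := card_biUnion_product_image_le I J (fun c d n => (d, n * c))
    fun c hc d hd => hu c d (hI0 c hc) (hJ0 d hd)
  have h3 : ((U₁ ∪ U₂).card : ℝ) ≤ U₁.card + U₂.card := by
    exact_mod_cast Finset.card_union_le U₁ U₂
  have h4 := Set.ncard_le_ncard hsub (Finset.finite_toSet _)
  rw [Set.ncard_coe_finset] at h4
  calc _ ≤ ((U₁ ∪ U₂).card : ℝ) := Nat.cast_le.2 h4
    _ ≤ U₁.card + U₂.card := h3
    _ ≤ _ := add_le_add h1 h2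
    _ = _ := by ring

theorem sum_filter_lt_card_primeFactors_inv_le {t : ℝ} (ht : 1 ≤ t) (M : ℕ) (k : ℝ) :
    ∑ c ∈ Finset.Icc 1 M with k < (((c : ℕ).primeFactors.card : ℕ) : ℝ), (1 : ℝ) / c ≤
      exp (-k * log t) * exp (t * ∑ p ∈ (M + 1).primesBelow, (1 : ℝ) / p + 8 * t) := by
  have ht0 : 0 < t := by linarith
  calc _ ≤ ∑ c ∈ Finset.Icc 1 M with k < (((c : ℕ).primeFactors.card : ℕ) : ℝ),
          exp (-k * log t) * (t ^ c.primeFactors.card / (c : ℝ)) := by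
        refine Finset.sum_le_sum fun c hc => ?_
        rw [mul_div_assoc']
        gcongr
        rw [← exp_log (pow_pos ht0 _), log_pow, ← exp_add]
        apply one_le_exp
        have h1 := (Finset.mem_filter.1 hc).2
        have h2 := log_nonneg ht
        nlinarith
    _ ≤ ∑ c ∈ Finset.Icc 1 M, exp (-k * log t) * (t ^ c.primeFactors.card / (c : ℝ)) :=
        Finset.sum_le_sum_of_subset_of_nonneg (Finset.filter_subset _ _)
          fun c _ _ => by positivity
    _ ≤ _ := by
        rw [← Finset.mul_sum]
        gcongr
        exact sum_pow_card_primeFactors_div_le ht M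

theorem sum_Icc_inv_le_one_add_log {N : ℝ} (hN : 1 ≤ N) :
    ∑ d ∈ Finset.Icc 1 ⌊N⌋₊, (1 : ℝ) / d ≤ 1 + log N := by
  have := harmonic_floor_le_one_add_log N hN
  rw [harmonic_eq_sum_Icc] at this
  push_cast at this
  simpa only [one_div] using this

theorem sub_one_lt_mul_log {t : ℝ} (ht : 1 < t) : t - 1 < t * log t := by
  have ht0 : 0 < t := by linarith
  have h := log_lt_sub_one_of_pos (inv_pos.2 ht0) (by simpa using ht.ne')
  rw [log_inv] at h
  have h2 := mul_lt_mul_of_pos_left h ht0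
  rw [mul_sub, mul_inv_cancel₀ ht0.ne'] at h2
  linarith

theorem stmt_14 (ε : ℝ) (hε : 0 < ε) :
    ∀ δ : ℝ, 0 < δ → ∃ N₀ : ℝ, ∀ N : ℝ, N₀ ≤ N →
      ({p : ℕ × ℕ | 0 < p.1 ∧ 0 < p.2 ∧ 1 < p.1 * p.2 ∧
          ((p.1 * p.2 : ℕ) : ℝ) ≤ N ∧ Nat.Prime (p.1 ^ 2 + p.2 ^ 2) ∧
          N ^ (1 / Real.log (Real.log N)) < (maxPrimeFac (p.1 * p.2) : ℝ) ∧
          (1 + ε) * Real.log (Real.log N) < (p.1.primeFactors.card : ℝ)}.ncard : ℝ)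
        ≤ δ * N := by
  intro δ hδ
  set t := 1 + ε with ht
  have ht1 : 1 < t := by linarith
  obtain ⟨κ, hκ⟩ : ∃ κ, κ = t * log t - t + 1 := ⟨_, rfl⟩
  have hκ0 : 0 < κ := by linarith [sub_one_lt_mul_log ht1]
  obtain ⟨η, hη⟩ : ∃ η, η = κ / (2 * (1 + t)) := ⟨_, rfl⟩
  have hη0 : 0 < η := by rw [hη]; positivity
  have hηκ : (1 + t) * η = κ / 2 := by rw [hη]; field_simp
  rw [← Filter.eventually_atTop]
  filter_upwards [eventually_card_primes_mul_le hη0, eventually_sum_inv_primesBelow_le hη0,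
    tendsto_log_log_atTop.eventually_ge_atTop ((log t + 8 * t - log (δ / 4)) / (κ / 2)),
    tendsto_log_atTop.eventually_ge_atTop 1, Filter.eventually_ge_atTop 1]
    with N hcard hsum hL hlog hN
  set L := log (log N) with hLdef
  have hexpL : exp L = log N := exp_log (by linarith)
  have hN0 : 0 < N := by linarith
  have hmain := ncard_pairs_le (K := t * L) (y := N ^ (1 / L)) (u := N * exp (-((2 - η) * L)))
    fun c d hc hd => (hcard c d hc hd).trans_eq (by ring)
  have h1 : ∑ c ∈ Finset.Icc 1 ⌊N⌋₊ with t * L - 1 < (((c : ℕ).primeFactors.card : ℕ) : ℝ),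
      (1 : ℝ) / c ≤ exp (-(t * L - 1) * log t + (t * ((1 + η) * L) + 8 * t)) := by
    refine (sum_filter_lt_card_primeFactors_inv_le ht1.le _ _).trans ?_
    rw [← exp_add]
    gcongr
  have h2 : ∑ d ∈ Finset.Icc 1 ⌊N⌋₊, (1 : ℝ) / d ≤ 2 * exp L := by
    have := sum_Icc_inv_le_one_add_log hN
    linarith
  calc _ ≤ _ := hmain
    _ ≤ 2 * (N * exp (-((2 - η) * L))) *
        (exp (-(t * L - 1) * log t + (t * ((1 + η) * L) + 8 * t)) * (2 * exp L)) := by gcongr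
    _ = 4 * N * exp (-((2 - η) * L) + (-(t * L - 1) * log t + (t * ((1 + η) * L) + 8 * t)) + L) := by
        rw [exp_add _ L, exp_add (-((2 - η) * L))]
        ring
    _ ≤ 4 * N * exp (log (δ / 4)) := by
        gcongr
        rw [div_le_iff₀ (by positivity)] at hL
        have e : -((2 - η) * L) + (-(t * L - 1) * log t + (t * ((1 + η) * L) + 8 * t)) + L =
            log t + 8 * t - L * κ + L * ((1 + t) * η) := by
          rw [hκ]
          ring
        rw [e, hηκ]
        linarith
    _ = δ * N := by
        rw [exp_log (by positivity)]
        ring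
end

section
/- For every real c' > log 4 − 1 there exist ε > 0 and a constant C > 0 such that for all sufficiently large real N, the number of quadruples (a, b, c, d) of positive integers with ab = cd and with both (a, b) and (c, d) belonging to L(ε, N) is at most C · N · (log N)^{c'}, where L(ε, N) denotes the set of ordered pairs (a, b) of positive integers with 1 < ab ≤ N, a² + b² prime, P(ab) > N^{1/log log N}, ω(a) ≤ (1 + ε) log log N, and ω(b) ≤ (1 + ε) log log N. -/
open Real

/-- The set of ordered pairs `(a, b)` of positive integers with `1 < ab ≤ N`,
`a² + b²` prime, `P(ab) > N^(1 / log log N)`, `ω(a) ≤ (1 + ε) log log N`, and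
`ω(b) ≤ (1 + ε) log log N`. -/
noncomputable def Lset (ε N : ℝ) : Set (ℕ × ℕ) :=
  {p | 0 < p.1 ∧ 0 < p.2 ∧ 1 < p.1 * p.2 ∧ ((p.1 * p.2 : ℕ) : ℝ) ≤ N ∧
    Nat.Prime (p.1 ^ 2 + p.2 ^ 2) ∧
    N ^ (1 / Real.log (Real.log N)) < (maxPrimeFac (p.1 * p.2) : ℝ) ∧
    (p.1.primeFactors.card : ℝ) ≤ (1 + ε) * Real.log (Real.log N) ∧
    (p.2.primeFactors.card : ℝ) ≤ (1 + ε) * Real.log (Real.log N)}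

theorem tsum_rpow_neg_le {s : ℝ} (hs : 1 < s) :
    Summable (fun n : ℕ => (n : ℝ) ^ (-s)) ∧ ∑' n : ℕ, (n : ℝ) ^ (-s) ≤ 1 + 1 / (s - 1) := by
  have hsum : Summable (fun n : ℕ => (n : ℝ) ^ (-s)) := by
    rw [Real.summable_nat_rpow]; linarith
  refine ⟨hsum, ?_⟩
  have h := ZetaAsymptotics.zeta_limit_aux1 hs
  have h0 : 0 ≤ ZetaAsymptotics.termTSum s :=
    tsum_nonneg fun n => ZetaAsymptotics.term_nonneg _ _
  rw [hsum.tsum_eq_zero_add]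
  have h1 : ∑' n : ℕ, ((n + 1 : ℕ) : ℝ) ^ (-s) = ∑' n : ℕ, 1 / (n + 1 : ℝ) ^ s := by
    refine tsum_congr fun n => ?_
    rw [Real.rpow_neg (by positivity)]
    push_cast
    simp
  rw [h1, Nat.cast_zero, Real.zero_rpow (by linarith)]
  have : 0 ≤ s * ZetaAsymptotics.termTSum s := mul_nonneg (by linarith) h0
  linarith

theorem sum_primesLE_rpow_neg_le {s : ℝ} (hs : 1 < s) (k : ℕ) :
    ∑ p ∈ Nat.primesLE k, (p : ℝ) ^ (-s) ≤ Real.log (1 + 1 / (s - 1)) := by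
  obtain ⟨hsum, hle⟩ := tsum_rpow_neg_le hs
  let f : ℕ →* ℝ :=
    { toFun := fun n => (n : ℝ) ^ (-s)
      map_one' := by simp
      map_mul' := fun m n => by
        push_cast
        exact Real.mul_rpow (by positivity) (by positivity) }
  have hf : ∀ n, f n = (n : ℝ) ^ (-s) := fun n => rfl
  have hfs : Summable f := hsum
  have hprod := EulerProduct.prod_primesBelow_geometric_eq_tsum_smoothNumbers hfs (k + 1)
  have hle2 : ∑' m : Nat.smoothNumbers (k + 1), f m ≤ 1 + 1 / (s - 1) :=
    (Summable.tsum_subtype_le f (Nat.smoothNumbers (k + 1)) (fun n => by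
      rw [hf]; positivity) hfs).trans hle
  have hpos : 0 < 1 + 1 / (s - 1) := by
    have : 0 < s - 1 := by linarith
    positivity
  rw [Real.le_log_iff_exp_le hpos, Real.exp_sum]
  refine le_trans ?_ hle2
  rw [← hprod]
  refine Finset.prod_le_prod (fun p _ => (Real.exp_pos _).le) fun p hp => ?_
  have hp2 : 2 ≤ p := (Nat.mem_primesLE.mp hp).2.two_le
  have hlt : (p : ℝ) ^ (-s) < 1 :=
    Real.rpow_lt_one_of_one_lt_of_neg (by exact_mod_cast hp2) (by linarith)
  rw [hf]
  have h1 : 1 - (p : ℝ) ^ (-s) ≤ Real.exp (-(p : ℝ) ^ (-s)) := by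
    have := Real.add_one_le_exp (-(p : ℝ) ^ (-s))
    linarith
  rw [le_inv_comm₀ (Real.exp_pos _) (by linarith), ← Real.exp_neg]
  exact h1

/-- Mertens' upper bound for the sum of the reciprocals of the primes, up to a factor `1 + δ`. -/
theorem sum_inv_primesLE_le {δ : ℝ} (hδ : 0 < δ) :
    ∃ C : ℝ, 0 ≤ C ∧ ∀ x : ℝ, 3 ≤ x →
      ∑ p ∈ Nat.primesLE ⌊x⌋₊, (1 / p : ℝ) ≤ (1 + δ) * Real.log (Real.log x) + C := by
  set η := Real.log (1 + δ) with hη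
  have hηpos : 0 < η := Real.log_pos (by linarith)
  refine ⟨(1 + δ) * Real.log (1 + 1 / η),
    mul_nonneg (by linarith) (Real.log_nonneg (by linarith [one_div_pos.mpr hηpos])),
    fun x hx => ?_⟩
  have hlogx : 1 ≤ Real.log x := by
    rw [Real.le_log_iff_exp_le (by linarith)]
    linarith [Real.exp_one_lt_d9]
  set s := 1 + η / Real.log x with hs
  have hs1 : 1 < s := by
    have : 0 < η / Real.log x := by positivity
    linarith
  have hterm : ∀ p ∈ Nat.primesLE ⌊x⌋₊, (1 / p : ℝ) ≤ (1 + δ) * (p : ℝ) ^ (-s) := by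
    intro p hp
    obtain ⟨hpx, hpp⟩ := Nat.mem_primesLE.mp hp
    have hp0 : (0 : ℝ) < p := by exact_mod_cast hpp.pos
    have hpx' : (p : ℝ) ≤ x := (Nat.le_floor_iff (by linarith)).mp hpx
    have h1 : (p : ℝ) ^ (η / Real.log x) ≤ 1 + δ := by
      rw [Real.rpow_def_of_pos hp0]
      have : Real.log p * (η / Real.log x) ≤ η := by
        rw [mul_div_assoc', div_le_iff₀ (by linarith)]
        have := Real.log_le_log hp0 hpx'
        nlinarith
      calc _ ≤ Real.exp η := Real.exp_le_exp.mpr this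
        _ = 1 + δ := Real.exp_log (by linarith)
    have h2 : (p : ℝ) ^ (-s) = (1 / p) * ((p : ℝ) ^ (η / Real.log x))⁻¹ := by
      rw [hs, neg_add, Real.rpow_add hp0, Real.rpow_neg_one, Real.rpow_neg hp0.le, one_div]
    rw [h2]
    have h3 : 0 < (p : ℝ) ^ (η / Real.log x) := Real.rpow_pos_of_pos hp0 _
    have h4 : 1 ≤ (1 + δ) * ((p : ℝ) ^ (η / Real.log x))⁻¹ := by
      rw [← div_eq_mul_inv, one_le_div h3]; exact h1
    have h5 : (0 : ℝ) ≤ 1 / p := by positivity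
    nlinarith
  calc ∑ p ∈ Nat.primesLE ⌊x⌋₊, (1 / p : ℝ)
      ≤ ∑ p ∈ Nat.primesLE ⌊x⌋₊, (1 + δ) * (p : ℝ) ^ (-s) := Finset.sum_le_sum hterm
    _ = (1 + δ) * ∑ p ∈ Nat.primesLE ⌊x⌋₊, (p : ℝ) ^ (-s) := by rw [Finset.mul_sum]
    _ ≤ (1 + δ) * Real.log (1 + 1 / (s - 1)) := by
        gcongr; exact sum_primesLE_rpow_neg_le hs1 _
    _ ≤ (1 + δ) * Real.log (Real.log x * (1 + 1 / η)) := by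
        gcongr
        rw [hs]
        have : 1 / (1 + η / Real.log x - 1) = Real.log x * (1 / η) := by
          rw [add_sub_cancel_left, one_div_div, mul_one_div]
        rw [this]; linarith
    _ = _ := by
        rw [Real.log_mul (by linarith) (by have := one_div_pos.mpr hηpos; linarith)]
        ring

theorem two_pow_neg_card_primeFactors_mul {m n : ℕ} (h : Nat.Coprime m n) :
    ((1 / 2 : ℝ) ^ (m * n).primeFactors.card) =
      (1 / 2 : ℝ) ^ m.primeFactors.card * (1 / 2 : ℝ) ^ n.primeFactors.card := by
  rw [h.primeFactors_mul, Finset.card_union_of_disjoint h.disjoint_primeFactors, pow_add]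

theorem sum_half_pow_card_primeFactors_div_le_prod (k : ℕ) :
    ∑ m ∈ Finset.Icc 1 k, (1 / 2 : ℝ) ^ m.primeFactors.card / m ≤
      ∏ p ∈ Nat.primesLE k, (1 + (1 / 2) * (1 / (p - 1 : ℝ))) := by
  obtain ⟨f, hf⟩ : ∃ f : ℕ → ℝ, f = fun m : ℕ => (1 / 2 : ℝ) ^ m.primeFactors.card / m := ⟨_, rfl⟩
  have hfm : ∀ m : ℕ, (1 / 2 : ℝ) ^ m.primeFactors.card / m = f m := fun m => by rw [hf]
  simp only [hfm]
  have hf1 : f 1 = 1 := by simp [hf]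
  have hmul : ∀ {m n : ℕ}, Nat.Coprime m n → f (m * n) = f m * f n := by
    intro m n h
    simp only [hf]
    rw [two_pow_neg_card_primeFactors_mul h]
    push_cast
    rw [mul_div_mul_comm]
  have hpow : ∀ {p : ℕ}, p.Prime → ∀ n : ℕ,
      f (p ^ (n + 1)) = (1 / 2) * ((1 / p : ℝ) * (1 / p : ℝ) ^ n) := by
    intro p hp n
    simp only [hf]
    rw [Nat.primeFactors_prime_pow (Nat.succ_ne_zero n) hp]
    simp [pow_succ]
    field_simp
  have hgeo : ∀ {p : ℕ}, p.Prime →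
      HasSum (fun n : ℕ => f (p ^ n)) (1 + (1 / 2) * (1 / (p - 1 : ℝ))) := by
    intro p hp
    have hp1 : (1 : ℝ) < p := by exact_mod_cast hp.one_lt
    have h := (hasSum_geometric_of_lt_one (r := (1 / p : ℝ)) (by positivity)
      (by rw [div_lt_one (by linarith)]; exact hp1)).mul_left (1 / 2 * (1 / p : ℝ))
    have hval : 1 / 2 * (1 / p : ℝ) * (1 - 1 / p : ℝ)⁻¹ =
        1 + (1 / 2) * (1 / (p - 1 : ℝ)) - ∑ i ∈ Finset.range 1, f (p ^ i) := by
      have h1 : (p : ℝ) - 1 ≠ 0 := by linarith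
      have h2 : (p : ℝ) ≠ 0 := by linarith
      rw [Finset.sum_range_one, pow_zero, hf1, one_sub_div h2, inv_div]
      field_simp
      ring
    have hfun : (fun n : ℕ => 1 / 2 * (1 / p : ℝ) * (1 / p : ℝ) ^ n) =
        fun n => f (p ^ (n + 1)) := by
      funext n
      rw [hpow hp, mul_assoc]
    rw [hval, hfun] at h
    exact (hasSum_nat_add_iff' 1).mp h
  have hnn : ∀ m, 0 ≤ f m := fun m => by simp only [hf]; positivity
  obtain ⟨hs, hh⟩ := EulerProduct.summable_and_hasSum_smoothNumbers_prod_primesBelow_tsum hf1 hmul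
    (fun {p} hp => by
      simpa only [Real.norm_of_nonneg (hnn _)] using (hgeo hp).summable) (k + 1)
  have hprod : ∏ p ∈ Nat.primesBelow (k + 1), ∑' n : ℕ, f (p ^ n) =
      ∏ p ∈ Nat.primesLE k, (1 + (1 / 2) * (1 / (p - 1 : ℝ))) :=
    Finset.prod_congr rfl fun p hp => (hgeo (Nat.mem_primesLE.mp hp).2).tsum_eq
  rw [hprod] at hh
  have hind := hasSum_subtype_iff_indicator.mp hh
  have := sum_le_hasSum (Finset.Icc 1 k) (fun i _ => Set.indicator_nonneg (fun m _ => hnn m) i) hind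
  refine le_trans (Finset.sum_le_sum fun m hm => ?_) this
  rw [Finset.mem_Icc] at hm
  rw [Set.indicator_of_mem]
  rw [Nat.mem_smoothNumbers_iff_forall_le]
  refine ⟨by omega, fun p hp hpp hpd => ?_⟩
  have := Nat.le_of_dvd (by omega) hpd
  omega

theorem sum_half_pow_card_primeFactors_div_le {δ : ℝ} (hδ : 0 < δ) :
    ∃ C : ℝ, 0 < C ∧ ∀ x : ℝ, 3 ≤ x →
      ∑ m ∈ Finset.Icc 1 ⌊x⌋₊, (1 / 2 : ℝ) ^ m.primeFactors.card / m ≤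
        C * Real.log x ^ (1 / 2 + δ) := by
  obtain ⟨C, hC0, hC⟩ := sum_inv_primesLE_le (δ := 2 * δ) (by linarith)
  obtain ⟨hsum2, -⟩ := tsum_rpow_neg_le (s := 2) (by norm_num)
  set D := ∑' n : ℕ, (n : ℝ) ^ (-2 : ℝ)
  refine ⟨Real.exp (C / 2 + D), Real.exp_pos _, fun x hx => ?_⟩
  have hlogx : 1 ≤ Real.log x := by
    rw [Real.le_log_iff_exp_le (by linarith)]
    linarith [Real.exp_one_lt_d9]
  refine (sum_half_pow_card_primeFactors_div_le_prod _).trans ?_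
  have h1 : ∏ p ∈ Nat.primesLE ⌊x⌋₊, (1 + (1 / 2) * (1 / (p - 1 : ℝ))) ≤
      Real.exp (∑ p ∈ Nat.primesLE ⌊x⌋₊, ((1 / 2) * (1 / p : ℝ) + (p : ℝ) ^ (-2 : ℝ))) := by
    rw [Real.exp_sum]
    refine Finset.prod_le_prod (fun p hp => ?_) fun p hp => ?_
    · have hp1 : (1 : ℝ) < p := by exact_mod_cast (Nat.mem_primesLE.mp hp).2.one_lt
      have : (0 : ℝ) < p - 1 := by linarith
      positivity
    · have hp2 : (2 : ℝ) ≤ p := by exact_mod_cast (Nat.mem_primesLE.mp hp).2.two_le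
      have h := Real.add_one_le_exp ((1 / 2) * (1 / p : ℝ) + (p : ℝ) ^ (-2 : ℝ))
      refine le_trans ?_ h
      have h2 : (p : ℝ) ^ (-2 : ℝ) = 1 / (p : ℝ) ^ 2 := by
        rw [Real.rpow_neg (by linarith), one_div]; norm_cast
      have h3 : 1 / (p - 1 : ℝ) ≤ 1 / p + 2 * (1 / (p : ℝ) ^ 2) := by
        have hp1 : (0 : ℝ) < p - 1 := by linarith
        have : 1 / (p : ℝ) + 2 * (1 / (p : ℝ) ^ 2) - 1 / (p - 1 : ℝ)
            = (p - 2) / (p ^ 2 * (p - 1)) := by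
          field_simp
          ring
        have h4 : 0 ≤ ((p : ℝ) - 2) / (p ^ 2 * (p - 1)) := by
          apply div_nonneg (by linarith); positivity
        linarith
      rw [h2]
      linarith
  refine h1.trans ?_
  rw [Finset.sum_add_distrib, ← Finset.mul_sum]
  have h2 : ∑ p ∈ Nat.primesLE ⌊x⌋₊, (p : ℝ) ^ (-2 : ℝ) ≤ D :=
    hsum2.sum_le_tsum _ fun n _ => by positivity
  have h3 := hC x hx
  have h4 : Real.log x ^ (1 / 2 + δ) = Real.exp ((1 / 2 + δ) * Real.log (Real.log x)) := by
    rw [Real.rpow_def_of_pos (by linarith), mul_comm]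
  rw [h4, ← Real.exp_add]
  apply Real.exp_le_exp.mpr
  linarith

section ResidueClass

open ArithmeticFunction.vonMangoldt

theorem residueClass_div_log_mem_Icc {q : ℕ} (a : ZMod q) (n : ℕ) :
    residueClass a n / Real.log n ∈ Set.Icc (0 : ℝ) 1 := by
  have hlog : 0 ≤ Real.log n := Real.log_natCast_nonneg n
  refine ⟨div_nonneg (residueClass_nonneg a n) hlog, div_le_one_of_le₀ ?_ hlog⟩
  exact (residueClass_le a n).trans ArithmeticFunction.vonMangoldt_le_log

theorem summable_residueClass_div_log_mul_rpow {q : ℕ} (a : ZMod q) {s : ℝ} (hs : 1 < s) :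
    Summable (fun n : ℕ => residueClass a n / Real.log n * (n : ℝ) ^ (-s)) := by
  refine Summable.of_nonneg_of_le (fun n => ?_) (fun n => ?_) (tsum_rpow_neg_le hs).1
  · exact mul_nonneg (residueClass_div_log_mem_Icc a n).1 (by positivity)
  · exact mul_le_of_le_one_left (by positivity) (residueClass_div_log_mem_Icc a n).2

theorem tsum_residueClass_div_log_sub_ge {q : ℕ} (a : ZMod q) {s t : ℝ} (hs : 1 < s)
    (hst : s ≤ t) :
    (t - s) * ∑' n : ℕ, residueClass a n / (n : ℝ) ^ t ≤
      ∑' n : ℕ, residueClass a n / Real.log n * (n : ℝ) ^ (-s) -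
        ∑' n : ℕ, residueClass a n / Real.log n * (n : ℝ) ^ (-t) := by
  have ht : 1 < t := hs.trans_le hst
  have hw : Summable (fun n : ℕ => residueClass a n / (n : ℝ) ^ t) :=
    LSeries.summable_real_of_abscissaOfAbsConv_lt <|
      (abscissaOfAbsConv_residueClass_le_one a).trans_lt <| mod_cast ht
  rw [← tsum_mul_left, ← (summable_residueClass_div_log_mul_rpow a hs).tsum_sub
    (summable_residueClass_div_log_mul_rpow a ht)]
  refine Summable.tsum_le_tsum (fun n => ?_) (hw.mul_left _)
    ((summable_residueClass_div_log_mul_rpow a hs).sub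
      (summable_residueClass_div_log_mul_rpow a ht))
  have hwn := residueClass_nonneg a n
  rcases le_or_gt n 1 with hn | hn
  · have h0 : residueClass a n = 0 := by
      refine le_antisymm ((residueClass_le a n).trans ?_) hwn
      refine ArithmeticFunction.vonMangoldt_le_log.trans ?_
      exact Real.log_nonpos (by positivity) (by exact_mod_cast hn)
    simp [h0]
  · have hn1 : (1 : ℝ) < n := by exact_mod_cast hn
    have hlog : 0 < Real.log n := Real.log_pos hn1
    have h1 : (n : ℝ) ^ (-s) = (n : ℝ) ^ (-t) * (n : ℝ) ^ (t - s) := by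
      rw [← Real.rpow_add (by linarith)]; congr 1; ring
    have h2 : 1 + (t - s) * Real.log n ≤ (n : ℝ) ^ (t - s) := by
      rw [Real.rpow_def_of_pos (by linarith)]
      have := Real.add_one_le_exp (Real.log n * (t - s))
      linarith
    have h3 : 0 < (n : ℝ) ^ (-t) := by positivity
    have h4 : residueClass a n / Real.log n * (n : ℝ) ^ (-s) -
        residueClass a n / Real.log n * (n : ℝ) ^ (-t) =
        residueClass a n / Real.log n * (n : ℝ) ^ (-t) * ((n : ℝ) ^ (t - s) - 1) := by
      rw [h1]; ring
    have h5 : (t - s) * (residueClass a n / (n : ℝ) ^ t) =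
        residueClass a n / Real.log n * (n : ℝ) ^ (-t) * ((t - s) * Real.log n) := by
      rw [Real.rpow_neg (by linarith)]; field_simp
    rw [h4, h5]
    refine mul_le_mul_of_nonneg_left (by linarith) ?_
    exact mul_nonneg (residueClass_div_log_mem_Icc a n).1 h3.le

theorem tsum_residueClass_div_log_ge {q : ℕ} [NeZero q] {a : ZMod q} (ha : IsUnit a)
    {θ : ℝ} (h0 : 0 < θ) (h1 : θ < 1) :
    ∃ C : ℝ, 0 ≤ C ∧ ∀ η : ℝ, 0 < η → η ≤ 1 →
      (q.totient : ℝ)⁻¹ * θ * Real.log (1 / η) - C ≤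
        ∑' n : ℕ, residueClass a n / Real.log n * (n : ℝ) ^ (-(1 + η)) := by
  obtain ⟨C, hC⟩ := LSeries_residueClass_lower_bound ha
  set φ := (q.totient : ℝ)⁻¹ with hφ
  have hφ0 : 0 ≤ φ := by positivity
  set F : ℝ → ℝ := fun s => ∑' n : ℕ, residueClass a n / Real.log n * (n : ℝ) ^ (-s) with hF
  have hF0 : ∀ s, 0 ≤ F s := fun s => tsum_nonneg fun n =>
    mul_nonneg (residueClass_div_log_mem_Icc a n).1 (by positivity)
  have hstep : ∀ k : ℕ, (1 - θ) * φ - |C| * (θ ^ k - θ ^ (k + 1)) ≤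
      F (1 + θ ^ (k + 1)) - F (1 + θ ^ k) := by
    intro k
    have hk : 0 < θ ^ k := by positivity
    have hkk : θ ^ (k + 1) ≤ θ ^ k := pow_le_pow_of_le_one h0.le h1.le (Nat.le_succ k)
    have hk1 : θ ^ k ≤ 1 := pow_le_one₀ h0.le h1.le
    have h2 := tsum_residueClass_div_log_sub_ge a (s := 1 + θ ^ (k + 1)) (t := 1 + θ ^ k)
      (by have : 0 < θ ^ (k + 1) := by positivity
          linarith) (by linarith)
    have h3 := hC (x := 1 + θ ^ k) ⟨by linarith, by linarith⟩
    rw [add_sub_cancel_left] at h3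
    refine le_trans ?_ h2
    have h4 : 0 ≤ 1 + θ ^ k - (1 + θ ^ (k + 1)) := by linarith
    refine le_trans ?_ (mul_le_mul_of_nonneg_left h3 h4)
    have h5 : (1 + θ ^ k - (1 + θ ^ (k + 1))) * (φ / θ ^ k - C) =
        (1 - θ) * φ - C * (θ ^ k - θ ^ (k + 1)) := by
      rw [pow_succ]; field_simp; ring
    rw [h5]
    have := mul_le_mul_of_nonneg_right (le_abs_self C) (sub_nonneg.mpr hkk)
    linarith
  have hsum : ∀ K : ℕ, K * ((1 - θ) * φ) - |C| ≤ F (1 + θ ^ K) := by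
    intro K
    have : K * ((1 - θ) * φ) - |C| * (1 - θ ^ K) ≤ F (1 + θ ^ K) := by
      induction K with
      | zero => simpa using hF0 (1 + 1)
      | succ K ih =>
        have := hstep K
        push_cast
        nlinarith
    have h2 : 0 ≤ |C| * θ ^ K := by positivity
    nlinarith
  refine ⟨|C| + φ, by positivity, fun η hη hη1 => ?_⟩
  have hlθ : 0 < Real.log (1 / θ) := Real.log_pos (by rw [lt_div_iff₀ h0]; linarith)
  have hlη : 0 ≤ Real.log (1 / η) := Real.log_nonneg (by rw [le_div_iff₀ hη]; linarith)
  set K := ⌊Real.log (1 / η) / Real.log (1 / θ)⌋₊ with hK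
  have hK1 : (K : ℝ) * Real.log (1 / θ) ≤ Real.log (1 / η) := by
    rw [← le_div_iff₀ hlθ]; exact Nat.floor_le (by positivity)
  have hK2 : Real.log (1 / η) / Real.log (1 / θ) < K + 1 := Nat.lt_floor_add_one _
  have hηθ : η ≤ θ ^ K := by
    rw [← Real.log_le_log_iff hη (by positivity), Real.log_pow]
    rw [one_div, one_div, Real.log_inv, Real.log_inv] at hK1
    linarith
  have hmono : F (1 + θ ^ K) ≤ F (1 + η) := by
    have h2 := tsum_residueClass_div_log_sub_ge a (s := 1 + η) (t := 1 + θ ^ K)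
      (by linarith) (by linarith)
    have h3 : 0 ≤ (1 + θ ^ K - (1 + η)) * ∑' n : ℕ, residueClass a n / (n : ℝ) ^ (1 + θ ^ K) :=
      mul_nonneg (by linarith) (tsum_nonneg fun n =>
        div_nonneg (residueClass_nonneg a n) (by positivity))
    have h4 := h3.trans h2
    simp only [hF]
    linarith
  refine le_trans ?_ hmono
  refine le_trans ?_ (hsum K)
  have h6 : θ * Real.log (1 / θ) ≤ 1 - θ := by
    have := Real.log_le_sub_one_of_pos (x := 1 / θ) (by positivity)
    calc θ * Real.log (1 / θ) ≤ θ * (1 / θ - 1) := by gcongr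
      _ = 1 - θ := by field_simp
  have h7 : θ * Real.log (1 / η) ≤ (K + 1) * (1 - θ) := by
    rw [div_lt_iff₀ hlθ] at hK2
    calc θ * Real.log (1 / η) ≤ θ * ((K + 1) * Real.log (1 / θ)) := by gcongr
      _ = (K + 1) * (θ * Real.log (1 / θ)) := by ring
      _ ≤ _ := by gcongr
  have h8 := mul_le_mul_of_nonneg_left h7 hφ0
  nlinarith

theorem tsum_residueClass_div_log_le_sum_add {q : ℕ} (a : ZMod q) {x η : ℝ} (hx : 1 ≤ x)
    (hη : 0 < η) :
    ∑' n : ℕ, residueClass a n / Real.log n * (n : ℝ) ^ (-(1 + η)) ≤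
      ∑ n ∈ Finset.range (⌊x⌋₊ + 1), residueClass a n / Real.log n / n +
        x ^ (-(η / 2)) * (1 + 2 / η) := by
  have hs := summable_residueClass_div_log_mul_rpow a (s := 1 + η) (by linarith)
  obtain ⟨hz, hz1⟩ := tsum_rpow_neg_le (s := 1 + η / 2) (by linarith)
  rw [← hs.sum_add_tsum_nat_add (⌊x⌋₊ + 1)]
  refine add_le_add (Finset.sum_le_sum fun n _ => ?_) ?_
  · rcases Nat.eq_zero_or_pos n with rfl | hn
    · simp
    · have hn1 : (1 : ℝ) ≤ n := by exact_mod_cast hn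
      rw [div_eq_mul_inv _ (n : ℝ), ← Real.rpow_neg_one]
      refine mul_le_mul_of_nonneg_left ?_ (residueClass_div_log_mem_Icc a n).1
      exact Real.rpow_le_rpow_of_exponent_le hn1 (by linarith)
  · have hz2 : ∑' n : ℕ, ((n + (⌊x⌋₊ + 1) : ℕ) : ℝ) ^ (-(1 + η / 2)) ≤ 1 + 2 / η := by
      have h1 := hz.sum_add_tsum_nat_add (⌊x⌋₊ + 1)
      have h2 : 0 ≤ ∑ n ∈ Finset.range (⌊x⌋₊ + 1), (n : ℝ) ^ (-(1 + η / 2)) :=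
        Finset.sum_nonneg fun n _ => by positivity
      have h3 : 1 / (1 + η / 2 - 1) = 2 / η := by
        rw [add_sub_cancel_left, one_div_div]
      rw [h3] at hz1
      linarith
    have hz3 : Summable fun n : ℕ => ((n + (⌊x⌋₊ + 1) : ℕ) : ℝ) ^ (-(1 + η / 2)) :=
      hz.comp_injective (add_left_injective (⌊x⌋₊ + 1))
    have hs3 : Summable fun n : ℕ => residueClass a (n + (⌊x⌋₊ + 1)) /
        Real.log ((n + (⌊x⌋₊ + 1) : ℕ) : ℝ) * ((n + (⌊x⌋₊ + 1) : ℕ) : ℝ) ^ (-(1 + η)) :=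
      hs.comp_injective (add_left_injective (⌊x⌋₊ + 1))
    refine le_trans ?_ (mul_le_mul_of_nonneg_left hz2 (by positivity))
    rw [← tsum_mul_left]
    refine Summable.tsum_le_tsum (fun n => ?_) hs3
      (hz3.mul_left _)
    refine (mul_le_of_le_one_left (by positivity) (residueClass_div_log_mem_Icc a _).2).trans ?_
    have hxn : x ≤ ((n + (⌊x⌋₊ + 1) : ℕ) : ℝ) := by
      push_cast
      have := Nat.lt_floor_add_one x
      have : (0 : ℝ) ≤ n := by positivity
      linarith
    have hpos : (0 : ℝ) < ((n + (⌊x⌋₊ + 1) : ℕ) : ℝ) := by linarith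
    have : -(1 + η) = -(η / 2) + -(1 + η / 2) := by ring
    rw [this, Real.rpow_add hpos]
    refine mul_le_mul_of_nonneg_right ?_ (by positivity)
    exact Real.rpow_le_rpow_of_nonpos (by linarith) hxn (by linarith)

theorem sum_residueClass_div_log_div_le {q : ℕ} (a : ZMod q) :
    ∃ C : ℝ, 0 ≤ C ∧ ∀ k : ℕ,
      ∑ n ∈ Finset.range (k + 1), residueClass a n / Real.log n / n ≤
        ∑ p ∈ (Nat.primesLE k).filter (fun p : ℕ => (p : ZMod q) = a), (1 / p : ℝ) + C := by
  have hs := summable_residueClass_non_primes_div (a := a)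
  have hnn : ∀ n : ℕ, 0 ≤ (if n.Prime then 0 else residueClass a n) / (n : ℝ) := fun n =>
    div_nonneg (by split_ifs; exacts [le_rfl, residueClass_nonneg a n]) (by positivity)
  refine ⟨(Real.log 2)⁻¹ * ∑' n : ℕ, (if n.Prime then 0 else residueClass a n) / (n : ℝ),
    mul_nonneg (inv_nonneg.mpr (Real.log_nonneg (by norm_num))) (tsum_nonneg hnn), fun k => ?_⟩
  have hl2 : 0 < Real.log 2 := Real.log_pos (by norm_num)
  have h1 := mul_le_mul_of_nonneg_left
    (hs.sum_le_tsum (Finset.range (k + 1)) fun n _ => hnn n) (inv_nonneg.mpr hl2.le)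
  refine le_trans ?_ (add_le_add le_rfl h1)
  rw [Nat.primesLE_eq_filter_range, Finset.filter_filter, Finset.sum_filter, Finset.mul_sum,
    ← Finset.sum_add_distrib]
  refine Finset.sum_le_sum fun n _ => ?_
  by_cases hp : n.Prime
  · have hlog : 0 < Real.log n := Real.log_pos (by exact_mod_cast hp.one_lt)
    by_cases hna : (n : ZMod q) = a
    · have : residueClass a n = Real.log n := by
        rw [residueClass, Set.indicator_of_mem (by exact hna),
          ArithmeticFunction.vonMangoldt_apply_prime hp]
      rw [this, if_pos ⟨hp, hna⟩, if_pos hp, div_self hlog.ne']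
      simp
    · have : residueClass a n = 0 := Set.indicator_of_notMem (s := {n : ℕ | (n : ZMod q) = a}) hna _
      rw [this, if_pos hp, if_neg (fun h => hna h.2)]
      simp
  · simp only [hp, false_and, if_false, zero_add]
    rcases le_or_gt n 1 with hn | hn
    · have : Real.log n = 0 := by interval_cases n <;> simp
      rw [this]
      simpa using mul_nonneg (inv_nonneg.mpr hl2.le)
        (div_nonneg (residueClass_nonneg a n) (by positivity))
    · have h2 : Real.log 2 ≤ Real.log n :=
        Real.log_le_log (by norm_num) (by exact_mod_cast hn)
      rw [div_right_comm, div_eq_inv_mul]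
      refine mul_le_mul_of_nonneg_right ?_
        (div_nonneg (residueClass_nonneg a n) (by positivity))
      exact inv_anti₀ hl2 h2

/-- Mertens' lower bound for primes in an invertible residue class, up to a factor `1 - δ`. -/
theorem sum_inv_primesLE_filter_ge {q : ℕ} [NeZero q] {a : ZMod q} (ha : IsUnit a)
    {δ : ℝ} (h0 : 0 < δ) (h1 : δ < 1) :
    ∃ C : ℝ, 0 ≤ C ∧ ∀ x : ℝ, 3 ≤ x →
      (q.totient : ℝ)⁻¹ * (1 - δ) ^ 2 * Real.log (Real.log x) - C ≤
        ∑ p ∈ (Nat.primesLE ⌊x⌋₊).filter (fun p : ℕ => (p : ZMod q) = a), (1 / p : ℝ) := by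
  obtain ⟨C₁, hC₁, h⟩ := tsum_residueClass_div_log_ge ha (θ := 1 - δ) (by linarith) (by linarith)
  obtain ⟨C₂, hC₂, h'⟩ := sum_residueClass_div_log_div_le a
  have hbdd : ∃ C₃ : ℝ, 0 ≤ C₃ ∧ ∀ y : ℝ, 1 ≤ y →
      Real.exp (-(y ^ δ / 2)) * (1 + 2 * y ^ (1 - δ)) ≤ C₃ := by
    have hδ' : 0 < 1 / δ := by positivity
    refine ⟨3 * ∑ i ∈ Finset.range (⌈1 / δ⌉₊ + 1), (2 : ℝ) ^ i * i.factorial,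
      by positivity, fun y hy => ?_⟩
    set m := ⌈1 / δ⌉₊ with hm
    have hy1 : 1 + 2 * y ^ (1 - δ) ≤ 3 * y := by
      have : y ^ (1 - δ) ≤ y ^ (1 : ℝ) := Real.rpow_le_rpow_of_exponent_le hy (by linarith)
      rw [Real.rpow_one] at this
      linarith
    set v := y ^ δ / 2 with hv
    have hyd : 1 ≤ y ^ δ := Real.one_le_rpow hy h0.le
    have hyv : y ≤ (2 * v) ^ m := by
      have h2v : 2 * v = y ^ δ := by rw [hv]; ring
      rw [h2v, ← Real.rpow_natCast, ← Real.rpow_mul (by linarith)]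
      calc y = y ^ (1 : ℝ) := (Real.rpow_one y).symm
        _ ≤ _ := Real.rpow_le_rpow_of_exponent_le hy (by
          have := Nat.le_ceil (1 / δ)
          rw [div_le_iff₀ h0] at this
          rw [hm]; linarith)
    have hexp : v ^ m ≤ m.factorial * Real.exp v := by
      have := Real.pow_div_factorial_le_exp v (by positivity) m
      rw [div_le_iff₀ (by positivity)] at this
      linarith
    have h3 : (2 : ℝ) ^ m * m.factorial ≤
        ∑ i ∈ Finset.range (m + 1), (2 : ℝ) ^ i * i.factorial :=
      Finset.single_le_sum (f := fun i => (2 : ℝ) ^ i * (i.factorial : ℝ))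
        (fun i _ => by positivity) (Finset.self_mem_range_succ m)
    rw [Real.exp_neg, inv_mul_le_iff₀ (Real.exp_pos v)]
    calc 1 + 2 * y ^ (1 - δ) ≤ 3 * (2 * v) ^ m := by linarith
      _ = 3 * (2 ^ m * v ^ m) := by rw [mul_pow]
      _ ≤ 3 * (2 ^ m * (m.factorial * Real.exp v)) := by gcongr
      _ = Real.exp v * (3 * (2 ^ m * m.factorial)) := by ring
      _ ≤ _ := by gcongr
  obtain ⟨C₃, hC₃, h''⟩ := hbdd
  refine ⟨C₁ + C₂ + C₃, by positivity, fun x hx => ?_⟩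
  have hy : 1 ≤ Real.log x := by
    rw [Real.le_log_iff_exp_le (by linarith)]
    linarith [Real.exp_one_lt_d9]
  set y := Real.log x with hyx
  set η := y ^ (-(1 - δ)) with hη
  have hη0 : 0 < η := by positivity
  have hη1 : η ≤ 1 := Real.rpow_le_one_of_one_le_of_nonpos hy (by linarith)
  have hinv : 1 / η = y ^ (1 - δ) := by rw [hη, Real.rpow_neg (by linarith), one_div, inv_inv]
  have h2 := h η hη0 hη1
  have h3 := tsum_residueClass_div_log_le_sum_add a (x := x) (by linarith) hη0
  have h4 := h' ⌊x⌋₊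
  have h5 := h'' y hy
  have h6 : x ^ (-(η / 2)) = Real.exp (-(y ^ δ / 2)) := by
    rw [Real.rpow_def_of_pos (by linarith), ← hyx]
    congr 1
    have : y * η = y ^ δ := by
      rw [hη]
      nth_rewrite 1 [← Real.rpow_one y]
      rw [← Real.rpow_add (by linarith)]
      congr 1; ring
    linarith
  have h7 : 1 + 2 / η = 1 + 2 * y ^ (1 - δ) := by rw [← hinv]; ring
  rw [h6, h7] at h3
  rw [hinv, Real.log_rpow (by linarith)] at h2
  have : (q.totient : ℝ)⁻¹ * (1 - δ) * ((1 - δ) * Real.log y) =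
    (q.totient : ℝ)⁻¹ * (1 - δ) ^ 2 * Real.log y := by ring
  linarith

end ResidueClass

theorem abs_card_filter_natCast_eq_sub_le {q : ℕ} (hq : 0 < q) (X : ℕ) (v : ZMod q) :
    |(((Finset.Ioc 0 X).filter (fun n : ℕ => (n : ZMod q) = v)).card : ℝ) - X / q| ≤ 1 := by
  have : NeZero q := ⟨hq.ne'⟩
  have h1 : (Finset.Ioc 0 X).filter (fun n : ℕ => (n : ZMod q) = v) =
      (Finset.Ioc 0 X).filter (fun n : ℕ => n ≡ v.val [MOD q]) := by
    refine Finset.filter_congr fun n _ => ?_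
    rw [← ZMod.natCast_eq_natCast_iff, ZMod.natCast_zmod_val]
  have h2 := Nat.Ioc_filter_modEq_card 0 X hq v.val
  have hq' : (0 : ℚ) < q := by exact_mod_cast hq
  rw [← h1] at h2
  set c := ((Finset.Ioc 0 X).filter (fun n : ℕ => (n : ZMod q) = v)).card
  have h3 : |(c : ℚ) - X / q| ≤ 1 := by
    have h4 : ((c : ℤ) : ℚ) = (⌊((X : ℚ) - v.val) / q⌋ - ⌊((0 : ℕ) - (v.val : ℚ)) / q⌋ : ℤ) := by
      rw [h2, max_eq_left]
      refine sub_nonneg.mpr (Int.floor_le_floor ?_)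
      gcongr
      simp
    have h5 := Int.floor_le (((X : ℚ) - v.val) / q)
    have h6 := Int.lt_floor_add_one (((X : ℚ) - v.val) / q)
    have h7 := Int.floor_le (((0 : ℕ) - (v.val : ℚ)) / q)
    have h8 := Int.lt_floor_add_one (((0 : ℕ) - (v.val : ℚ)) / q)
    have h9 : (X : ℚ) / q = ((X : ℚ) - v.val) / q - ((0 : ℕ) - (v.val : ℚ)) / q := by
      rw [← sub_div]; congr 1; push_cast; ring
    push_cast at h4 h7 h8 h9
    rw [h4, h9, abs_le]
    constructor <;> linarith
  have h10 : ((|(c : ℚ) - X / q| : ℚ) : ℝ) ≤ ((1 : ℚ) : ℝ) := Rat.cast_le.mpr h3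
  push_cast at h10
  exact h10

theorem exists_finset_zmod_prod (D : Finset ℕ) (hD : ∀ ℓ ∈ D, ℓ.Prime)
    (R : ∀ ℓ : ℕ, Finset (ZMod ℓ)) :
    ∃ V : Finset (ZMod (∏ ℓ ∈ D, ℓ)), V.card = ∏ ℓ ∈ D, (R ℓ).card ∧
      ∀ n : ℕ, (∀ ℓ ∈ D, (n : ZMod ℓ) ∈ R ℓ) ↔ (n : ZMod (∏ ℓ ∈ D, ℓ)) ∈ V := by
  induction D using Finset.induction with
  | empty =>
    rw [Finset.prod_empty]
    exact ⟨{0}, by simp, fun n => by simp [eq_iff_true_of_subsingleton]⟩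
  | insert ℓ D hℓ ih =>
    obtain ⟨V, hV, hn⟩ := ih fun p hp => hD p (Finset.mem_insert_of_mem hp)
    have hcop : Nat.Coprime ℓ (∏ p ∈ D, p) := by
      refine Nat.Coprime.prod_right fun p hp => ?_
      rw [Nat.coprime_primes (hD ℓ (Finset.mem_insert_self _ _))
        (hD p (Finset.mem_insert_of_mem hp))]
      rintro rfl
      exact hℓ hp
    rw [Finset.prod_insert hℓ]
    let e := ZMod.chineseRemainder hcop
    refine ⟨(R ℓ ×ˢ V).map e.symm.toEquiv.toEmbedding, ?_, fun n => ?_⟩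
    · rw [Finset.card_map, Finset.card_product, hV, Finset.prod_insert hℓ]
    · rw [Finset.forall_mem_insert, hn, Finset.mem_map_equiv]
      have : e.symm.toEquiv.symm (n : ZMod (ℓ * ∏ p ∈ D, p)) =
          ((n : ZMod ℓ), (n : ZMod (∏ p ∈ D, p))) := by
        change e (n : ZMod (ℓ * ∏ p ∈ D, p)) = _
        rw [map_natCast]; rfl
      rw [this, Finset.mem_product]

theorem abs_card_filter_forall_mem_sub_le (D : Finset ℕ) (hD : ∀ ℓ ∈ D, ℓ.Prime)
    (R : ∀ ℓ : ℕ, Finset (ZMod ℓ)) (X : ℕ) :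
    |(((Finset.Ioc 0 X).filter (fun n : ℕ => ∀ ℓ ∈ D, (n : ZMod ℓ) ∈ R ℓ)).card : ℝ) -
      X * ∏ ℓ ∈ D, ((R ℓ).card / ℓ : ℝ)| ≤ ∏ ℓ ∈ D, ((R ℓ).card : ℝ) := by
  obtain ⟨q, hqdef, V, hV, hn⟩ : ∃ q, q = ∏ ℓ ∈ D, ℓ ∧ ∃ V : Finset (ZMod q),
      V.card = ∏ ℓ ∈ D, (R ℓ).card ∧ ∀ n : ℕ, (∀ ℓ ∈ D, (n : ZMod ℓ) ∈ R ℓ) ↔ (n : ZMod q) ∈ V :=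
    ⟨_, rfl, exists_finset_zmod_prod D hD R⟩
  have hq : 0 < q := hqdef ▸ Finset.prod_pos fun ℓ h => (hD ℓ h).pos
  simp only [hn]
  have hcard : ((Finset.Ioc 0 X).filter (fun n : ℕ => (n : ZMod q) ∈ V)).card =
      ∑ v ∈ V, ((Finset.Ioc 0 X).filter (fun n : ℕ => (n : ZMod q) = v)).card := by
    refine (Finset.card_eq_sum_card_fiberwise (f := fun n : ℕ => (n : ZMod q)) (t := V)
      (fun n hn => (Finset.mem_filter.mp hn).2)).trans ?_
    refine Finset.sum_congr rfl fun v hv => ?_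
    congr 1
    ext n
    simp only [Finset.mem_filter]
    constructor
    · rintro ⟨⟨h1, -⟩, h3⟩; exact ⟨h1, h3⟩
    · rintro ⟨h1, h3⟩; exact ⟨⟨h1, h3 ▸ hv⟩, h3⟩
  have hmain : (X : ℝ) * ∏ ℓ ∈ D, ((R ℓ).card / ℓ : ℝ) = ∑ _v ∈ V, (X / q : ℝ) := by
    rw [Finset.sum_const, hV, Finset.prod_div_distrib, hqdef, nsmul_eq_mul]
    push_cast
    ring
  rw [hcard, hmain, Nat.cast_sum, ← Finset.sum_sub_distrib]
  refine (Finset.abs_sum_le_sum_abs _ _).trans ?_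
  refine (Finset.sum_le_sum fun v _ => abs_card_filter_natCast_eq_sub_le hq X v).trans ?_
  rw [Finset.sum_const, hV]
  simp

/-- Bonferroni's inequality for the indicator of the empty set. -/
theorem one_or_zero_le_sum_powerset_filter (T : Finset ℕ) {r : ℕ} (hr : Even r) :
    (if T = ∅ then (1 : ℝ) else 0) ≤ ∑ D ∈ T.powerset.filter (·.card ≤ r), (-1 : ℝ) ^ D.card := by
  have h1 : ∑ D ∈ T.powerset.filter (·.card ≤ r), (-1 : ℝ) ^ D.card =
      ((∑ k ∈ Finset.range (r + 1), ((-1) ^ k * T.card.choose k : ℤ) : ℤ) : ℝ) := by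
    rw [← Finset.sum_fiberwise_of_maps_to (g := Finset.card) (t := Finset.range (r + 1))
      (fun D hD => by
        rw [Finset.mem_range]; exact Nat.lt_succ_of_le (Finset.mem_filter.mp hD).2)]
    push_cast
    refine Finset.sum_congr rfl fun k hk => ?_
    have : (T.powerset.filter (·.card ≤ r)).filter (·.card = k) = Finset.powersetCard k T := by
      ext D
      simp only [Finset.mem_filter, Finset.mem_powerset, Finset.mem_powersetCard]
      rw [Finset.mem_range] at hk
      constructor
      · rintro ⟨⟨h, -⟩, h'⟩; exact ⟨h, h'⟩
      · rintro ⟨h, h'⟩; exact ⟨⟨h, by omega⟩, h'⟩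
    rw [this, Finset.sum_congr rfl fun D hD => by rw [(Finset.mem_powersetCard.mp hD).2]]
    rw [Finset.sum_const, Finset.card_powersetCard, nsmul_eq_mul, mul_comm]
  rw [h1]
  split_ifs with hT
  · subst hT
    rw [Finset.card_empty, Finset.sum_range_succ']
    simp
  · obtain ⟨m, hm⟩ := Nat.exists_eq_succ_of_ne_zero (Finset.card_ne_zero.mpr
      (Finset.nonempty_iff_ne_empty.mpr hT))
    rw [hm, Nat.succ_eq_add_one, Int.alternating_sum_range_choose_eq_choose, hr.neg_one_pow]
    positivity

theorem card_le_of_forall_notMem (P : Finset ℕ) (hP : ∀ ℓ ∈ P, ℓ.Prime)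
    (R : ∀ ℓ : ℕ, Finset (ZMod ℓ)) (X : ℕ) (S : Finset ℕ) (hS : S ⊆ Finset.Ioc 0 X)
    (hSR : ∀ n ∈ S, ∀ ℓ ∈ P, (n : ZMod ℓ) ∉ R ℓ) {r : ℕ} (hr : Even r) :
    (S.card : ℝ) ≤ X * (∏ ℓ ∈ P, (1 - (R ℓ).card / ℓ : ℝ) +
        ∑ D ∈ P.powerset.filter (fun D => r < D.card), ∏ ℓ ∈ D, ((R ℓ).card / ℓ : ℝ)) +
      ∑ D ∈ P.powerset.filter (fun D => D.card ≤ r), ∏ ℓ ∈ D, ((R ℓ).card : ℝ) := by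
  set A : Finset ℕ → ℝ := fun D =>
    ((Finset.Ioc 0 X).filter (fun n : ℕ => ∀ ℓ ∈ D, (n : ZMod ℓ) ∈ R ℓ)).card with hA
  set g : Finset ℕ → ℝ := fun D => ∏ ℓ ∈ D, ((R ℓ).card / ℓ : ℝ) with hg
  set low := P.powerset.filter (fun D => D.card ≤ r)
  set high := P.powerset.filter (fun D => r < D.card)
  have hg0 : ∀ D, 0 ≤ g D := fun D => Finset.prod_nonneg fun ℓ _ => by positivity
  have h1 : (S.card : ℝ) ≤ ∑ D ∈ low, (-1 : ℝ) ^ D.card * A D := by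
    have h2 : (S.card : ℝ) ≤ ∑ n ∈ Finset.Ioc 0 X,
        (if P.filter (fun ℓ => (n : ZMod ℓ) ∈ R ℓ) = ∅ then (1 : ℝ) else 0) := by
      rw [← Finset.sum_filter, Finset.sum_const, nsmul_eq_mul, mul_one]
      exact_mod_cast Finset.card_le_card fun n hn => Finset.mem_filter.mpr
        ⟨hS hn, Finset.filter_eq_empty_iff.mpr fun {ℓ} hℓ => hSR n hn ℓ hℓ⟩
    refine h2.trans ((Finset.sum_le_sum fun n _ =>
      one_or_zero_le_sum_powerset_filter _ hr).trans (le_of_eq ?_))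
    have h3 : ∀ D ∈ low, (-1 : ℝ) ^ D.card * A D = ∑ n ∈ Finset.Ioc 0 X,
        if ∀ ℓ ∈ D, (n : ZMod ℓ) ∈ R ℓ then (-1 : ℝ) ^ D.card else 0 := by
      intro D _
      rw [← Finset.sum_filter, Finset.sum_const, nsmul_eq_mul, mul_comm]
    rw [Finset.sum_congr rfl h3, Finset.sum_comm]
    refine Finset.sum_congr rfl fun n _ => ?_
    rw [← Finset.sum_filter]
    refine Finset.sum_congr ?_ fun _ _ => rfl
    ext D
    simp only [low, Finset.mem_filter, Finset.mem_powerset, Finset.subset_iff]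
    constructor
    · rintro ⟨h, h'⟩; exact ⟨⟨fun ℓ hℓ => (h hℓ).1, h'⟩, fun ℓ hℓ => (h hℓ).2⟩
    · rintro ⟨⟨h, h'⟩, h''⟩; exact ⟨fun ℓ hℓ => ⟨h hℓ, h'' ℓ hℓ⟩, h'⟩
  have h2 : ∑ D ∈ low, (-1 : ℝ) ^ D.card * A D ≤
      ∑ D ∈ low, ((-1 : ℝ) ^ D.card * (X * g D) + ∏ ℓ ∈ D, ((R ℓ).card : ℝ)) := by
    refine Finset.sum_le_sum fun D hD => ?_
    have hDP : ∀ ℓ ∈ D, ℓ.Prime := fun ℓ hℓ =>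
      hP ℓ (Finset.mem_powerset.mp (Finset.mem_filter.mp hD).1 hℓ)
    have h3 := abs_le.mp (abs_card_filter_forall_mem_sub_le D hDP R X)
    change -_ ≤ A D - X * g D ∧ A D - X * g D ≤ _ at h3
    rcases neg_one_pow_eq_or ℝ D.card with h | h <;> rw [h] <;> linarith
  refine (h1.trans h2).trans ?_
  rw [Finset.sum_add_distrib]
  gcongr
  have h3 : ∏ ℓ ∈ P, (1 - (R ℓ).card / ℓ : ℝ) =
      ∑ D ∈ low, (-1 : ℝ) ^ D.card * g D + ∑ D ∈ high, (-1 : ℝ) ^ D.card * g D := by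
    have h4 : ∏ ℓ ∈ P, (1 - (R ℓ).card / ℓ : ℝ) = ∏ ℓ ∈ P, (1 + -1 * ((R ℓ).card / ℓ : ℝ)) :=
      Finset.prod_congr rfl fun ℓ _ => by ring
    rw [h4, Finset.prod_one_add, ← Finset.sum_filter_add_sum_filter_not _ (fun D => D.card ≤ r)]
    simp only [not_le, Finset.prod_mul_distrib, Finset.prod_const]
    rfl
  have h5 : -∑ D ∈ high, g D ≤ ∑ D ∈ high, (-1 : ℝ) ^ D.card * g D := by
    rw [← Finset.sum_neg_distrib]
    refine Finset.sum_le_sum fun D _ => ?_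
    have := hg0 D
    rcases neg_one_pow_eq_or ℝ D.card with h | h <;> rw [h] <;> linarith
  have h6 : ∑ D ∈ low, (-1 : ℝ) ^ D.card * (X * g D) = X * ∑ D ∈ low, (-1 : ℝ) ^ D.card * g D := by
    rw [Finset.mul_sum]
    exact Finset.sum_congr rfl fun D _ => by ring
  rw [h6]
  gcongr
  linarith

/-- Brun's pure sieve. -/
theorem card_le_brun (P : Finset ℕ) (hP : ∀ ℓ ∈ P, ℓ.Prime)
    (R : ∀ ℓ : ℕ, Finset (ZMod ℓ)) (X : ℕ) (S : Finset ℕ) (hS : S ⊆ Finset.Ioc 0 X)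
    (hSR : ∀ n ∈ S, ∀ ℓ ∈ P, (n : ZMod ℓ) ∉ R ℓ) {r : ℕ} (hr : Even r)
    {κ Z : ℕ} (hκ : 1 ≤ κ) (hZ : 1 ≤ Z) (hR : ∀ ℓ ∈ P, (R ℓ).card ≤ κ) (hRl : ∀ ℓ ∈ P, κ ≤ ℓ)
    (hPZ : ∀ ℓ ∈ P, ℓ ≤ Z) :
    (S.card : ℝ) ≤ X * (Real.exp (-∑ ℓ ∈ P, ((R ℓ).card / ℓ : ℝ)) +
        Real.exp (3 * ∑ ℓ ∈ P, ((R ℓ).card / ℓ : ℝ) - r)) + 3 * (κ * Z : ℝ) ^ r := by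
  refine (card_le_of_forall_notMem P hP R X S hS hSR hr).trans ?_
  have hZ' : (1 : ℝ) ≤ Z := by exact_mod_cast hZ
  have hκ' : (1 : ℝ) ≤ κ := by exact_mod_cast hκ
  have h1 : ∏ ℓ ∈ P, (1 - (R ℓ).card / ℓ : ℝ) ≤ Real.exp (-∑ ℓ ∈ P, ((R ℓ).card / ℓ : ℝ)) := by
    rw [← Finset.sum_neg_distrib, Real.exp_sum]
    refine Finset.prod_le_prod (fun ℓ hℓ => ?_) fun ℓ hℓ => ?_
    · have : ((R ℓ).card : ℝ) ≤ ℓ := by exact_mod_cast (hR ℓ hℓ).trans (hRl ℓ hℓ)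
      linarith [div_le_one_of_le₀ this (by positivity)]
    · linarith [Real.add_one_le_exp (-((R ℓ).card / ℓ : ℝ))]
  have h2 : ∑ D ∈ P.powerset.filter (fun D => r < D.card), ∏ ℓ ∈ D, ((R ℓ).card / ℓ : ℝ) ≤
      Real.exp (3 * ∑ ℓ ∈ P, ((R ℓ).card / ℓ : ℝ) - r) := by
    have h3 : ∀ D ∈ P.powerset.filter (fun D => r < D.card), ∏ ℓ ∈ D, ((R ℓ).card / ℓ : ℝ) ≤
        Real.exp (-r) * ∏ ℓ ∈ D, (3 * ((R ℓ).card / ℓ : ℝ)) := by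
      intro D hD
      have hc : (r : ℝ) ≤ D.card := by exact_mod_cast (Finset.mem_filter.mp hD).2.le
      rw [Finset.prod_mul_distrib, Finset.prod_const, ← mul_assoc]
      refine le_mul_of_one_le_left (Finset.prod_nonneg fun ℓ _ => by positivity) ?_
      calc 1 ≤ Real.exp (-r) * Real.exp D.card := by
            rw [← Real.exp_add]; exact Real.one_le_exp (by linarith)
        _ ≤ Real.exp (-r) * 3 ^ D.card := by
            gcongr
            rw [← Real.exp_one_pow]
            gcongr
            linarith [Real.exp_one_lt_d9]
    calc _ ≤ ∑ D ∈ P.powerset.filter (fun D => r < D.card),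
            Real.exp (-r) * ∏ ℓ ∈ D, (3 * ((R ℓ).card / ℓ : ℝ)) := Finset.sum_le_sum h3
      _ ≤ ∑ D ∈ P.powerset, Real.exp (-r) * ∏ ℓ ∈ D, (3 * ((R ℓ).card / ℓ : ℝ)) :=
          Finset.sum_le_sum_of_subset_of_nonneg (Finset.filter_subset _ _) fun D _ _ =>
            mul_nonneg (Real.exp_pos _).le (Finset.prod_nonneg fun ℓ _ => by positivity)
      _ = Real.exp (-r) * ∏ ℓ ∈ P, (1 + 3 * ((R ℓ).card / ℓ : ℝ)) := by
          rw [← Finset.mul_sum, Finset.prod_one_add]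
      _ ≤ Real.exp (-r) * ∏ ℓ ∈ P, Real.exp (3 * ((R ℓ).card / ℓ : ℝ)) := by
          refine mul_le_mul_of_nonneg_left (Finset.prod_le_prod (fun ℓ _ => by positivity)
            fun ℓ _ => ?_) (Real.exp_pos _).le
          linarith [Real.add_one_le_exp (3 * ((R ℓ).card / ℓ : ℝ))]
      _ = _ := by
          rw [← Real.exp_sum, ← Real.exp_add, ← Finset.mul_sum]; congr 1; ring
  have h3 : ∑ D ∈ P.powerset.filter (fun D => D.card ≤ r), ∏ ℓ ∈ D, ((R ℓ).card : ℝ) ≤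
      3 * (κ * Z : ℝ) ^ r := by
    have h4 : ∀ D ∈ P.powerset.filter (fun D => D.card ≤ r), ∏ ℓ ∈ D, ((R ℓ).card : ℝ) ≤
        (κ * Z : ℝ) ^ r * ∏ _ℓ ∈ D, (1 / Z : ℝ) := by
      intro D hD
      obtain ⟨hDP, hc⟩ := Finset.mem_filter.mp hD
      rw [Finset.mem_powerset] at hDP
      rw [Finset.prod_const]
      have h5 : ∏ ℓ ∈ D, ((R ℓ).card : ℝ) ≤ (κ : ℝ) ^ r := by
        calc ∏ ℓ ∈ D, ((R ℓ).card : ℝ) ≤ ∏ _ℓ ∈ D, (κ : ℝ) :=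
              Finset.prod_le_prod (fun ℓ _ => by positivity) fun ℓ hℓ => by
                exact_mod_cast hR ℓ (hDP hℓ)
          _ = (κ : ℝ) ^ D.card := by rw [Finset.prod_const]
          _ ≤ _ := pow_le_pow_right₀ hκ' hc
      have h6 : 1 ≤ (Z : ℝ) ^ r * (1 / Z : ℝ) ^ D.card := by
        rw [one_div, inv_pow, ← div_eq_mul_inv, one_le_div (by positivity)]
        exact pow_le_pow_right₀ hZ' hc
      rw [mul_pow, mul_assoc]
      exact h5.trans (le_mul_of_one_le_right (by positivity) h6)
    have hPc : P.card ≤ Z := by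
      have : P ⊆ Finset.Icc 1 Z := fun ℓ hℓ =>
        Finset.mem_Icc.mpr ⟨(hP ℓ hℓ).one_le, hPZ ℓ hℓ⟩
      simpa using Finset.card_le_card this
    calc _ ≤ ∑ D ∈ P.powerset.filter (fun D => D.card ≤ r),
            (κ * Z : ℝ) ^ r * ∏ _ℓ ∈ D, (1 / Z : ℝ) := Finset.sum_le_sum h4
      _ ≤ ∑ D ∈ P.powerset, (κ * Z : ℝ) ^ r * ∏ _ℓ ∈ D, (1 / Z : ℝ) :=
          Finset.sum_le_sum_of_subset_of_nonneg (Finset.filter_subset _ _) fun D _ _ => by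
            positivity
      _ = (κ * Z : ℝ) ^ r * (1 + 1 / Z : ℝ) ^ P.card := by
          rw [← Finset.mul_sum, ← Finset.prod_one_add, Finset.prod_const]
      _ ≤ (κ * Z : ℝ) ^ r * 3 := by
          gcongr
          calc (1 + 1 / Z : ℝ) ^ P.card ≤ (Real.exp (1 / Z)) ^ P.card := by
                gcongr
                linarith [Real.add_one_le_exp (1 / Z : ℝ)]
            _ = Real.exp (P.card * (1 / Z)) := by rw [← Real.exp_nat_mul]
            _ ≤ Real.exp 1 := by
                apply Real.exp_le_exp.mpr
                rw [mul_one_div]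
                exact div_le_one_of_le₀ (by exact_mod_cast hPc) (by positivity)
            _ ≤ 3 := by linarith [Real.exp_one_lt_d9]
      _ = _ := by ring
  gcongr

theorem card_primeFactors_mul_log_two_le {n : ℕ} (hn : 0 < n) :
    (n.primeFactors.card : ℝ) * Real.log 2 ≤ Real.log n := by
  rw [← Real.log_pow]
  refine Real.log_le_log (by positivity) ?_
  have : 2 ^ n.primeFactors.card ≤ n :=
    (Finset.pow_card_le_prod _ _ _ fun p hp => (Nat.prime_of_mem_primeFactors hp).two_le).trans
      (Nat.le_of_dvd hn (Nat.prod_primeFactors_dvd n))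
  exact_mod_cast this

theorem sum_inv_primeFactors_le {δ K : ℝ} (hδ : 0 < δ) (hK : 0 ≤ K) :
    ∃ C, 0 ≤ C ∧ ∀ y : ℝ, 3 ≤ y → ∀ E : ℕ, 0 < E → Real.log E ≤ K * y →
      ∑ ℓ ∈ E.primeFactors, (1 / ℓ : ℝ) ≤ δ * Real.log y + C := by
  obtain ⟨C, hC, h⟩ := sum_inv_primesLE_le one_pos
  refine ⟨C + |2 * Real.log (2 / δ)| + K / Real.log 2, by positivity, fun y hy E hE hEy => ?_⟩
  have hl2 : 0 < Real.log 2 := Real.log_pos one_lt_two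
  have hly : 1 < Real.log y := by
    rw [Real.lt_log_iff_exp_lt (by linarith)]
    linarith [Real.exp_one_lt_d9]
  rw [← Finset.sum_filter_add_sum_filter_not E.primeFactors
    (fun ℓ : ℕ => (ℓ : ℝ) ≤ y) (fun ℓ => (1 / ℓ : ℝ))]
  have h1 : ∑ ℓ ∈ E.primeFactors.filter (fun ℓ : ℕ => (ℓ : ℝ) ≤ y), (1 / ℓ : ℝ) ≤
      δ * Real.log y + (C + |2 * Real.log (2 / δ)|) := by
    have h2 : ∑ ℓ ∈ E.primeFactors.filter (fun ℓ : ℕ => (ℓ : ℝ) ≤ y), (1 / ℓ : ℝ) ≤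
        ∑ p ∈ Nat.primesLE ⌊y⌋₊, (1 / p : ℝ) := by
      refine Finset.sum_le_sum_of_subset_of_nonneg (fun ℓ hℓ => ?_) fun _ _ _ => by positivity
      obtain ⟨h3, h4⟩ := Finset.mem_filter.mp hℓ
      exact Nat.mem_primesLE.mpr ⟨Nat.le_floor h4, Nat.prime_of_mem_primeFactors h3⟩
    have h3 := h y hy
    have h4 : Real.log (Real.log y) ≤ δ / 2 * Real.log y + Real.log (2 / δ) := by
      have h5 := Real.log_le_sub_one_of_pos (x := δ / 2 * Real.log y) (by positivity)
      rw [Real.log_mul (by positivity) (by positivity)] at h5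
      have h6 : Real.log (2 / δ) = - Real.log (δ / 2) := by
        rw [← Real.log_inv, inv_div]
      linarith
    have h5 := le_abs_self (2 * Real.log (2 / δ))
    linarith
  have h2 : ∑ ℓ ∈ E.primeFactors.filter (fun ℓ : ℕ => ¬ (ℓ : ℝ) ≤ y), (1 / ℓ : ℝ) ≤ K / Real.log 2 := by
    calc ∑ ℓ ∈ E.primeFactors.filter (fun ℓ : ℕ => ¬ (ℓ : ℝ) ≤ y), (1 / ℓ : ℝ) ≤
          ∑ _ℓ ∈ E.primeFactors.filter (fun ℓ : ℕ => ¬ (ℓ : ℝ) ≤ y), (1 / y : ℝ) := by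
          refine Finset.sum_le_sum fun ℓ hℓ => ?_
          have := (Finset.mem_filter.mp hℓ).2
          exact one_div_le_one_div_of_le (by linarith) (by linarith)
      _ = ((E.primeFactors.filter (fun ℓ : ℕ => ¬ (ℓ : ℝ) ≤ y)).card : ℝ) * (1 / y) := by
          rw [Finset.sum_const, nsmul_eq_mul]
      _ ≤ E.primeFactors.card * (1 / y) := by
          gcongr
          exact Finset.filter_subset _ _
      _ ≤ K / Real.log 2 := by
          have h3 := card_primeFactors_mul_log_two_le hE
          rw [mul_one_div, div_le_div_iff₀ (by linarith) hl2]
          linarith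
  linarith

/-- The expected number of residue classes removed by the sieve. -/
theorem sum_sieve_density_bounds {κ : ℕ} (hκ : 1 ≤ κ) {δ K : ℝ} (h0 : 0 < δ) (h1 : δ < 1)
    (hK : 0 ≤ K) :
    ∃ C, 0 ≤ C ∧ ∀ z : ℝ, 3 ≤ z → ∀ y : ℝ, 3 ≤ y → ∀ E : ℕ, 0 < E → Real.log E ≤ K * y →
      (κ + 1) / 2 * (1 - δ) ^ 2 * Real.log (Real.log z) - (κ + 1) * δ * Real.log y - C ≤
        ∑ ℓ ∈ (Nat.primesLE ⌊z⌋₊).filter (fun ℓ => ¬ ℓ ∣ E),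
          (((if ℓ % 4 = 1 then κ else 1 : ℕ) : ℝ) / ℓ) ∧
      ∑ ℓ ∈ (Nat.primesLE ⌊z⌋₊).filter (fun ℓ => ¬ ℓ ∣ E),
          (((if ℓ % 4 = 1 then κ else 1 : ℕ) : ℝ) / ℓ) ≤ 2 * κ * Real.log (Real.log z) + C := by
  obtain ⟨C₁, hC₁, hu⟩ := sum_inv_primesLE_le one_pos
  obtain ⟨C₂, hC₂, hE⟩ := sum_inv_primeFactors_le h0 hK
  obtain ⟨C₃, hC₃, hl1⟩ := sum_inv_primesLE_filter_ge (q := 4) (a := 1) isUnit_one h0 h1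
  obtain ⟨C₄, hC₄, hl3⟩ := sum_inv_primesLE_filter_ge (q := 4) (a := 3) (by decide) h0 h1
  have hκ' : (1 : ℝ) ≤ κ := by exact_mod_cast hκ
  refine ⟨κ * C₁ + (κ + 1) * C₂ + κ * C₃ + C₄, by positivity, fun z hz y hy E hE0 hEy => ?_⟩
  have hu := hu z hz
  have hE := hE y hy E hE0 hEy
  have hl1 := hl1 z hz
  have hl3 := hl3 z hz
  have hφ : Nat.totient 4 = 2 := by decide
  rw [hφ] at hl1 hl3
  set Q := Nat.primesLE ⌊z⌋₊ with hQ
  have hlow : ∀ a : ZMod 4, ∑ p ∈ Q.filter (fun p : ℕ => (p : ZMod 4) = a), (1 / p : ℝ) ≤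
      ∑ p ∈ (Q.filter (fun ℓ => ¬ ℓ ∣ E)).filter (fun p : ℕ => (p : ZMod 4) = a), (1 / p : ℝ) +
      ∑ ℓ ∈ E.primeFactors, (1 / ℓ : ℝ) := by
    intro a
    rw [← Finset.sum_filter_add_sum_filter_not (Q.filter _) (fun ℓ => ¬ ℓ ∣ E),
      Finset.filter_comm]
    gcongr
    intro ℓ hℓ
    simp only [Finset.mem_filter, not_not, hQ, Nat.mem_primesLE] at hℓ
    exact Nat.mem_primeFactors.mpr ⟨hℓ.1.1.2, hℓ.2, hE0.ne'⟩
  have hb1 := hlow 1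
  have hb3 := hlow 3
  have hmod : ∀ (p a : ℕ), a < 4 → ((p : ZMod 4) = (a : ℕ) ↔ p % 4 = a) := by
    intro p a ha
    rw [ZMod.natCast_eq_natCast_iff, Nat.ModEq, Nat.mod_eq_of_lt ha]
  have hm1 : ∀ p : ℕ, (p : ZMod 4) = 1 ↔ p % 4 = 1 := fun p => by simpa using hmod p 1 (by norm_num)
  have hm3 : ∀ p : ℕ, (p : ZMod 4) = 3 ↔ p % 4 = 3 := fun p => by simpa using hmod p 3 (by norm_num)
  constructor
  · set P := Q.filter (fun ℓ => ¬ ℓ ∣ E)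
    clear_value P
    have h5 : κ * ∑ p ∈ P.filter (fun p : ℕ => (p : ZMod 4) = 1), (1 / p : ℝ) +
        ∑ p ∈ P.filter (fun p : ℕ => (p : ZMod 4) = 3), (1 / p : ℝ) ≤
        ∑ ℓ ∈ P, (((if ℓ % 4 = 1 then κ else 1 : ℕ) : ℝ) / ℓ) := by
      rw [Finset.sum_filter, Finset.sum_filter, Finset.mul_sum, ← Finset.sum_add_distrib]
      refine Finset.sum_le_sum fun p _ => ?_
      simp only [hm1, hm3]
      by_cases h : p % 4 = 1
      · simp [h, div_eq_mul_inv]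
      · have : (0 : ℝ) ≤ 1 / p := by positivity
        simp only [h, if_false, mul_zero, zero_add, Nat.cast_one]
        split_ifs
        · exact le_rfl
        · exact this
    have h6 := mul_le_mul_of_nonneg_left (hl1.trans hb1) (by linarith : (0 : ℝ) ≤ κ)
    have h7 := mul_le_mul_of_nonneg_left hE (by linarith : (0 : ℝ) ≤ κ + 1)
    have h8 : (0 : ℝ) ≤ κ * C₁ := by positivity
    push_cast at h6 hl3
    nlinarith
  · calc _ ≤ ∑ ℓ ∈ Q, (κ : ℝ) * (1 / ℓ : ℝ) := by
          refine (Finset.sum_le_sum fun ℓ _ => ?_).trans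
            (Finset.sum_le_sum_of_subset_of_nonneg (Finset.filter_subset _ _) fun _ _ _ => by
              positivity)
          rw [mul_one_div]
          gcongr
          split_ifs
          · exact le_rfl
          · exact hκ
      _ ≤ κ * ((1 + 1) * Real.log (Real.log z) + C₁) := by
          rw [← Finset.mul_sum]
          gcongr
      _ ≤ _ := by
          have : (0 : ℝ) ≤ (κ + 1) * C₂ + κ * C₃ + C₄ := by positivity
          linarith

theorem eventually_mul_log_sq_le_rpow (M : ℝ) {δ : ℝ} (hδ : 0 < δ) :
    ∀ᶠ L : ℝ in Filter.atTop, M * Real.log L ^ 2 ≤ L ^ δ := by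
  have h := (isLittleO_log_rpow_rpow_atTop 2 hδ).bound (c := 1 / (|M| + 1)) (by positivity)
  filter_upwards [h, Filter.eventually_ge_atTop 1] with L hL hL1
  rw [Real.norm_of_nonneg (by positivity [Real.log_nonneg hL1]), Real.norm_of_nonneg (by positivity),
    Real.rpow_two] at hL
  have h1 : (|M| + 1) * Real.log L ^ 2 ≤ L ^ δ := by
    rwa [one_div_mul_eq_div, le_div_iff₀' (by positivity)] at hL
  have h2 := le_abs_self M
  nlinarith [sq_nonneg (Real.log L)]

set_option maxHeartbeats 400000 in
theorem sieve_card_le {κ : ℕ} (hκ : 1 ≤ κ) {δ K : ℝ} (h0 : 0 < δ) (h1 : δ < 1) (hK : 0 ≤ K) :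
    ∃ C, 0 < C ∧ ∃ L₀ : ℝ, ∀ L : ℝ, L₀ ≤ L → ∀ E : ℕ, 0 < E → Real.log E ≤ K * L →
      ∀ X : ℕ, L / Real.log L ≤ Real.log X → ∀ R : ∀ ℓ : ℕ, Finset (ZMod ℓ),
      ∀ S ⊆ Finset.Ioc 0 X,
      (∀ ℓ : ℕ, ℓ.Prime → (ℓ : ℝ) ≤ Real.exp (L ^ (1 - δ)) → ¬ ℓ ∣ E →
        κ ≤ ℓ ∧ (R ℓ).card = (if ℓ % 4 = 1 then κ else 1) ∧ ∀ n ∈ S, (n : ZMod ℓ) ∉ R ℓ) →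
      (S.card : ℝ) ≤ C * X * L ^ (-((κ + 1) / 2 - 5 * κ * δ) : ℝ) := by
  obtain ⟨C, hC, hsum⟩ := sum_sieve_density_bounds hκ h0 h1 hK
  have hκ' : (1 : ℝ) ≤ κ := by exact_mod_cast hκ
  have hev := ((eventually_mul_log_sq_le_rpow (11 * κ * (κ + 1)) h0).and
    (Filter.eventually_ge_atTop (3 : ℝ))).and
    ((tendsto_rpow_atTop (sub_pos.mpr h1)).eventually_ge_atTop 2)
  obtain ⟨L₀, hL₀⟩ := Filter.eventually_atTop.mp hev
  refine ⟨Real.exp C + Real.exp (3 * C) + 3, by positivity, L₀,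
    fun L hL E hE0 hE X hX R S hS hRS => ?_⟩
  obtain ⟨⟨hL1, hL3⟩, hL2⟩ := hL₀ L hL
  have hLpos : 0 < L := by linarith
  set lam := Real.log L with hlam
  have hlam1 : 1 < lam := by
    rw [hlam, Real.lt_log_iff_exp_lt hLpos]
    linarith [Real.exp_one_lt_d9]
  set w := L ^ (1 - δ) with hw
  set z := Real.exp w with hz
  have hz3 : 3 ≤ z := by linarith [Real.add_one_le_exp w]
  have hllz : Real.log (Real.log z) = (1 - δ) * lam := by
    rw [hz, Real.log_exp, hw, Real.log_rpow hLpos]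
  set P := (Nat.primesLE ⌊z⌋₊).filter (fun ℓ => ¬ ℓ ∣ E) with hP
  have hPmem : ∀ ℓ ∈ P, ℓ.Prime ∧ (ℓ : ℝ) ≤ z ∧ ¬ ℓ ∣ E := by
    intro ℓ hℓ
    simp only [hP, Finset.mem_filter, Nat.mem_primesLE] at hℓ
    exact ⟨hℓ.1.2, (Nat.le_floor_iff (by positivity)).mp hℓ.1.1, hℓ.2⟩
  have hPR : ∀ ℓ ∈ P, κ ≤ ℓ ∧ (R ℓ).card = (if ℓ % 4 = 1 then κ else 1) ∧
      ∀ n ∈ S, (n : ZMod ℓ) ∉ R ℓ := fun ℓ hℓ =>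
    hRS ℓ (hPmem ℓ hℓ).1 (hPmem ℓ hℓ).2.1 (hPmem ℓ hℓ).2.2
  set r := 2 * ⌈4 * κ * lam⌉₊ with hr
  have hr1 : 8 * κ * lam ≤ (r : ℝ) := by
    have := Nat.le_ceil (4 * κ * lam)
    rw [hr]; push_cast; linarith
  have hr2 : (r : ℝ) ≤ 10 * κ * lam := by
    have := Nat.ceil_lt_add_one (a := 4 * κ * lam) (by positivity)
    have h3 := one_le_mul_of_one_le_of_one_le hκ' hlam1.le
    rw [hr]; push_cast; linarith
  have hbrun := card_le_brun P (fun ℓ hℓ => (hPmem ℓ hℓ).1) R X S hS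
    (fun n hn ℓ hℓ => (hPR ℓ hℓ).2.2 n hn) (hr ▸ even_two_mul _ : Even r) hκ (Z := ⌊z⌋₊)
    (Nat.le_floor (by norm_num; linarith))
    (fun ℓ hℓ => by rw [(hPR ℓ hℓ).2.1]; split_ifs <;> omega) (fun ℓ hℓ => (hPR ℓ hℓ).1)
    (fun ℓ hℓ => Nat.le_floor (hPmem ℓ hℓ).2.1)
  have hsumeq : ∑ ℓ ∈ P, ((R ℓ).card / ℓ : ℝ) =
      ∑ ℓ ∈ P, (((if ℓ % 4 = 1 then κ else 1 : ℕ) : ℝ) / ℓ) :=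
    Finset.sum_congr rfl fun ℓ hℓ => by rw [(hPR ℓ hℓ).2.1]
  obtain ⟨hlow, hup⟩ := hsum z hz3 L hL3 E hE0 hE
  rw [← hP, ← hsumeq, hllz] at hlow hup
  rw [← hlam] at hlow
  set σ₀ := ∑ ℓ ∈ P, ((R ℓ).card / ℓ : ℝ)
  set e : ℝ := (κ + 1) / 2 - 5 * κ * δ with he
  have hpow : ∀ t : ℝ, L ^ t = Real.exp (t * lam) := fun t => by
    rw [Real.rpow_def_of_pos hLpos, mul_comm]
  have hκe : e ≤ κ := by
    have : 0 ≤ 5 * (κ : ℝ) * δ := by positivity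
    rw [he]; linarith
  have hA : Real.exp (-σ₀) ≤ Real.exp C * L ^ (-e) := by
    rw [hpow, ← Real.exp_add]
    apply Real.exp_le_exp.mpr
    have h3 : (1 - 3 * δ) * lam ≤ (1 - δ) ^ 2 * ((1 - δ) * lam) := by
      have h4 := mul_nonneg (mul_nonneg (sq_nonneg δ) (by linarith : 0 ≤ 3 - δ))
        (by linarith : 0 ≤ lam)
      linarith
    have h4 := mul_le_mul_of_nonneg_left h3 (by positivity : (0 : ℝ) ≤ (κ + 1) / 2)
    have h5 : (κ + 1) * (δ * lam) ≤ 2 * κ * (δ * lam) := by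
      gcongr
      linarith
    rw [he]
    linarith
  have hB : Real.exp (3 * σ₀ - r) ≤ Real.exp (3 * C) * L ^ (-e) := by
    rw [hpow, ← Real.exp_add]
    apply Real.exp_le_exp.mpr
    have h3 : 2 * κ * ((1 - δ) * lam) ≤ 2 * κ * lam := by
      have : 0 ≤ κ * (δ * lam) := by positivity
      linarith
    have h4 : e * lam ≤ κ * lam := by gcongr
    have h5 : 0 ≤ κ * lam := by positivity
    linarith
  have hX0 : 0 < X := by
    rcases Nat.eq_zero_or_pos X with h | h
    · rw [h, Nat.cast_zero, Real.log_zero] at hX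
      have : 0 < L / lam := by positivity
      linarith
    · exact h
  have hX' : (0 : ℝ) < X := by exact_mod_cast hX0
  have hD : (κ * (⌊z⌋₊ : ℕ) : ℝ) ^ r ≤ X * L ^ (-e) := by
    calc (κ * (⌊z⌋₊ : ℕ) : ℝ) ^ r ≤ (Real.exp κ * Real.exp w) ^ r := by
          gcongr
          · linarith [Real.add_one_le_exp (κ : ℝ)]
          · exact Nat.floor_le (by positivity)
      _ = Real.exp (r * (κ + w)) := by rw [← Real.exp_add, ← Real.exp_nat_mul]
      _ ≤ Real.exp (Real.log X + -e * lam) := by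
          apply Real.exp_le_exp.mpr
          have h3 : e * lam ≤ κ * lam := by gcongr
          have h4 : L / lam ≤ Real.log X := hX
          have h5 : 11 * κ * (κ + 1) * lam * w ≤ L / lam := by
            rw [le_div_iff₀ (by linarith)]
            calc 11 * κ * (κ + 1) * lam * w * lam = (11 * κ * (κ + 1) * lam ^ 2) * w := by ring
              _ ≤ L ^ δ * w := by gcongr
              _ = L := by rw [hw, ← Real.rpow_add hLpos]; simp
          have h6 : r * (κ + w) ≤ 10 * κ * lam * ((κ + 1) * w) := by
            have : (κ : ℝ) + w ≤ (κ + 1) * w := by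
              have := mul_nonneg (by linarith : (0 : ℝ) ≤ κ) (by linarith : 0 ≤ w - 1)
              linarith
            exact mul_le_mul hr2 this (by positivity) (by positivity)
          have h7 : κ * lam ≤ κ * lam * ((κ + 1) * w) :=
            le_mul_of_one_le_right (by positivity)
              (one_le_mul_of_one_le_of_one_le (by linarith) (by linarith))
          linarith
      _ = X * L ^ (-e) := by rw [Real.exp_add, Real.exp_log hX', hpow]
  calc (S.card : ℝ) ≤ X * (Real.exp (-σ₀) + Real.exp (3 * σ₀ - r)) + 3 * (κ * (⌊z⌋₊ : ℕ) : ℝ) ^ r :=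
        hbrun
    _ ≤ X * (Real.exp C * L ^ (-e) + Real.exp (3 * C) * L ^ (-e)) + 3 * (X * L ^ (-e)) := by gcongr
    _ = _ := by ring

theorem sieve_card_le_of_rough {κ : ℕ} (hκ : 1 ≤ κ) {δ K : ℝ} (h0 : 0 < δ) (h1 : δ < 1)
    (hK : 0 ≤ K) :
    ∃ C, 0 < C ∧ ∃ L₀ : ℝ, ∀ L : ℝ, L₀ ≤ L → ∀ E : ℕ, 0 < E → Real.log E ≤ K * L →
      ∀ F : ℕ → ℕ, (∀ ℓ : ℕ, ℓ.Prime → ¬ ℓ ∣ E → κ ≤ ℓ ∧ ∃ R : Finset (ZMod ℓ),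
        R.card = (if ℓ % 4 = 1 then κ else 1) ∧ ∀ n : ℕ, (n : ZMod ℓ) ∈ R → ℓ ∣ F n) →
      ∀ X : ℕ, ∀ S ⊆ Finset.Ioc 0 X,
      (∀ n ∈ S, Real.exp (L / Real.log L) < n ∧
        ∀ ℓ : ℕ, ℓ.Prime → ℓ ∣ F n → Real.exp (L / Real.log L) < ℓ) →
      (S.card : ℝ) ≤ C * X * L ^ (-((κ + 1) / 2 - 5 * κ * δ) : ℝ) := by
  obtain ⟨C, hC, L₁, h⟩ := sieve_card_le hκ h0 h1 hK
  obtain ⟨L₂, hL₂⟩ := Filter.eventually_atTop.mp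
    ((eventually_mul_log_sq_le_rpow 1 h0).and (Filter.eventually_ge_atTop (3 : ℝ)))
  refine ⟨C, hC, max L₁ L₂, fun L hL E hE0 hE F hF X S hS hSF => ?_⟩
  obtain ⟨hL1, hL3⟩ := hL₂ L ((le_max_right _ _).trans hL)
  have hlam1 : 1 < Real.log L := by
    rw [Real.lt_log_iff_exp_lt (by linarith)]
    linarith [Real.exp_one_lt_d9]
  rcases S.eq_empty_or_nonempty with rfl | ⟨p, hp⟩
  · simp only [Finset.card_empty, Nat.cast_zero]
    positivity
  have hX : L / Real.log L ≤ Real.log X := by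
    have hpX := (Finset.mem_Ioc.mp (hS hp)).2
    have hX0 : (0 : ℝ) < X := by
      exact_mod_cast (Finset.mem_Ioc.mp (hS hp)).1.trans_le hpX
    rw [Real.le_log_iff_exp_le hX0]
    exact (hSF p hp).1.le.trans (by exact_mod_cast hpX)
  have hz : L ^ (1 - δ) ≤ L / Real.log L := by
    rw [le_div_iff₀ (by linarith), Real.rpow_sub (by linarith), Real.rpow_one, div_mul_eq_mul_div,
      div_le_iff₀ (by positivity)]
    gcongr
    nlinarith
  choose! R hR using fun ℓ : ℕ => fun (hℓ : ℓ.Prime ∧ ¬ ℓ ∣ E) => (hF ℓ hℓ.1 hℓ.2).2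
  refine h L ((le_max_left _ _).trans hL) E hE0 hE X hX R S hS fun ℓ hℓ hℓz hℓE =>
    ⟨(hF ℓ hℓ hℓE).1, (hR ℓ ⟨hℓ, hℓE⟩).1, fun n hn hnR => ?_⟩
  have h2 := (hSF n hn).2 ℓ hℓ ((hR ℓ ⟨hℓ, hℓE⟩).2 n hnR)
  have h3 := Real.exp_le_exp.mpr hz
  linarith

theorem exists_three_roots {F : Type*} [Field F] {i A B : F} (hi : i ^ 2 = -1) (h2 : (2 : F) ≠ 0)
    (hA : A ≠ 0) (hB : B ≠ 0) :
    ∃ R : Finset F, R.card = 3 ∧ ∀ x ∈ R, x * ((A * x) ^ 2 + B ^ 2) = 0 := by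
  classical
  have hi0 : i ≠ 0 := by rintro rfl; simp at hi
  set x := i * B / A with hx
  have hx0 : x ≠ 0 := div_ne_zero (mul_ne_zero hi0 hB) hA
  have hxx : x ≠ -x := fun h => by
    have : (2 : F) * x = 0 := by linear_combination h
    exact (mul_ne_zero h2 hx0) this
  have hAx : A * x = i * B := by rw [hx]; field_simp
  refine ⟨{0, x, -x}, ?_, ?_⟩
  · rw [Finset.card_insert_of_notMem, Finset.card_pair hxx]
    simp [hx0.symm, hx0]
  · intro y hy
    simp only [Finset.mem_insert, Finset.mem_singleton] at hy
    rcases hy with rfl | rfl | rfl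
    · simp
    · rw [hAx]; linear_combination x * B ^ 2 * hi
    · rw [mul_neg, hAx]; linear_combination -x * B ^ 2 * hi

theorem exists_five_roots {F : Type*} [Field F] {i A B C D : F} (hi : i ^ 2 = -1)
    (h2 : (2 : F) ≠ 0) (hA : A ≠ 0) (hB : B ≠ 0) (hC : C ≠ 0) (hD : D ≠ 0)
    (h : (B * C) ^ 2 ≠ (A * D) ^ 2) :
    ∃ R : Finset F, R.card = 5 ∧
      ∀ x ∈ R, x * ((A * x) ^ 2 + B ^ 2) * ((C * x) ^ 2 + D ^ 2) = 0 := by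
  classical
  have hi0 : i ≠ 0 := by rintro rfl; simp at hi
  set x := i * B / A with hx
  set y := i * D / C with hy
  have hx0 : x ≠ 0 := div_ne_zero (mul_ne_zero hi0 hB) hA
  have hy0 : y ≠ 0 := div_ne_zero (mul_ne_zero hi0 hD) hC
  have hneg : ∀ x : F, x ≠ 0 → x ≠ -x := fun x hx0 h => by
    have : (2 : F) * x = 0 := by linear_combination h
    exact (mul_ne_zero h2 hx0) this
  have hAx : A * x = i * B := by rw [hx]; field_simp
  have hCy : C * y = i * D := by rw [hy]; field_simp
  have hxy : x ^ 2 ≠ y ^ 2 := fun hxy => h <| by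
    have h3 : (A * x) ^ 2 * C ^ 2 = (C * y) ^ 2 * A ^ 2 := by
      linear_combination A ^ 2 * C ^ 2 * hxy
    rw [hAx, hCy] at h3
    linear_combination (-1 : F) * h3 + (B ^ 2 * C ^ 2 - D ^ 2 * A ^ 2) * hi
  have hxy1 : x ≠ y := fun h => hxy (by rw [h])
  have hxy2 : x ≠ -y := fun h => hxy (by rw [h, neg_sq])
  have hxy3 : -x ≠ y := fun h => hxy (by rw [← h, neg_sq])
  refine ⟨{0, x, -x, y, -y}, ?_, ?_⟩
  · rw [Finset.card_insert_of_notMem, Finset.card_insert_of_notMem, Finset.card_insert_of_notMem,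
      Finset.card_pair (hneg y hy0)]
    · simp [hxy3, hxy1]
    · simp [hneg x hx0, hxy1, hxy2]
    · simp [hx0.symm, hy0.symm, hx0, hy0]
  · intro w hw
    simp only [Finset.mem_insert, Finset.mem_singleton] at hw
    rcases hw with rfl | rfl | rfl | rfl | rfl
    · simp
    · rw [hAx]; linear_combination x * B ^ 2 * ((C * x) ^ 2 + D ^ 2) * hi
    · rw [mul_neg, hAx]; linear_combination -x * B ^ 2 * ((C * -x) ^ 2 + D ^ 2) * hi
    · rw [hCy]; linear_combination y * D ^ 2 * ((A * y) ^ 2 + B ^ 2) * hi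
    · rw [mul_neg C, hCy]; linear_combination -y * D ^ 2 * ((A * -y) ^ 2 + B ^ 2) * hi

theorem exists_sq_eq_neg_one_zmod {ℓ : ℕ} (hℓ : ℓ.Prime) (h : ℓ % 4 = 1) :
    ∃ i : ZMod ℓ, i ^ 2 = -1 := by
  have := Fact.mk hℓ
  obtain ⟨i, hi⟩ := ZMod.exists_sq_eq_neg_one_iff.mpr (by omega : ℓ % 4 ≠ 3)
  exact ⟨i, by rw [sq]; exact hi.symm⟩

theorem natCast_zmod_ne_zero {ℓ n E : ℕ} (hn : n ∣ E) (hℓ : ¬ ℓ ∣ E) : (n : ZMod ℓ) ≠ 0 := fun h =>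
  hℓ (((ZMod.natCast_eq_zero_iff n ℓ).mp h).trans hn)

theorem five_le_of_not_dvd {ℓ E : ℕ} (hℓ : ℓ.Prime) (hE : 30 ∣ E) (h : ¬ ℓ ∣ E) : 5 ≤ ℓ := by
  by_contra! hlt
  have := hℓ.two_le
  have : ℓ ∣ 30 := by interval_cases ℓ <;> first | (norm_num; done) | exact absurd hℓ (by norm_num)
  exact h (this.trans hE)

theorem exists_residues_three {A B ℓ : ℕ} (hℓ : ℓ.Prime) (hE : ¬ ℓ ∣ 30 * (A * B)) :
    3 ≤ ℓ ∧ ∃ R : Finset (ZMod ℓ), R.card = (if ℓ % 4 = 1 then 3 else 1) ∧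
      ∀ n : ℕ, (n : ZMod ℓ) ∈ R → ℓ ∣ n * ((A * n) ^ 2 + B ^ 2) := by
  have := Fact.mk hℓ
  refine ⟨(by norm_num : 3 ≤ 5).trans (five_le_of_not_dvd hℓ (dvd_mul_right _ _) hE), ?_⟩
  split_ifs with h
  · obtain ⟨i, hi⟩ := exists_sq_eq_neg_one_zmod hℓ h
    obtain ⟨R, hR, hR'⟩ := exists_three_roots (F := ZMod ℓ) (A := (A : ℕ)) (B := (B : ℕ)) hi
      (by exact_mod_cast natCast_zmod_ne_zero (n := 2) (Dvd.dvd.mul_right (by norm_num) _) hE)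
      (natCast_zmod_ne_zero (Dvd.intro_left (30 * B) (by ring)) hE)
      (natCast_zmod_ne_zero (Dvd.intro_left (30 * A) (by ring)) hE)
    refine ⟨R, hR, fun n hn => ?_⟩
    rw [← ZMod.natCast_eq_zero_iff]
    push_cast
    exact hR' n hn
  · refine ⟨{0}, rfl, fun n hn => ?_⟩
    rw [Finset.mem_singleton, ZMod.natCast_eq_zero_iff] at hn
    exact hn.mul_right _

theorem exists_residues_five {A B C D ℓ : ℕ} (hℓ : ℓ.Prime)
    (hE : ¬ ℓ ∣ 30 * (A * B * C * D) * (((B * C) ^ 2 - (A * D) ^ 2 : ℤ).natAbs)) :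
    5 ≤ ℓ ∧ ∃ R : Finset (ZMod ℓ), R.card = (if ℓ % 4 = 1 then 5 else 1) ∧
      ∀ n : ℕ, (n : ZMod ℓ) ∈ R → ℓ ∣ n * ((A * n) ^ 2 + B ^ 2) * ((C * n) ^ 2 + D ^ 2) := by
  have := Fact.mk hℓ
  refine ⟨five_le_of_not_dvd hℓ ((dvd_mul_right _ _).mul_right _) hE, ?_⟩
  split_ifs with h
  · obtain ⟨i, hi⟩ := exists_sq_eq_neg_one_zmod hℓ h
    have hne : ((((B * C) ^ 2 - (A * D) ^ 2 : ℤ).natAbs : ℕ) : ZMod ℓ) ≠ 0 :=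
      natCast_zmod_ne_zero (dvd_mul_left _ _) hE
    have hE' : ¬ ℓ ∣ 30 * (A * B * C * D) := fun h => hE (h.mul_right _)
    obtain ⟨R, hR, hR'⟩ := exists_five_roots (F := ZMod ℓ) (A := (A : ℕ)) (B := (B : ℕ))
      (C := (C : ℕ)) (D := (D : ℕ)) hi
      (by exact_mod_cast natCast_zmod_ne_zero (n := 2) (Dvd.dvd.mul_right (by norm_num) _) hE')
      (natCast_zmod_ne_zero (Dvd.intro_left (30 * B * C * D) (by ring)) hE')
      (natCast_zmod_ne_zero (Dvd.intro_left (30 * A * C * D) (by ring)) hE')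
      (natCast_zmod_ne_zero (Dvd.intro_left (30 * A * B * D) (by ring)) hE')
      (natCast_zmod_ne_zero (Dvd.intro_left (30 * A * B * C) (by ring)) hE') (fun heq => hne (by
        rw [ZMod.natCast_eq_zero_iff, ← Int.natCast_dvd, ← ZMod.intCast_zmod_eq_zero_iff_dvd]
        push_cast
        rw [heq, sub_self]))
    refine ⟨R, hR, fun n hn => ?_⟩
    rw [← ZMod.natCast_eq_zero_iff]
    push_cast
    exact hR' n hn
  · refine ⟨{0}, rfl, fun n hn => ?_⟩
    rw [Finset.mem_singleton, ZMod.natCast_eq_zero_iff] at hn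
    exact (hn.mul_right _).mul_right _

theorem lt_prime_of_dvd_prime_sq_add_sq {A B p ℓ : ℕ} {T : ℝ} (hA : 0 < A) (hT : T < p)
    (h : ((A * p) ^ 2 + B ^ 2).Prime) (hℓ : ℓ.Prime) (hdvd : ℓ ∣ (A * p) ^ 2 + B ^ 2) : T < ℓ := by
  rw [(Nat.prime_dvd_prime_iff_eq hℓ h).mp hdvd]
  have h1 : p ≤ (A * p) ^ 2 + B ^ 2 := by nlinarith [Nat.le_mul_of_pos_left p hA]
  exact hT.trans_le (by exact_mod_cast h1)

theorem lt_prime_of_dvd_prime {p ℓ : ℕ} {T : ℝ} (hT : T < p) (hp : p.Prime) (hℓ : ℓ.Prime)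
    (hdvd : ℓ ∣ p) : T < ℓ := by
  rwa [(Nat.prime_dvd_prime_iff_eq hℓ hp).mp hdvd]

theorem card_primes_le_three {δ : ℝ} (h0 : 0 < δ) (h1 : δ < 1) :
    ∃ K, 0 < K ∧ ∃ L₀ : ℝ, ∀ L : ℝ, L₀ ≤ L → ∀ A B : ℕ, 0 < A → 0 < B →
      (A : ℝ) ≤ Real.exp L → (B : ℝ) ≤ Real.exp L → ∀ X : ℕ, ∀ S ⊆ Finset.Ioc 0 X,
      (∀ p ∈ S, p.Prime ∧ Real.exp (L / Real.log L) < p ∧ ((A * p) ^ 2 + B ^ 2).Prime) →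
      (S.card : ℝ) ≤ K * X * L ^ (-(2 - 15 * δ) : ℝ) := by
  obtain ⟨K, hK, L₀, h⟩ := sieve_card_le_of_rough (κ := 3) (K := 3) (by norm_num) h0 h1 (by norm_num)
  refine ⟨K, hK, max L₀ (Real.log 30), fun L hL A B hA hB hAL hBL X S hS hSp => ?_⟩
  have hE : Real.log ((30 * (A * B) : ℕ) : ℝ) ≤ 3 * L := by
    rw [Real.log_le_iff_le_exp (by positivity)]
    have h30 : (30 : ℝ) ≤ Real.exp L := by
      rw [← Real.log_le_iff_le_exp (by norm_num)]
      exact (le_max_right _ _).trans hL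
    calc ((30 * (A * B) : ℕ) : ℝ) = 30 * (A * B) := by push_cast; ring
      _ ≤ Real.exp L * (Real.exp L * Real.exp L) := by gcongr
      _ = Real.exp (3 * L) := by rw [← Real.exp_add, ← Real.exp_add]; congr 1; ring
  have := h L ((le_max_left _ _).trans hL) (30 * (A * B)) (by positivity) hE
    (fun n => n * ((A * n) ^ 2 + B ^ 2)) (fun ℓ hℓ hℓE => exists_residues_three hℓ hℓE) X S hS
    (fun p hp => ⟨(hSp p hp).2.1, fun ℓ hℓ hdvd => by
      obtain ⟨hpp, hT, hq⟩ := hSp p hp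
      rcases hℓ.dvd_mul.mp hdvd with hd | hd
      · exact lt_prime_of_dvd_prime hT hpp hℓ hd
      · exact lt_prime_of_dvd_prime_sq_add_sq hA hT hq hℓ hd⟩)
  convert this using 3
  push_cast
  ring

theorem card_primes_le_five {δ : ℝ} (h0 : 0 < δ) (h1 : δ < 1) :
    ∃ K, 0 < K ∧ ∃ L₀ : ℝ, ∀ L : ℝ, L₀ ≤ L → ∀ A B C D : ℕ, 0 < A → 0 < B → 0 < C → 0 < D →
      (A : ℝ) ≤ Real.exp L → (B : ℝ) ≤ Real.exp L → (C : ℝ) ≤ Real.exp L → (D : ℝ) ≤ Real.exp L →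
      B * C ≠ A * D → ∀ X : ℕ, ∀ S ⊆ Finset.Ioc 0 X,
      (∀ p ∈ S, p.Prime ∧ Real.exp (L / Real.log L) < p ∧ ((A * p) ^ 2 + B ^ 2).Prime ∧
        ((C * p) ^ 2 + D ^ 2).Prime) →
      (S.card : ℝ) ≤ K * X * L ^ (-(3 - 25 * δ) : ℝ) := by
  obtain ⟨K, hK, L₀, h⟩ := sieve_card_le_of_rough (κ := 5) (K := 9) (by norm_num) h0 h1 (by norm_num)
  refine ⟨K, hK, max L₀ (Real.log 30),
    fun L hL A B C D hA hB hC hD hAL hBL hCL hDL hne X S hS hSp => ?_⟩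
  set d := ((B * C) ^ 2 - (A * D) ^ 2 : ℤ).natAbs with hd
  have hd0 : 0 < d := by
    rw [hd, Int.natAbs_pos, sub_ne_zero]
    intro h
    have h' : (B * C) ^ 2 = (A * D) ^ 2 := by exact_mod_cast h
    exact hne (Nat.pow_left_injective two_ne_zero h')
  have hd1 : (d : ℝ) ≤ Real.exp L ^ 4 := by
    have h3 : (d : ℝ) = |((B * C : ℝ)) ^ 2 - (A * D) ^ 2| := by
      rw [hd, Nat.cast_natAbs]; push_cast; rfl
    have h4 : (B * C : ℝ) ^ 2 ≤ (Real.exp L * Real.exp L) ^ 2 := by gcongr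
    have h5 : (A * D : ℝ) ^ 2 ≤ (Real.exp L * Real.exp L) ^ 2 := by gcongr
    have h6 : (Real.exp L * Real.exp L) ^ 2 = Real.exp L ^ 4 := by ring
    rw [h3, abs_le]
    constructor <;> nlinarith [sq_nonneg (B * C : ℝ), sq_nonneg (A * D : ℝ)]
  have hE : Real.log ((30 * (A * B * C * D) * d : ℕ) : ℝ) ≤ 9 * L := by
    rw [Real.log_le_iff_le_exp (by positivity)]
    have h30 : (30 : ℝ) ≤ Real.exp L := by
      rw [← Real.log_le_iff_le_exp (by norm_num)]
      exact (le_max_right _ _).trans hL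
    calc ((30 * (A * B * C * D) * d : ℕ) : ℝ) = 30 * (A * B * C * D) * d := by push_cast; ring
      _ ≤ Real.exp L * (Real.exp L * Real.exp L * Real.exp L * Real.exp L) * Real.exp L ^ 4 := by
          gcongr
      _ = Real.exp L ^ 9 := by ring
      _ = Real.exp (9 * L) := by rw [← Real.exp_nat_mul]; norm_num
  have := h L ((le_max_left _ _).trans hL) (30 * (A * B * C * D) * d) (by positivity) hE
    (fun n => n * ((A * n) ^ 2 + B ^ 2) * ((C * n) ^ 2 + D ^ 2))
    (fun ℓ hℓ hℓE => exists_residues_five hℓ hℓE) X S hS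
    (fun p hp => ⟨(hSp p hp).2.1, fun ℓ hℓ hdvd => by
      obtain ⟨hpp, hT, hq, hq'⟩ := hSp p hp
      rcases hℓ.dvd_mul.mp hdvd with hd | hd
      · rcases hℓ.dvd_mul.mp hd with hd | hd
        · exact lt_prime_of_dvd_prime hT hpp hℓ hd
        · exact lt_prime_of_dvd_prime_sq_add_sq hA hT hq hℓ hd
      · exact lt_prime_of_dvd_prime_sq_add_sq hC hT hq' hℓ hd⟩)
  convert this using 3
  push_cast
  ring

theorem coprime_of_prime_sq_add_sq {a b : ℕ} (h : (a ^ 2 + b ^ 2).Prime) : Nat.Coprime a b := by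
  refine Nat.coprime_of_dvd fun k hk hka hkb => ?_
  have h1 : k * k ∣ a ^ 2 + b ^ 2 := by
    rw [← sq]
    exact dvd_add (pow_dvd_pow_of_dvd hka 2) (pow_dvd_pow_of_dvd hkb 2)
  exact hk.one_lt.ne' (Nat.isUnit_iff.mp (h.prime.squarefree k h1))

theorem swap_mem_Lset {ε N : ℝ} {a b : ℕ} (h : (a, b) ∈ Lset ε N) : (b, a) ∈ Lset ε N := by
  obtain ⟨h1, h2, h3, h4, h5, h6, h7, h8⟩ := h
  simp only at h1 h2 h3 h4 h5 h6 h7 h8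
  rw [mul_comm] at h3 h4 h6
  rw [add_comm] at h5
  exact ⟨h2, h1, h3, h4, h5, h6, h8, h7⟩

theorem exists_prime_of_mem_Lset {ε N : ℝ} {a b : ℕ} (h : (a, b) ∈ Lset ε N) :
    ∃ p : ℕ, p.Prime ∧ N ^ (1 / Real.log (Real.log N)) < p ∧ p ∣ a * b := by
  obtain ⟨h1, h2, h3, -, -, h6, -, -⟩ := h
  simp only at h1 h2 h3 h6
  rw [maxPrimeFac, if_neg (by omega)] at h6
  obtain ⟨p, hp, hp'⟩ := Finset.exists_mem_eq_sup _ (Nat.nonempty_primeFactors.mpr h3) id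
  rw [hp'] at h6
  exact ⟨p, Nat.prime_of_mem_primeFactors hp, h6, Nat.dvd_of_mem_primeFactors hp⟩

theorem le_floor_of_mem_Lset {ε N : ℝ} {a b : ℕ} (h : (a, b) ∈ Lset ε N) :
    a ∈ Finset.Icc 1 ⌊N⌋₊ ∧ b ∈ Finset.Icc 1 ⌊N⌋₊ := by
  obtain ⟨h1, h2, -, h4, -⟩ := h
  simp only at h1 h2 h4
  have h5 := Nat.le_floor h4
  rw [Finset.mem_Icc, Finset.mem_Icc]
  exact ⟨⟨h1, (Nat.le_mul_of_pos_right a h2).trans h5⟩,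
    ⟨h2, (Nat.le_mul_of_pos_left b h1).trans h5⟩⟩

/-- The quadruples to be counted. -/
def multQuadruples (ε N : ℝ) : Set (ℕ × ℕ × ℕ × ℕ) :=
  {q | q.1 * q.2.1 = q.2.2.1 * q.2.2.2 ∧
    (q.1, q.2.1) ∈ Lset ε N ∧ (q.2.2.1, q.2.2.2) ∈ Lset ε N}

/-- The quadruples in which the first and third entry share a large prime factor. -/
def alignedQuadruples (ε N : ℝ) : Set (ℕ × ℕ × ℕ × ℕ) :=
  {q ∈ multQuadruples ε N | ∃ p : ℕ, p.Prime ∧ N ^ (1 / Real.log (Real.log N)) < p ∧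
    p ∣ q.1 ∧ p ∣ q.2.2.1}

theorem multQuadruples_finite (ε N : ℝ) : (multQuadruples ε N).Finite := by
  let I := Finset.Icc 1 ⌊N⌋₊
  refine (I ×ˢ I ×ˢ I ×ˢ I).finite_toSet.subset ?_
  rintro ⟨a, b, c, d⟩ ⟨-, h1, h2⟩
  have h3 := le_floor_of_mem_Lset h1
  have h4 := le_floor_of_mem_Lset h2
  simp only [Finset.coe_product, Set.mem_prod, Finset.mem_coe]
  exact ⟨h3.1, h3.2, h4.1, h4.2⟩

theorem ncard_multQuadruples_le (ε N : ℝ) :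
    (multQuadruples ε N).ncard ≤ 4 * (alignedQuadruples ε N).ncard := by
  set S := alignedQuadruples ε N with hS
  have hfin : S.Finite := (multQuadruples_finite ε N).subset (Set.sep_subset _ _)
  let f : ℕ × ℕ × ℕ × ℕ → ℕ × ℕ × ℕ × ℕ := fun q => (q.2.1, q.1, q.2.2.1, q.2.2.2)
  let g : ℕ × ℕ × ℕ × ℕ → ℕ × ℕ × ℕ × ℕ := fun q => (q.1, q.2.1, q.2.2.2, q.2.2.1)
  have hsub : multQuadruples ε N ⊆ (S ∪ f '' S) ∪ (g '' S ∪ f '' (g '' S)) := by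
    rintro ⟨a, b, c, d⟩ ⟨h, h1, h2⟩
    simp only at h h1 h2
    obtain ⟨p, hp, hpT, hpd⟩ := exists_prime_of_mem_Lset h1
    have hpd' := hpd
    rw [h] at hpd'
    rcases hp.dvd_mul.mp hpd with ha | hb <;> rcases hp.dvd_mul.mp hpd' with hc | hd
    · exact Or.inl (Or.inl ⟨⟨h, h1, h2⟩, p, hp, hpT, ha, hc⟩)
    · exact Or.inr (Or.inl ⟨(a, b, d, c),
        ⟨⟨by simpa [mul_comm d] using h, h1, swap_mem_Lset h2⟩, p, hp, hpT, ha, hd⟩, rfl⟩)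
    · exact Or.inl (Or.inr ⟨(b, a, c, d),
        ⟨⟨by simpa [mul_comm b] using h, swap_mem_Lset h1, h2⟩, p, hp, hpT, hb, hc⟩, rfl⟩)
    · exact Or.inr (Or.inr ⟨(b, a, c, d), ⟨(b, a, d, c),
        ⟨⟨by simpa [mul_comm b, mul_comm d] using h, swap_mem_Lset h1, swap_mem_Lset h2⟩,
          p, hp, hpT, hb, hd⟩, rfl⟩, rfl⟩)
  have hg := hfin.image g
  have h1 := Set.ncard_le_ncard hsub ((hfin.union (hfin.image f)).union (hg.union (hg.image f)))
  have h2 := Set.ncard_union_le (S ∪ f '' S) (g '' S ∪ f '' (g '' S))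
  have h3 := Set.ncard_union_le S (f '' S)
  have h4 := Set.ncard_union_le (g '' S) (f '' (g '' S))
  have h5 := Set.ncard_image_le (f := f) hfin
  have h6 := Set.ncard_image_le (f := g) hfin
  have h7 := Set.ncard_image_le (f := f) hg
  omega

theorem exists_decomposition {a b c d p : ℕ} (ha : 0 < a) (hb : 0 < b) (h : a * b = c * d)
    (hcd : Nat.Coprime c d) (hpa : p ∣ a) (hpc : p ∣ c) :
    ∃ m s t u : ℕ, a = p * m * s ∧ b = t * u ∧ c = p * m * t ∧ d = s * u ∧ (s = t → s = 1) ∧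
      Nat.Coprime m s ∧ Nat.Coprime t u := by
  obtain ⟨m, hm⟩ := Nat.dvd_gcd hpa hpc
  obtain ⟨s, t, hst, has, hct⟩ := Nat.exists_coprime a c
  rw [hm] at has hct
  have hr : 0 < p * m := by
    rcases Nat.eq_zero_or_pos (p * m) with h0 | h0
    · rw [h0, mul_zero] at has; omega
    · exact h0
  have h1 : s * b = t * d := by
    rw [has, hct] at h
    exact Nat.eq_of_mul_eq_mul_left hr (by linarith)
  obtain ⟨u, hu⟩ : t ∣ b := hst.symm.dvd_of_dvd_mul_left (Dvd.intro d h1.symm)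
  have ht : 0 < t := by
    rcases Nat.eq_zero_or_pos t with h0 | h0
    · rw [hu, h0, zero_mul] at hb; omega
    · exact h0
  have hd : d = s * u := by
    rw [hu] at h1
    exact Nat.eq_of_mul_eq_mul_left ht (by linarith)
  refine ⟨m, s, t, u, by rw [has, mul_comm], hu, by rw [hct, mul_comm], hd, ?_, ?_, ?_⟩
  · rintro rfl
    exact (Nat.coprime_self s).mp hst
  · exact (hcd.coprime_dvd_left (Dvd.intro_left (t * p) (by rw [hct]; ring))).coprime_dvd_right
      (Dvd.intro u hd.symm)
  · exact (hcd.coprime_dvd_left (Dvd.intro (p * m) hct.symm)).coprime_dvd_right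
      (Dvd.intro_left s hd.symm)

/-- The primes `p` in `(T, X]` for which `(A p)² + B²` and `(C p)² + D²` are both prime. -/
noncomputable def formPrimes (T : ℝ) (X A B C D : ℕ) : Finset ℕ :=
  (Finset.Ioc 0 X).filter fun p => p.Prime ∧ T < p ∧ ((A * p) ^ 2 + B ^ 2).Prime ∧
    ((C * p) ^ 2 + D ^ 2).Prime

/-- The parameters `(m, s, t, u)` for which some `(p m s, t u, p m t, s u)` may be aligned. -/
noncomputable def decompositionIndex (ε N : ℝ) : Finset (ℕ × ℕ × ℕ × ℕ) :=
  (Finset.Icc 1 ⌊N⌋₊ ×ˢ Finset.Icc 1 ⌊N⌋₊ ×ˢ Finset.Icc 1 ⌊N⌋₊ ×ˢ Finset.Icc 1 ⌊N⌋₊).filter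
    fun x => x.1 * x.2.1 * x.2.2.1 * x.2.2.2 ≤ ⌊N⌋₊ ∧ (x.2.1 = x.2.2.1 → x.2.1 = 1) ∧
      (x.1.primeFactors.card + x.2.1.primeFactors.card : ℝ) ≤ (1 + ε) * Real.log (Real.log N) ∧
      (x.2.2.1.primeFactors.card + x.2.2.2.primeFactors.card : ℝ) ≤
        (1 + ε) * Real.log (Real.log N)

theorem ncard_alignedQuadruples_le (ε N : ℝ) :
    (alignedQuadruples ε N).ncard ≤ ∑ x ∈ decompositionIndex ε N,
        (formPrimes (N ^ (1 / Real.log (Real.log N))) (⌊N⌋₊ / (x.1 * x.2.1 * x.2.2.1 * x.2.2.2))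
          (x.1 * x.2.1) (x.2.2.1 * x.2.2.2) (x.1 * x.2.2.1) (x.2.1 * x.2.2.2)).card := by
  classical
  set T := N ^ (1 / Real.log (Real.log N))
  set I := Finset.Icc 1 ⌊N⌋₊ with hI
  set P : ℕ × ℕ × ℕ × ℕ → Finset ℕ := fun x =>
    formPrimes T (⌊N⌋₊ / (x.1 * x.2.1 * x.2.2.1 * x.2.2.2))
      (x.1 * x.2.1) (x.2.2.1 * x.2.2.2) (x.1 * x.2.2.1) (x.2.1 * x.2.2.2) with hP
  let f : ℕ × ℕ × ℕ × ℕ → ℕ → ℕ × ℕ × ℕ × ℕ := fun x p =>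
    (p * x.1 * x.2.1, x.2.2.1 * x.2.2.2, p * x.1 * x.2.2.1, x.2.1 * x.2.2.2)
  have hsub : alignedQuadruples ε N ⊆ ((decompositionIndex ε N).biUnion fun x => (P x).image (f x) : Finset _) := by
    rintro ⟨a, b, c, d⟩ ⟨⟨h, h1, h2⟩, p, hp, hpT, hpa, hpc⟩
    simp only at h h1 h2 hpa hpc
    obtain ⟨ha, hb, -, hN, hq, -, hωa, hωb⟩ := h1
    obtain ⟨hc, hd, -, -, hq', -, -, -⟩ := h2
    simp only at ha hb hN hq hωa hωb hc hd hq'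
    obtain ⟨m, s, t, u, rfl, rfl, rfl, rfl, hst, hms, htu⟩ := exists_decomposition ha hb h
      (coprime_of_prime_sq_add_sq hq') hpa hpc
    have hm0 : 0 < m := Nat.pos_of_ne_zero (by rintro rfl; simp at ha)
    have hs0 : 0 < s := Nat.pos_of_ne_zero (by rintro rfl; simp at ha)
    have ht0 : 0 < t := Nat.pos_of_ne_zero (by rintro rfl; simp at hb)
    have hu0 : 0 < u := Nat.pos_of_ne_zero (by rintro rfl; simp at hb)
    have hN' : p * (m * s * t * u) ≤ ⌊N⌋₊ := by
      refine (le_of_eq (by ring)).trans (Nat.le_floor hN)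
    have hprod : m * s * t * u ≤ ⌊N⌋₊ := (Nat.le_mul_of_pos_left _ hp.pos).trans hN'
    have hle : ∀ k : ℕ, 0 < k → k ∣ m * s * t * u → k ∈ I := fun k hk hkd => by
      rw [hI, Finset.mem_Icc]
      exact ⟨hk, (Nat.le_of_dvd (by positivity) hkd).trans hprod⟩
    simp only [Finset.coe_biUnion, Set.mem_iUnion, Finset.mem_coe, Finset.mem_image]
    refine ⟨(m, s, t, u), ?_, p, ?_, rfl⟩
    · refine Finset.mem_filter.mpr ⟨?_, hprod, hst, ?_, ?_⟩
      · simp only [Finset.mem_product]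
        exact ⟨hle m hm0 (Dvd.intro (s * t * u) (by ring)),
          hle s hs0 (Dvd.intro (m * t * u) (by ring)),
          hle t ht0 (Dvd.intro (m * s * u) (by ring)), hle u hu0 (Dvd.intro_left _ rfl)⟩
      · refine le_trans ?_ hωa
        have h3 : (m * s).primeFactors ⊆ (p * m * s).primeFactors :=
          Nat.primeFactors_mono (Dvd.intro_left p (by ring)) ha.ne'
        have h4 := Finset.card_le_card h3
        rw [hms.primeFactors_mul, Finset.card_union_of_disjoint hms.disjoint_primeFactors] at h4
        exact_mod_cast h4
      · refine le_trans (le_of_eq ?_) hωb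
        rw [htu.primeFactors_mul, Finset.card_union_of_disjoint htu.disjoint_primeFactors]
        push_cast; rfl
    · refine Finset.mem_filter.mpr ⟨Finset.mem_Ioc.mpr ⟨hp.pos, ?_⟩, hp, hpT, ?_, ?_⟩
      · rw [Nat.le_div_iff_mul_le (by positivity)]
        exact hN'
      · convert hq using 3; simp only; ring
      · convert hq' using 3; simp only; ring
  have h1 := Set.ncard_le_ncard hsub (Finset.finite_toSet _)
  rw [Set.ncard_coe_finset] at h1
  exact h1.trans (Finset.card_biUnion_le.trans (Finset.sum_le_sum fun x _ => Finset.card_image_le))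

theorem sum_product_mul_four {α β : Type*} [CommSemiring β] (I : Finset α) (f g h k : α → β) :
    ∑ x ∈ I ×ˢ I ×ˢ I ×ˢ I, f x.1 * g x.2.1 * h x.2.2.1 * k x.2.2.2 =
      (∑ x ∈ I, f x) * (∑ x ∈ I, g x) * (∑ x ∈ I, h x) * ∑ x ∈ I, k x := by
  simp only [Finset.sum_product]
  simp only [← Finset.mul_sum, ← Finset.sum_mul]

theorem one_div_mul_four_le {m s t u : ℕ} {W : ℝ}
    (h1 : (m.primeFactors.card + s.primeFactors.card : ℝ) ≤ W)
    (h2 : (t.primeFactors.card + u.primeFactors.card : ℝ) ≤ W) :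
    1 / (m * s * t * u : ℝ) ≤ (4 : ℝ) ^ W * ((1 / 2) ^ m.primeFactors.card / m *
      ((1 / 2) ^ s.primeFactors.card / s) * ((1 / 2) ^ t.primeFactors.card / t) *
      ((1 / 2) ^ u.primeFactors.card / u)) := by
  set k := m.primeFactors.card + s.primeFactors.card + t.primeFactors.card + u.primeFactors.card
    with hk
  have h3 : (2 : ℝ) ^ k ≤ (4 : ℝ) ^ W := by
    have h4 : (4 : ℝ) = 2 ^ (2 : ℝ) := by norm_num
    rw [h4, ← Real.rpow_mul (by norm_num), ← Real.rpow_natCast]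
    refine Real.rpow_le_rpow_of_exponent_le (by norm_num) ?_
    rw [hk]; push_cast; linarith
  have h5 : (2 : ℝ) ^ k * (1 / 2) ^ k = 1 := by rw [← mul_pow]; norm_num
  calc 1 / (m * s * t * u : ℝ) = 2 ^ k * (1 / 2) ^ k * (1 / (m * s * t * u : ℝ)) := by
        rw [h5, one_mul]
    _ ≤ 4 ^ W * (1 / 2) ^ k * (1 / (m * s * t * u : ℝ)) := by gcongr
    _ = _ := by rw [hk, pow_add, pow_add, pow_add]; ring

theorem card_formPrimes_le {δ : ℝ} (h0 : 0 < δ) (h1 : δ < 1) :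
    ∃ K, 0 < K ∧ ∃ N₀ : ℝ, ∀ N : ℝ, N₀ ≤ N → ∀ ε : ℝ, ∀ x ∈ decompositionIndex ε N,
      ((formPrimes (N ^ (1 / Real.log (Real.log N)))
        (⌊N⌋₊ / (x.1 * x.2.1 * x.2.2.1 * x.2.2.2)) (x.1 * x.2.1) (x.2.2.1 * x.2.2.2)
        (x.1 * x.2.2.1) (x.2.1 * x.2.2.2)).card : ℝ) ≤
      K * N * (if x.2.1 = 1 ∧ x.2.2.1 = 1 then Real.log N ^ (-(2 - 15 * δ))
        else Real.log N ^ (-(3 - 25 * δ))) * (1 / (x.1 * x.2.1 * x.2.2.1 * x.2.2.2)) := by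
  obtain ⟨K₃, hK₃, L₃, h₃⟩ := card_primes_le_three h0 h1
  obtain ⟨K₅, hK₅, L₅, h₅⟩ := card_primes_le_five h0 h1
  refine ⟨K₃ + K₅, by positivity, max 3 (Real.exp (max L₃ L₅)), fun N hN ε x hx => ?_⟩
  obtain ⟨m, s, t, u⟩ := x
  have hN3 : 3 ≤ N := (le_max_left _ _).trans hN
  have hNpos : 0 < N := by linarith
  have hL : max L₃ L₅ ≤ Real.log N :=
    (Real.le_log_iff_exp_le hNpos).mpr ((le_max_right _ _).trans hN)
  have hlog : 0 < Real.log N := Real.log_pos (by linarith)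
  have hT : N ^ (1 / Real.log (Real.log N)) = Real.exp (Real.log N / Real.log (Real.log N)) := by
    rw [Real.rpow_def_of_pos hNpos, mul_one_div]
  have hexp : Real.exp (Real.log N) = N := Real.exp_log hNpos
  obtain ⟨hI, hprod, hst, -, -⟩ := Finset.mem_filter.mp hx
  simp only [Finset.mem_product, Finset.mem_Icc] at hI
  obtain ⟨⟨hm, -⟩, ⟨hs, -⟩, ⟨ht, -⟩, ⟨hu, -⟩⟩ := hI
  simp only at hprod hst hm hs ht hu
  have hle : ∀ k : ℕ, k ∣ m * s * t * u → (k : ℝ) ≤ Real.exp (Real.log N) := fun k hk => by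
    rw [hexp]
    have := (Nat.le_of_dvd (by positivity) hk).trans hprod
    exact (Nat.cast_le.mpr this).trans (Nat.floor_le hNpos.le)
  have hX : ((⌊N⌋₊ / (m * s * t * u) : ℕ) : ℝ) ≤ N * (1 / (m * s * t * u)) := by
    rw [mul_one_div]
    refine Nat.cast_div_le.trans ?_
    push_cast
    gcongr
    exact Nat.floor_le hNpos.le
  simp only
  rw [hT]
  set X := ⌊N⌋₊ / (m * s * t * u)
  have hmem : ∀ p ∈ formPrimes (Real.exp (Real.log N / Real.log (Real.log N))) X (m * s) (t * u)
      (m * t) (s * u), p.Prime ∧ Real.exp (Real.log N / Real.log (Real.log N)) < p ∧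
        (((m * s) * p) ^ 2 + (t * u) ^ 2).Prime ∧ (((m * t) * p) ^ 2 + (s * u) ^ 2).Prime :=
    fun p hp => (Finset.mem_filter.mp hp).2
  have hsub : formPrimes (Real.exp (Real.log N / Real.log (Real.log N))) X (m * s) (t * u)
      (m * t) (s * u) ⊆ Finset.Ioc 0 X := Finset.filter_subset _ _
  have hms := hle (m * s) (Dvd.intro (t * u) (by ring))
  have htu := hle (t * u) (Dvd.intro (m * s) (by ring))
  have hmt := hle (m * t) (Dvd.intro (s * u) (by ring))
  have hsu := hle (s * u) (Dvd.intro (m * t) (by ring))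
  split_ifs with hc
  · calc _ ≤ K₃ * X * Real.log N ^ (-(2 - 15 * δ)) :=
          h₃ _ ((le_max_left _ _).trans hL) (m * s) (t * u) (by positivity) (by positivity) hms htu
            X _ hsub fun p hp => ⟨(hmem p hp).1, (hmem p hp).2.1, (hmem p hp).2.2.1⟩
      _ ≤ (K₃ + K₅) * (N * (1 / (m * s * t * u))) * Real.log N ^ (-(2 - 15 * δ)) := by
          gcongr
          linarith
      _ = _ := by ring
  · have hne : s ≠ t := fun h => hc ⟨hst h, h ▸ hst h⟩
    have hne' : t * u * (m * t) ≠ m * s * (s * u) := by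
      intro h
      have h6 : (m * u) * t ^ 2 = (m * u) * s ^ 2 := by linarith
      have h7 := Nat.eq_of_mul_eq_mul_left (by positivity) h6
      exact hne (Nat.pow_left_injective two_ne_zero h7).symm
    calc _ ≤ K₅ * X * Real.log N ^ (-(3 - 25 * δ)) :=
          h₅ _ ((le_max_right _ _).trans hL) (m * s) (t * u) (m * t) (s * u) (by positivity)
            (by positivity) (by positivity) (by positivity) hms htu hmt hsu hne' X _ hsub hmem
      _ ≤ (K₃ + K₅) * (N * (1 / (m * s * t * u))) * Real.log N ^ (-(3 - 25 * δ)) := by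
          gcongr
          linarith
      _ = _ := by ring

theorem ncard_multQuadruples_le_rpow {δ : ℝ} (h0 : 0 < δ) (h1 : δ < 1) :
    ∃ C, 0 < C ∧ ∃ N₀ : ℝ, ∀ N : ℝ, N₀ ≤ N →
      ((multQuadruples δ N).ncard : ℝ) ≤
        C * N * Real.log N ^ ((1 + δ) * Real.log 4 - 1 + 29 * δ) := by
  obtain ⟨K, hK, N₀, h⟩ := card_formPrimes_le h0 h1
  obtain ⟨C, hC, hsum⟩ := sum_half_pow_card_primeFactors_div_le h0
  refine ⟨4 * (K * (C ^ 4 + C ^ 2)), by positivity, max N₀ 3, fun N hN => ?_⟩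
  have hN3 : 3 ≤ N := (le_max_right _ _).trans hN
  set L := Real.log N with hL
  have hL1 : 1 < L := by
    rw [hL, Real.lt_log_iff_exp_lt (by linarith)]
    linarith [Real.exp_one_lt_d9]
  have hLpos : 0 < L := by linarith
  set I := Finset.Icc 1 ⌊N⌋₊ with hI
  set v : ℕ → ℝ := fun n => (1 / 2 : ℝ) ^ n.primeFactors.card / n with hv
  have hv0 : ∀ n, 0 ≤ v n := fun n => by positivity
  have hH : ∑ n ∈ I, v n ≤ C * L ^ (1 / 2 + δ) := hsum N hN3
  have hH0 : 0 ≤ ∑ n ∈ I, v n := Finset.sum_nonneg fun n _ => hv0 n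
  set G : ℝ := (4 : ℝ) ^ ((1 + δ) * Real.log L) with hG
  have hG' : G = L ^ ((1 + δ) * Real.log 4) := by
    rw [hG, Real.rpow_def_of_pos (by norm_num), Real.rpow_def_of_pos hLpos]
    congr 1; ring
  let o : ℕ → ℝ := fun n => if n = 1 then 1 else 0
  have ho : ∑ n ∈ I, o n ≤ 1 := by
    rw [Finset.sum_ite_eq']
    split_ifs <;> norm_num
  have ho0 : ∀ n, 0 ≤ o n := fun n => by simp only [o]; split_ifs <;> norm_num
  have hoS : 0 ≤ ∑ n ∈ I, o n := Finset.sum_nonneg fun n _ => ho0 n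
  have hterm : ∀ x ∈ decompositionIndex δ N,
      ((formPrimes (N ^ (1 / Real.log (Real.log N)))
        (⌊N⌋₊ / (x.1 * x.2.1 * x.2.2.1 * x.2.2.2)) (x.1 * x.2.1) (x.2.2.1 * x.2.2.2)
        (x.1 * x.2.2.1) (x.2.1 * x.2.2.2)).card : ℝ) ≤
      K * N * L ^ (-(3 - 25 * δ)) * G * (v x.1 * v x.2.1 * v x.2.2.1 * v x.2.2.2) +
      K * N * L ^ (-(2 - 15 * δ)) * G * (v x.1 * o x.2.1 * o x.2.2.1 * v x.2.2.2) := by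
    intro x hx
    refine (h N ((le_max_left _ _).trans hN) δ x hx).trans ?_
    obtain ⟨-, -, -, hω1, hω2⟩ := Finset.mem_filter.mp hx
    have h2 := one_div_mul_four_le hω1 hω2
    have hvv : 0 ≤ v x.1 * v x.2.1 * v x.2.2.1 * v x.2.2.2 := by
      have := hv0 x.1; have := hv0 x.2.1; have := hv0 x.2.2.1; have := hv0 x.2.2.2
      positivity
    have hvo : 0 ≤ v x.1 * o x.2.1 * o x.2.2.1 * v x.2.2.2 := by
      have := hv0 x.1; have := ho0 x.2.1; have := ho0 x.2.2.1; have := hv0 x.2.2.2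
      positivity
    split_ifs with hc
    · have h3 : v x.1 * o x.2.1 * o x.2.2.1 * v x.2.2.2 =
          v x.1 * v x.2.1 * v x.2.2.1 * v x.2.2.2 := by
        simp [hc.1, hc.2, o, hv]
      refine le_trans ?_ (le_add_of_nonneg_left (by positivity))
      rw [h3, mul_assoc _ G]
      gcongr
    · refine le_trans ?_ (le_add_of_nonneg_right (by positivity))
      rw [mul_assoc _ G]
      gcongr
  have hmain : ((alignedQuadruples δ N).ncard : ℝ) ≤
      K * N * L ^ (-(3 - 25 * δ)) * G * (C * L ^ (1 / 2 + δ)) ^ 4 +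
      K * N * L ^ (-(2 - 15 * δ)) * G * (C * L ^ (1 / 2 + δ)) ^ 2 := by
    calc ((alignedQuadruples δ N).ncard : ℝ) ≤ _ := Nat.cast_le.mpr (ncard_alignedQuadruples_le δ N)
      _ = _ := Nat.cast_sum _ _
      _ ≤ _ := Finset.sum_le_sum hterm
      _ ≤ ∑ x ∈ I ×ˢ I ×ˢ I ×ˢ I,
          (K * N * L ^ (-(3 - 25 * δ)) * G * (v x.1 * v x.2.1 * v x.2.2.1 * v x.2.2.2) +
          K * N * L ^ (-(2 - 15 * δ)) * G * (v x.1 * o x.2.1 * o x.2.2.1 * v x.2.2.2)) := by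
          refine Finset.sum_le_sum_of_subset_of_nonneg (Finset.filter_subset _ _) fun x _ _ => ?_
          have := hv0 x.1; have := hv0 x.2.1; have := hv0 x.2.2.1; have := hv0 x.2.2.2
          have := ho0 x.2.1; have := ho0 x.2.2.1
          positivity
      _ = K * N * L ^ (-(3 - 25 * δ)) * G *
            ((∑ n ∈ I, v n) * (∑ n ∈ I, v n) * (∑ n ∈ I, v n) * ∑ n ∈ I, v n) +
          K * N * L ^ (-(2 - 15 * δ)) * G *
            ((∑ n ∈ I, v n) * (∑ n ∈ I, o n) * (∑ n ∈ I, o n) * ∑ n ∈ I, v n) := by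
          rw [Finset.sum_add_distrib, ← Finset.mul_sum, ← Finset.mul_sum, sum_product_mul_four,
            sum_product_mul_four]
      _ ≤ K * N * L ^ (-(3 - 25 * δ)) * G *
            (C * L ^ (1 / 2 + δ) * (C * L ^ (1 / 2 + δ)) * (C * L ^ (1 / 2 + δ)) *
              (C * L ^ (1 / 2 + δ))) +
          K * N * L ^ (-(2 - 15 * δ)) * G *
            (C * L ^ (1 / 2 + δ) * 1 * 1 * (C * L ^ (1 / 2 + δ))) := by gcongr
      _ = _ := by ring
  have hpow4 : L ^ (-(3 - 25 * δ)) * G * (L ^ (1 / 2 + δ)) ^ 4 =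
      L ^ ((1 + δ) * Real.log 4 - 1 + 29 * δ) := by
    rw [hG', ← Real.rpow_mul_natCast hLpos.le, ← Real.rpow_add hLpos, ← Real.rpow_add hLpos]
    congr 1; push_cast; ring
  have hpow2 : L ^ (-(2 - 15 * δ)) * G * (L ^ (1 / 2 + δ)) ^ 2 ≤
      L ^ ((1 + δ) * Real.log 4 - 1 + 29 * δ) := by
    rw [hG', ← Real.rpow_mul_natCast hLpos.le, ← Real.rpow_add hLpos, ← Real.rpow_add hLpos]
    refine Real.rpow_le_rpow_of_exponent_le hL1.le ?_
    push_cast; linarith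
  have h4 : ((multQuadruples δ N).ncard : ℝ) ≤ 4 * (alignedQuadruples δ N).ncard := by
    exact_mod_cast ncard_multQuadruples_le δ N
  calc ((multQuadruples δ N).ncard : ℝ) ≤ 4 * (alignedQuadruples δ N).ncard := h4
    _ ≤ 4 * (K * N * L ^ (-(3 - 25 * δ)) * G * (C * L ^ (1 / 2 + δ)) ^ 4 +
          K * N * L ^ (-(2 - 15 * δ)) * G * (C * L ^ (1 / 2 + δ)) ^ 2) := by gcongr
    _ = 4 * (K * N * (C ^ 4 * (L ^ (-(3 - 25 * δ)) * G * (L ^ (1 / 2 + δ)) ^ 4) +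
          C ^ 2 * (L ^ (-(2 - 15 * δ)) * G * (L ^ (1 / 2 + δ)) ^ 2))) := by ring
    _ ≤ 4 * (K * N * (C ^ 4 * L ^ ((1 + δ) * Real.log 4 - 1 + 29 * δ) +
          C ^ 2 * L ^ ((1 + δ) * Real.log 4 - 1 + 29 * δ))) := by
        rw [hpow4]
        gcongr
    _ = _ := by ring

theorem stmt_16 (c' : ℝ) (hc' : Real.log 4 - 1 < c') :
    ∃ ε C : ℝ, 0 < ε ∧ 0 < C ∧ ∃ N₀ : ℝ, ∀ N : ℝ, N₀ ≤ N →
      ({q : ℕ × ℕ × ℕ × ℕ | q.1 * q.2.1 = q.2.2.1 * q.2.2.2 ∧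
          (q.1, q.2.1) ∈ Lset ε N ∧ (q.2.2.1, q.2.2.2) ∈ Lset ε N}.ncard : ℝ)
        ≤ C * N * Real.log N ^ c' := by
  set η := c' - (Real.log 4 - 1) with hη
  have hη0 : 0 < η := sub_pos.mpr hc'
  set δ := min (1 / 2) (η / 31) with hδ
  have h0 : 0 < δ := by positivity
  have h1 : δ < 1 := (min_le_left _ _).trans_lt (by norm_num)
  have h2 : 31 * δ ≤ η := by linarith [min_le_right (1 / 2) (η / 31)]
  have hlog4 : Real.log 4 ≤ 2 := by
    rw [show (4 : ℝ) = 2 ^ 2 by norm_num, Real.log_pow]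
    push_cast
    linarith [Real.log_two_lt_d9]
  obtain ⟨C, hC, N₀, h⟩ := ncard_multQuadruples_le_rpow h0 h1
  refine ⟨δ, C, h0, hC, max N₀ 3, fun N hN => ?_⟩
  have hN3 : 3 ≤ N := (le_max_right _ _).trans hN
  have hL1 : 1 ≤ Real.log N := by
    rw [Real.le_log_iff_exp_le (by linarith)]
    linarith [Real.exp_one_lt_d9]
  refine (h N ((le_max_left _ _).trans hN)).trans ?_
  gcongr
  nlinarith
end
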